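/- Let p ≥ 1 be an integer and a > 2p a real number. Assume (ε_n) is a martingale difference sequence with E[ε_{n+1}² | F_n] = σ² a.s. for all n and sup_{n≥0} E[|ε_{n+1}|^a | F_n] < ∞ a.s. Assume the explosion coefficient f_n tends to zero a.s. and that there exists a positive random sequence (α_n) increasing to infinity and a symmetric positive definite d×d matrix L such that S_n/α_n → L a.s. With g_n = M_n^t S_{n-1}^{-1} Φ_n, β_n = tr(L^{-1/2} S_n L^{-1/2}), and m_n = β_{n-1}^{-1} M_n^t L^{-1} M_n, one has almost surely lim_{n→∞} (1/log d_n) Σ_{k=1}^n (1 − f_k) g_k² m_k^{p−1} = λ(p)/(p d^{p−1}), where λ(p) = (p/d) ℓ(p) and ℓ(p) = d σ^{2p} ∏_{j=1}^{p-1} (d + 2j). -/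

import Mathlib

open MeasureTheory ProbabilityTheory Filter Finset Matrix Topology

noncomputable section

/-- `S_n = S + ∑_{k=0}^n Φ_k Φ_kᵗ`. -/
def Smat {Ω : Type*} {d : ℕ} (S : Matrix (Fin d) (Fin d) ℝ)
    (Φ : ℕ → Ω → Fin d → ℝ) (n : ℕ) (ω : Ω) : Matrix (Fin d) (Fin d) ℝ :=
  S + ∑ k ∈ Finset.range (n + 1), vecMulVec (Φ k ω) (Φ k ω)

/-- The explosion coefficient `f_n = Φ_nᵗ S_n⁻¹ Φ_n`. -/
def expl {Ω : Type*} {d : ℕ} (S : Matrix (Fin d) (Fin d) ℝ)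
    (Φ : ℕ → Ω → Fin d → ℝ) (n : ℕ) (ω : Ω) : ℝ :=
  Φ n ω ⬝ᵥ ((Smat S Φ n ω)⁻¹ *ᵥ Φ n ω)

/-- The vector martingale transform `M_n = M_0 + ∑_{k=1}^n Φ_{k-1} ε_k`. -/
def Mart {Ω : Type*} {d : ℕ} (M0 : Ω → Fin d → ℝ) (Φ : ℕ → Ω → Fin d → ℝ)
    (ε : ℕ → Ω → ℝ) (n : ℕ) (ω : Ω) : Fin d → ℝ :=
  M0 ω + ∑ k ∈ Finset.range n, ε (k + 1) ω • Φ k ω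

/-- `ℓ(p) = d σ^{2p} ∏_{j=1}^{p-1} (d + 2j)`. -/
def elllim (d p : ℕ) (σ : ℝ) : ℝ :=
  (d : ℝ) * σ ^ (2 * p) * ∏ j ∈ Finset.Icc 1 (p - 1), ((d : ℝ) + 2 * (j : ℝ))

section partA
lemma vbe1 {r : ℝ} (hr1 : 1 < r) (hr2 : r ≤ 2) (u : ℝ) :
    |1 + u| ^ r ≤ 1 + r * u + 6 * |u| ^ r := by
  by_cases hu : |u| ≤ 1
  · have h1 : 0 ≤ 1 + u := by linarith [(abs_le.1 hu).1]
    rw [abs_of_nonneg h1]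
    have e1 : (1 + u) ^ r = (1 + u) * (1 + u) ^ (r - 1) := by
      have := Real.rpow_add_of_nonneg h1 zero_le_one (by linarith : (0:ℝ) ≤ r - 1)
      rw [Real.rpow_one] at this
      rw [← this]; congr 1; ring
    have e2 : (1 + u) ^ (r - 1) ≤ 1 + (r - 1) * u :=
      rpow_one_add_le_one_add_mul_self (by linarith) (by linarith) (by linarith)
    have e3 : u ^ 2 ≤ |u| ^ r := by
      rcases eq_or_lt_of_le (abs_nonneg u) with h | h
      · have : u = 0 := abs_eq_zero.1 h.symm
        subst this; simp [Real.zero_rpow (by linarith : r ≠ 0)]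
      · have := Real.rpow_le_rpow_of_exponent_ge h hu hr2
        rw [Real.rpow_two, sq_abs] at this; exact this
    have e4 := mul_le_mul_of_nonneg_left e2 h1
    rw [e1]
    nlinarith [sq_nonneg u, Real.rpow_nonneg (abs_nonneg u) r]
  · push Not at hu
    have h0 : (0:ℝ) ≤ |u| := abs_nonneg u
    have e1 : |1 + u| ≤ 2 * |u| := by
      calc |1 + u| ≤ |1| + |u| := abs_add_le _ _
        _ ≤ _ := by rw [abs_one]; linarith
    have e2 : |1 + u| ^ r ≤ (2 * |u|) ^ r := Real.rpow_le_rpow (abs_nonneg _) e1 (by linarith)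
    rw [Real.mul_rpow (by norm_num) h0] at e2
    have e3 : (2:ℝ) ^ r ≤ 4 := by
      calc (2:ℝ) ^ r ≤ 2 ^ (2:ℝ) := Real.rpow_le_rpow_of_exponent_le (by norm_num) hr2
        _ = 4 := by norm_num
    have e4 : |u| ≤ |u| ^ r := by
      calc |u| = |u| ^ (1:ℝ) := by simp
        _ ≤ _ := Real.rpow_le_rpow_of_exponent_le hu.le hr1.le
    have e5 := neg_abs_le u
    have e6 := mul_le_mul_of_nonneg_right e3 (Real.rpow_nonneg h0 r)
    nlinarith

lemma vbe {r : ℝ} (hr1 : 1 < r) (hr2 : r ≤ 2) (x y : ℝ) :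
    |x + y| ^ r ≤ |x| ^ r + r * (x * |x| ^ (r - 2)) * y + 6 * |y| ^ r := by
  by_cases hx : x = 0
  · subst hx
    have := Real.rpow_nonneg (abs_nonneg y) r
    simp [Real.zero_rpow (by linarith : r ≠ 0)]; linarith
  · have hx' : 0 < |x| := abs_pos.2 hx
    have h := vbe1 hr1 hr2 (y / x)
    have e1 : |x + y| = |x| * |1 + y / x| := by rw [← abs_mul]; congr 1; field_simp
    have e2 : |y| = |x| * |y / x| := by rw [← abs_mul]; congr 1; field_simp
    have e3 : (x * |x| ^ (r - 2)) * y = |x| ^ r * (y / x) := by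
      rw [Real.rpow_sub hx', Real.rpow_two, sq_abs]; field_simp
    rw [mul_assoc r, e3, e1, e2, Real.mul_rpow hx'.le (abs_nonneg _),
      Real.mul_rpow hx'.le (abs_nonneg _)]
    have := mul_le_mul_of_nonneg_left h (Real.rpow_nonneg hx'.le r)
    linarith

lemma bern {r : ℝ} (hr1 : 1 < r) (hr2 : r ≤ 2) (n : ℕ) :
    ∃ C : ℝ, 0 ≤ C ∧ ∀ u : ℝ, -1 ≤ u → u ≤ 3 →
      (1 + u) ^ (n + r) ≤ 1 + (n + r) * u + C * u ^ 2 := by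
  induction n with
  | zero =>
    refine ⟨1, zero_le_one, fun u h1 h3 => ?_⟩
    have h1 : 0 ≤ 1 + u := by linarith
    have e1 : (1 + u) ^ r = (1 + u) * (1 + u) ^ (r - 1) := by
      have := Real.rpow_add_of_nonneg h1 zero_le_one (by linarith : (0:ℝ) ≤ r - 1)
      rw [Real.rpow_one] at this
      rw [← this]; congr 1; ring
    have e2 : (1 + u) ^ (r - 1) ≤ 1 + (r - 1) * u :=
      rpow_one_add_le_one_add_mul_self (by linarith) (by linarith) (by linarith)
    have e4 := mul_le_mul_of_nonneg_left e2 h1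
    simp only [Nat.cast_zero, zero_add]
    rw [e1]
    nlinarith [sq_nonneg u]
  | succ n ih =>
    obtain ⟨C, hC, ih⟩ := ih
    have hn : (0:ℝ) ≤ n := Nat.cast_nonneg n
    refine ⟨n + r + 4 * C, by linarith, fun u h1 h3 => ?_⟩
    have h0 : 0 ≤ 1 + u := by linarith
    have e1 : (1 + u) ^ ((n + 1 : ℕ) + r) = (1 + u) * (1 + u) ^ (n + r) := by
      have := Real.rpow_add_of_nonneg h0 zero_le_one (by linarith : (0:ℝ) ≤ n + r)
      rw [Real.rpow_one] at this
      rw [← this]; congr 1; push_cast; ring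
    have e4 := mul_le_mul_of_nonneg_left (ih u h1 h3) h0
    rw [e1]
    have : C * u ^ 2 * u ≤ C * u ^ 2 * 3 := mul_le_mul_of_nonneg_left h3 (by positivity)
    push_cast
    nlinarith [sq_nonneg u]

lemma quad_nonneg {A B c e : ℝ} (hA : 0 ≤ A) (hc : 0 ≤ c) (hB : B ^ 2 ≤ 4 * A * c) :
    |B * e| ≤ 2 * (√A * (√c * |e|)) := by
  have h1 : |B| ≤ 2 * (√A * √c) := by
    apply abs_le_of_sq_le_sq _ (by positivity)
    rw [mul_pow, mul_pow, Real.sq_sqrt hA, Real.sq_sqrt hc]; linarith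
  rw [abs_mul]
  have := mul_le_mul_of_nonneg_right h1 (abs_nonneg e)
  linarith

lemma qineq {r : ℝ} (hr1 : 1 < r) (hr2 : r ≤ 2) (n : ℕ) :
    ∃ K : ℝ, 0 ≤ K ∧ ∀ A B c e : ℝ, 0 ≤ A → 0 ≤ c → B ^ 2 ≤ 4 * A * c →
      (A + B * e + c * e ^ 2) ^ (n + r) ≤ A ^ (n + r) + (n + r) * A ^ (n + r - 1) * B * e
        + K * (A ^ (n + r - 1) * c * e ^ 2 + c ^ (n + r) * |e| ^ (2 * (n + r))) := by
  obtain ⟨C, hC, hb⟩ := bern hr1 hr2 n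
  have hn : (0:ℝ) ≤ n := Nat.cast_nonneg n
  set q : ℝ := n + r with hq
  have hq1 : 1 < q := by linarith
  refine ⟨q + 9 * C + 4 ^ q + 2 * q, by positivity, fun A B c e hA hc hB => ?_⟩
  have hBe := quad_nonneg (e := e) hA hc hB
  set x := √A with hx
  set s := √c * |e| with hs
  have hx0 : 0 ≤ x := Real.sqrt_nonneg _
  have hs0 : 0 ≤ s := by positivity
  have hAx : A = x ^ 2 := (Real.sq_sqrt hA).symm
  have hss : c * e ^ 2 = s ^ 2 := by rw [hs, mul_pow, Real.sq_sqrt hc, sq_abs]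
  have hnn : 0 ≤ A + B * e + c * e ^ 2 := by
    rw [hss, hAx]; nlinarith [(abs_le.1 hBe).1, sq_nonneg (x - s)]
  have hcq : c ^ q * |e| ^ (2 * q) = (s ^ 2) ^ q := by
    rw [← hss, Real.mul_rpow hc (sq_nonneg e), Real.rpow_mul (abs_nonneg e), Real.rpow_two, sq_abs]
  have hA1 : 0 ≤ A ^ (q - 1) := Real.rpow_nonneg hA _
  have hS1 : 0 ≤ (s ^ 2) ^ q := Real.rpow_nonneg (sq_nonneg s) _
  rw [hcq, mul_assoc (A ^ (q - 1)), hss]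
  have h4 : (0:ℝ) ≤ 4 ^ q := by positivity
  by_cases hcase : s ≤ x
  · rcases eq_or_lt_of_le hx0 with h0 | h0
    · have hs' : s = 0 := le_antisymm (by linarith) hs0
      have hA' : A = 0 := by rw [hAx, ← h0]; simp
      have hB0 : B * e = 0 := by
        rw [hs', mul_zero, mul_zero] at hBe; exact abs_nonpos_iff.1 hBe
      have hq0 : q ≠ 0 := by linarith
      rw [hs', hA', mul_assoc, hB0]; simp [Real.zero_rpow hq0]
    · have hApos : 0 < A := by rw [hAx]; positivity
      have hu := hb ((B * e + s ^ 2) / A) (by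
        rw [le_div_iff₀ hApos, hAx]; nlinarith [(abs_le.1 hBe).1, sq_nonneg (x - s)]) (by
        rw [div_le_iff₀ hApos, hAx]; nlinarith [(abs_le.1 hBe).2])
      have e1 : A + B * e + s ^ 2 = A * (1 + (B * e + s ^ 2) / A) := by field_simp; ring
      have h1u : 0 ≤ 1 + (B * e + s ^ 2) / A := by
        have : 1 + (B * e + s ^ 2) / A = (A + B * e + s ^ 2) / A := by field_simp; ring
        rw [this]; rw [hss] at hnn; positivity
      rw [e1, Real.mul_rpow hA h1u]
      have e2 := mul_le_mul_of_nonneg_left hu (Real.rpow_nonneg hA q)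
      have e3 : A ^ q = A ^ (q - 1) * A := by
        rw [Real.rpow_sub_one hApos.ne']; field_simp
      have e4 : A ^ q * (1 + q * ((B * e + s ^ 2) / A) + C * ((B * e + s ^ 2) / A) ^ 2)
          = A ^ q + q * A ^ (q - 1) * B * e + q * A ^ (q-1) * s ^ 2
            + C * A ^ (q - 1) * ((B * e + s ^ 2) ^ 2 / A) := by
        rw [e3]; field_simp; ring
      have e5 : (B * e + s ^ 2) ^ 2 / A ≤ 9 * s ^ 2 := by
        rw [div_le_iff₀ hApos, hAx]
        have : |B * e + s ^ 2| ≤ 3 * x * s := by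
          refine (abs_add_le _ _).trans ?_
          rw [abs_of_nonneg (sq_nonneg s)]; nlinarith
        calc (B * e + s ^ 2) ^ 2 = |B * e + s ^ 2| ^ 2 := (sq_abs _).symm
          _ ≤ (3 * x * s) ^ 2 := by gcongr
          _ = _ := by ring
      have e6 := mul_le_mul_of_nonneg_left e5 (mul_nonneg hC hA1)
      have e7 : 0 ≤ (4 ^ q + 2 * q) * (A ^ (q - 1) * s ^ 2) := by positivity
      have e8 : 0 ≤ (q + 9 * C + 4 ^ q + 2 * q) * (s ^ 2) ^ q := by positivity
      rw [e4] at e2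
      linarith
  · push Not at hcase
    have e1 : A + B * e + s ^ 2 ≤ 4 * s ^ 2 := by
      rw [hAx]; nlinarith [(abs_le.1 hBe).2]
    rw [hss] at hnn
    have e2 := Real.rpow_le_rpow hnn e1 (by linarith : 0 ≤ q)
    rw [Real.mul_rpow (by norm_num) (sq_nonneg s)] at e2
    have e3 : A ^ (q - 1) ≤ (s ^ 2) ^ (q - 1) :=
      Real.rpow_le_rpow hA (by rw [hAx]; nlinarith) (by linarith)
    have e4 : (s ^ 2) ^ (q - 1) * s ^ 2 = (s ^ 2) ^ q := by
      have : s ^ 2 ≠ 0 := by have : 0 < s := lt_of_le_of_lt hx0 hcase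
                             positivity
      rw [Real.rpow_sub_one this]; exact div_mul_cancel₀ _ this
    have e5 : - (2 * (s ^ 2) ^ q) ≤ A ^ (q - 1) * (B * e) := by
      have : |A ^ (q - 1) * (B * e)| ≤ (s ^ 2) ^ (q - 1) * (2 * s ^ 2) := by
        rw [abs_mul, abs_of_nonneg hA1]
        apply mul_le_mul e3 _ (abs_nonneg _) (Real.rpow_nonneg (sq_nonneg s) _)
        nlinarith
      linarith [(abs_le.1 this).1]
    have e6 := mul_le_mul_of_nonneg_left e5 (by linarith : 0 ≤ q)
    have e7 : 0 ≤ A ^ q := Real.rpow_nonneg hA _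
    have e8 : 0 ≤ (q + 9 * C + 4 ^ q + 2 * q) * (A ^ (q - 1) * s ^ 2) := by positivity
    have e9 : 0 ≤ (q + 9 * C) * (s ^ 2) ^ q := by positivity
    linarith

/-- polynomial expansion, raw form -/
lemma expand_raw (n : ℕ) : ∃ K : ℝ, 0 ≤ K ∧ ∀ x s b : ℝ, 0 ≤ x → 0 ≤ s → |b| ≤ 2 * (x * s) →
    |(x ^ 2 + (b + s ^ 2)) ^ (n + 2) - (x ^ 2) ^ (n + 2) - (n + 2) * (x ^ 2) ^ (n + 1) * (b + s ^ 2)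
      - ((n + 2).choose 2 : ℕ) * (x ^ 2) ^ n * b ^ 2| ≤ K * s ^ 3 * (x + s) ^ (2 * n + 1) := by
  induction n with
  | zero =>
    refine ⟨4, by norm_num, fun x s b hx hs hb => ?_⟩
    have : (x ^ 2 + (b + s ^ 2)) ^ (0 + 2) - (x ^ 2) ^ (0 + 2)
      - ((0:ℕ) + 2) * (x ^ 2) ^ (0 + 1) * (b + s ^ 2)
      - ((0 + 2).choose 2 : ℕ) * (x ^ 2) ^ 0 * b ^ 2 = b * (2 * s ^ 2) + s ^ 4 := by
      simp; ring
    rw [this]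
    calc |b * (2 * s ^ 2) + s ^ 4| ≤ |b| * (2 * s ^ 2) + s ^ 4 := by
          refine (abs_add_le _ _).trans ?_
          rw [abs_mul, abs_of_nonneg (by positivity : 0 ≤ 2 * s ^ 2),
            abs_of_nonneg (by positivity : 0 ≤ s ^ 4)]
      _ ≤ 2 * (x * s) * (2 * s ^ 2) + s ^ 4 := by gcongr
      _ ≤ _ := by
        have : 0 ≤ s ^ 4 := by positivity
        ring_nf; nlinarith
  | succ n ih =>
    obtain ⟨K, hK, ih⟩ := ih
    refine ⟨K + 4 * (n + 2) + 8 * ((n + 2).choose 2 : ℕ), by positivity, fun x s b hx hs hb => ?_⟩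
    have ih := ih x s b hx hs hb
    set E := (x ^ 2 + (b + s ^ 2)) ^ (n + 2) - (x ^ 2) ^ (n + 2)
      - (n + 2) * (x ^ 2) ^ (n + 1) * (b + s ^ 2)
      - ((n + 2).choose 2 : ℕ) * (x ^ 2) ^ n * b ^ 2 with hE
    have hch : ((n + 1 + 2).choose 2 : ℕ) = ((n + 2).choose 2 : ℝ) + (n + 2) := by
      have : (n + 1 + 2).choose 2 = (n + 2).choose 1 + (n + 2).choose 2 := rfl
      rw [this, Nat.choose_one_right]; push_cast; ring
    have hid : (x ^ 2 + (b + s ^ 2)) ^ (n + 1 + 2) - (x ^ 2) ^ (n + 1 + 2)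
        - ((n + 1 : ℕ) + 2) * (x ^ 2) ^ (n + 1 + 1) * (b + s ^ 2)
        - ((n + 1 + 2).choose 2 : ℕ) * (x ^ 2) ^ (n + 1) * b ^ 2
        = (x ^ 2 + (b + s ^ 2)) * E + (n + 2) * (x ^ 2) ^ (n + 1) * (b * (2 * s ^ 2) + s ^ 4)
          + ((n + 2).choose 2 : ℕ) * (x ^ 2) ^ n * ((b + s ^ 2) * b ^ 2) := by
      rw [hch, hE]; push_cast; ring
    rw [hid]
    have h1 : |x ^ 2 + (b + s ^ 2)| ≤ (x + s) ^ 2 := by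
      refine (abs_add_le _ _).trans ?_
      refine (add_le_add_right (abs_add_le _ _) _).trans ?_
      rw [abs_of_nonneg (sq_nonneg x), abs_of_nonneg (sq_nonneg s)]; nlinarith
    have h2 : |b * (2 * s ^ 2) + s ^ 4| ≤ 4 * s ^ 3 * (x + s) := by
      calc |b * (2 * s ^ 2) + s ^ 4| ≤ |b| * (2 * s ^ 2) + s ^ 4 := by
            refine (abs_add_le _ _).trans ?_
            rw [abs_mul, abs_of_nonneg (by positivity : 0 ≤ 2 * s ^ 2),
              abs_of_nonneg (by positivity : 0 ≤ s ^ 4)]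
        _ ≤ 2 * (x * s) * (2 * s ^ 2) + s ^ 4 := by gcongr
        _ ≤ _ := by
          have : 0 ≤ s ^ 4 := by positivity
          ring_nf; nlinarith
    have hbs : |b + s ^ 2| ≤ 2 * s * (x + s) := by
      refine (abs_add_le _ _).trans ?_
      rw [abs_of_nonneg (sq_nonneg s)]; nlinarith
    have hb2 : b ^ 2 ≤ 4 * s ^ 2 * (x + s) ^ 2 := by
      rw [← sq_abs]
      calc |b| ^ 2 ≤ (2 * (x * s)) ^ 2 := by gcongr
        _ ≤ (2 * ((x + s) * s)) ^ 2 := by gcongr; linarith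
        _ = _ := by ring
    have h3 : |(b + s ^ 2) * b ^ 2| ≤ 8 * s ^ 3 * (x + s) ^ 3 := by
      rw [abs_mul, abs_of_nonneg (sq_nonneg b)]
      calc _ ≤ (2 * s * (x + s)) * (4 * s ^ 2 * (x + s) ^ 2) := by gcongr
        _ = _ := by ring
    have hxx : x ^ 2 ≤ (x + s) ^ 2 := by gcongr; linarith
    have t1 : |(x ^ 2 + (b + s ^ 2)) * E| ≤ (x + s) ^ 2 * (K * s ^ 3 * (x + s) ^ (2 * n + 1)) := by
      rw [abs_mul]; gcongr
    have t2 : |((n:ℝ) + 2) * (x ^ 2) ^ (n + 1) * (b * (2 * s ^ 2) + s ^ 4)| ≤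
        (n + 2) * ((x + s) ^ 2) ^ (n + 1) * (4 * s ^ 3 * (x + s)) := by
      rw [abs_mul, abs_of_nonneg (by positivity : 0 ≤ ((n:ℝ) + 2) * (x ^ 2) ^ (n + 1))]; gcongr
    have t3 : |(((n + 2).choose 2 : ℕ) : ℝ) * (x ^ 2) ^ n * ((b + s ^ 2) * b ^ 2)| ≤
        ((n + 2).choose 2 : ℕ) * ((x + s) ^ 2) ^ n * (8 * s ^ 3 * (x + s) ^ 3) := by
      rw [abs_mul, abs_of_nonneg
        (by positivity : 0 ≤ (((n + 2).choose 2 : ℕ) : ℝ) * (x ^ 2) ^ n)]; gcongr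
    calc _ ≤ _ := (abs_add_le _ _).trans (add_le_add ((abs_add_le _ _).trans (add_le_add t1 t2)) t3)
      _ = _ := by
        generalize x + s = w
        simp only [← pow_mul]
        ring

lemma expand_main (p : ℕ) (hp : 1 ≤ p) : ∃ K : ℝ, 0 ≤ K ∧ ∀ A B c e : ℝ, 0 ≤ A → 0 ≤ c → c ≤ 1 →
    B ^ 2 ≤ 4 * A * c →
    |(A + B * e + c * e ^ 2) ^ p - A ^ p - p * A ^ (p - 1) * (B * e + c * e ^ 2)
      - (p.choose 2 : ℕ) * A ^ (p - 2) * B ^ 2 * e ^ 2|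
      ≤ K * (c * √c * (1 + A ^ (p - 1))) * (1 + |e|) ^ (2 * p) := by
  rcases Nat.lt_or_ge p 2 with h | h
  · obtain rfl : p = 1 := by omega
    refine ⟨0, le_rfl, fun A B c e _ _ _ _ => ?_⟩
    simp
    ring
  · obtain ⟨n, rfl⟩ : ∃ n, p = n + 2 := ⟨p - 2, by omega⟩
    obtain ⟨K, hK, hE⟩ := expand_raw n
    refine ⟨K * 2 ^ (2 * n + 2), by positivity, fun A B c e hA hc hc1 hB => ?_⟩
    have hBe := quad_nonneg (e := e) hA hc hB
    have hE := hE (√A) (√c * |e|) (B * e) (Real.sqrt_nonneg _) (by positivity) hBe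
    have hs2 : (√c * |e|) ^ 2 = c * e ^ 2 := by rw [mul_pow, Real.sq_sqrt hc, sq_abs]
    rw [hs2, Real.sq_sqrt hA] at hE
    have e0 : n + 2 - 1 = n + 1 := rfl
    have e00 : n + 2 - 2 = n := rfl
    rw [e0, e00]
    have : (A + B * e + c * e ^ 2) ^ (n + 2) - A ^ (n + 2)
        - ((n + 2 : ℕ) : ℝ) * A ^ (n + 1) * (B * e + c * e ^ 2)
        - ((n + 2).choose 2 : ℕ) * A ^ n * B ^ 2 * e ^ 2 =
        (A + (B * e + c * e ^ 2)) ^ (n + 2) - A ^ (n + 2)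
        - (n + 2) * A ^ (n + 1) * (B * e + c * e ^ 2)
        - ((n + 2).choose 2 : ℕ) * A ^ n * (B * e) ^ 2 := by push_cast; ring
    rw [this]
    refine hE.trans ?_
    set x := √A
    have hx0 : 0 ≤ x := Real.sqrt_nonneg _
    have hAx : A = x ^ 2 := (Real.sq_sqrt hA).symm
    have hsc : √c ≤ 1 := Real.sqrt_le_one.2 hc1
    have h1 : x + √c * |e| ≤ (1 + x) * (1 + |e|) := by
      have : √c * |e| ≤ 1 * |e| := by gcongr
      nlinarith [abs_nonneg e, mul_nonneg hx0 (abs_nonneg e)]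
    have h2 : (√c * |e|) ^ 3 ≤ c * √c * (1 + |e|) ^ 3 := by
      rw [mul_pow]
      have : √c ^ 3 = c * √c := by rw [pow_succ, Real.sq_sqrt hc]
      rw [this]; gcongr; linarith
    have h3 : (1 + x) ^ (2 * n + 1) ≤ 2 ^ (2 * n + 2) * (1 + A ^ (n + 1)) := by
      calc (1 + x) ^ (2 * n + 1) ≤ (1 + x) ^ (2 * n + 2) := by
            apply pow_le_pow_right₀ <;> linarith
        _ ≤ 2 ^ (2 * n + 2) * (1 ^ (2 * n + 2) + x ^ (2 * n + 2)) := by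
            refine (add_pow_le (by norm_num) hx0 _).trans ?_
            gcongr
            · norm_num
            · omega
        _ = _ := by rw [hAx, one_pow, ← pow_mul]; ring
    calc K * (√c * |e|) ^ 3 * (x + √c * |e|) ^ (2 * n + 1)
        ≤ K * (c * √c * (1 + |e|) ^ 3) * ((1 + x) * (1 + |e|)) ^ (2 * n + 1) := by gcongr
      _ = K * (c * √c * (1 + x) ^ (2 * n + 1)) * (1 + |e|) ^ (2 * (n + 2)) := by
        rw [mul_pow]; ring
      _ ≤ K * (c * √c * (2 ^ (2 * n + 2) * (1 + A ^ (n + 1)))) * (1 + |e|) ^ (2 * (n + 2)) := by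
        gcongr
      _ = _ := by ring
end partA

section partB
/-- partial sums are `O(ℓ)` -/
def BO (w ℓ : ℕ → ℝ) : Prop := ∃ C : ℝ, ∀ n, ∑ k ∈ Finset.range n, w k ≤ C * ℓ n

lemma ds_aux {η s t : ℝ} (hη : 0 < η) (hs : 0 < s) (hst : s ≤ t) :
    (t - s) / t ^ (1 + η) ≤ 1 / η * (s ^ (-η) - t ^ (-η)) := by
  have ht : 0 < t := lt_of_lt_of_le hs hst
  have h1 : 1 + η * (1 - s / t) ≤ (s / t) ^ (-η) := by
    have hpos : 0 < s / t := by positivity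
    rw [Real.rpow_def_of_pos hpos]
    have := Real.log_le_sub_one_of_pos hpos
    have h2 := Real.add_one_le_exp (Real.log (s / t) * -η)
    nlinarith
  rw [Real.div_rpow hs.le ht.le] at h1
  have h3 : (t - s) / t ^ (1 + η) = (1 - s / t) * t ^ (-η) := by
    rw [Real.rpow_add ht, Real.rpow_one, Real.rpow_neg ht.le]; field_simp
  have h4 : 0 < t ^ (-η) := Real.rpow_pos_of_pos ht _
  rw [le_div_iff₀ h4] at h1
  rw [h3, one_div, ← div_eq_inv_mul, le_div_iff₀ hη]
  linarith

lemma ds {w ℓ : ℕ → ℝ} (hw : ∀ k, 0 ≤ w k) (hl : ∀ k, 1 ≤ ℓ k) (hd : ∀ k, ℓ (k + 1) ≤ 2 * ℓ k)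
    (hb : BO w ℓ) {η : ℝ} (hη : 0 < η) : Summable fun k => w k / ℓ k ^ (1 + η) := by
  obtain ⟨C, hC⟩ := hb
  have hC0 : 0 ≤ C := by
    have := hC 0; simp at this
    by_contra h; push Not at h
    nlinarith [hl 0]
  set T : ℕ → ℝ := fun n => 1 + ∑ k ∈ Finset.range n, w k with hT
  have hT1 : ∀ n, 1 ≤ T n := fun n => by
    have : 0 ≤ ∑ k ∈ Finset.range n, w k := Finset.sum_nonneg fun k _ => hw k
    simp only [hT]; linarith
  have hTs : ∀ n, T (n + 1) = T n + w n := fun n => by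
    simp only [hT, Finset.sum_range_succ]; ring
  set D := 2 * (1 + C) with hD
  have hTl : ∀ n, T (n + 1) ≤ D * ℓ n := fun n => by
    have h1 := hC (n + 1)
    have h2 := hd n
    have h3 := hl (n + 1)
    have : T (n + 1) ≤ (1 + C) * ℓ (n + 1) := by simp only [hT]; linarith
    nlinarith
  have hD0 : 0 < D := by positivity
  apply summable_of_sum_range_le (c := D ^ (1 + η) * (1 / η))
  · intro k; have := hw k; have := hl k; positivity
  · intro n
    have key : ∀ k, w k / ℓ k ^ (1 + η) ≤
        D ^ (1 + η) * (1 / η) * ((T k) ^ (-η) - (T (k + 1)) ^ (-η)) := fun k => by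
      have h0 := ds_aux hη (lt_of_lt_of_le zero_lt_one (hT1 k))
        (by rw [hTs]; linarith [hw k] : T k ≤ T (k + 1))
      rw [show T (k + 1) - T k = w k by rw [hTs]; ring] at h0
      have hlk : 0 < ℓ k := by linarith [hl k]
      have hTk : 0 < T (k + 1) := by linarith [hT1 (k + 1)]
      have h1 : T (k + 1) ^ (1 + η) ≤ D ^ (1 + η) * ℓ k ^ (1 + η) := by
        rw [← Real.mul_rpow hD0.le hlk.le]
        exact Real.rpow_le_rpow hTk.le (hTl k) (by linarith)
      calc w k / ℓ k ^ (1 + η) = D ^ (1 + η) * (w k / (D ^ (1 + η) * ℓ k ^ (1 + η))) := by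
            have : 0 < D ^ (1 + η) := by positivity
            field_simp
        _ ≤ D ^ (1 + η) * (w k / T (k + 1) ^ (1 + η)) := by
            have := hw k
            gcongr
        _ ≤ _ := by rw [mul_assoc]; gcongr
    refine (Finset.sum_le_sum fun k _ => key k).trans ?_
    rw [← Finset.mul_sum, Finset.sum_range_sub']
    have h5 : T 0 ^ (-η) = 1 := by simp [hT]
    have h6 : 0 ≤ T n ^ (-η) := Real.rpow_nonneg (by linarith [hT1 n]) _
    rw [h5]
    have : 0 ≤ D ^ (1 + η) * (1 / η) := by positivity
    nlinarith

lemma ces {w z δ ℓ : ℕ → ℝ} (hw : ∀ k, 0 ≤ w k) (hl : Tendsto ℓ atTop atTop)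
    (hb : BO w ℓ) (hδ : Tendsto δ atTop (𝓝 0)) (hz : ∀ᶠ k in atTop, |z k| ≤ δ k * w k) :
    Tendsto (fun n => (∑ k ∈ Finset.range n, z k) / ℓ n) atTop (𝓝 0) := by
  obtain ⟨C, hC⟩ := hb
  rw [Metric.tendsto_atTop]
  intro e he
  set e' := e / (2 * (|C| + 1)) with he'
  have he0 : 0 < e' := by positivity
  obtain ⟨N, hN⟩ := eventually_atTop.1 (hz.and (hδ.eventually_lt_const he0))
  set R := ∑ k ∈ Finset.range N, |z k|
  obtain ⟨N2, hN2⟩ := eventually_atTop.1 (hl.eventually_gt_atTop (max 0 (2 * R / e)))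
  refine ⟨max N N2, fun n hn => ?_⟩
  have hn1 : N ≤ n := le_trans (le_max_left _ _) hn
  have hln := hN2 n (le_trans (le_max_right _ _) hn)
  have hl0 : 0 < ℓ n := lt_of_le_of_lt (le_max_left _ _) hln
  have hlR : 2 * R / e < ℓ n := lt_of_le_of_lt (le_max_right _ _) hln
  rw [div_lt_iff₀ he] at hlR
  rw [Real.dist_eq, sub_zero, abs_div, abs_of_pos hl0, div_lt_iff₀ hl0]
  have h1 : ∀ k ∈ Finset.range n, |z k| ≤ (if k < N then |z k| else 0) + e' * w k := by
    intro k _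
    split_ifs with h
    · have := mul_nonneg he0.le (hw k); linarith
    · push Not at h
      obtain ⟨ha, hb⟩ := hN k h
      have := mul_le_mul_of_nonneg_right hb.le (hw k)
      linarith
  have h2 : ∑ k ∈ Finset.range n, (if k < N then |z k| else 0) = R := by
    rw [← Finset.sum_filter]
    congr 1; ext k; simp; omega
  have h3 : |∑ k ∈ Finset.range n, z k| ≤ R + e' * (C * ℓ n) := by
    refine (Finset.abs_sum_le_sum_abs _ _).trans ((Finset.sum_le_sum h1).trans ?_)
    rw [Finset.sum_add_distrib, h2, ← Finset.mul_sum]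
    gcongr; exact hC n
  have h4 : e' * (C * ℓ n) ≤ e / 2 * ℓ n := by
    have : e' * (|C| + 1) = e / 2 := by rw [he']; field_simp
    rw [← this]
    have : C ≤ |C| + 1 := by linarith [le_abs_self C]
    nlinarith [mul_pos he0 hl0]
  linarith

lemma bo_of_tendsto {w ℓ : ℕ → ℝ} (hl : ∀ k, 1 ≤ ℓ k) {a : ℝ}
    (h : Tendsto (fun n => (∑ k ∈ Finset.range n, w k) / ℓ n) atTop (𝓝 a)) : BO w ℓ := by
  obtain ⟨C, hC⟩ := h.bddAbove_range
  refine ⟨C, fun n => ?_⟩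
  have := hC ⟨n, rfl⟩
  simp only at this
  rwa [div_le_iff₀ (by linarith [hl n])] at this

lemma bo_mono {v w ℓ : ℕ → ℝ} (hw : ∀ k, 0 ≤ w k) (hl : ∀ k, 1 ≤ ℓ k) (hb : BO w ℓ) (K : ℝ)
    (h : ∀ᶠ k in atTop, v k ≤ K * w k) : BO v ℓ := by
  obtain ⟨C, hC⟩ := hb
  obtain ⟨N, hN⟩ := eventually_atTop.1 h
  refine ⟨∑ k ∈ Finset.range N, |v k| + |K| * C, fun n => ?_⟩
  have h1 : ∀ k ∈ Finset.range n, v k ≤ (if k < N then |v k| else 0) + |K| * w k := by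
    intro k _
    split_ifs with h
    · have := mul_nonneg (abs_nonneg K) (hw k); linarith [le_abs_self (v k)]
    · push Not at h
      have := hN k h
      have := mul_le_mul_of_nonneg_right (le_abs_self K) (hw k)
      linarith
  have h2 : ∑ k ∈ Finset.range n, (if k < N then |v k| else 0) ≤ ∑ k ∈ Finset.range N, |v k| := by
    rw [← Finset.sum_filter]
    apply Finset.sum_le_sum_of_subset_of_nonneg
    · intro k; simp
    · intros; positivity
  refine (Finset.sum_le_sum h1).trans ?_
  rw [Finset.sum_add_distrib, ← Finset.mul_sum]
  have h3 := mul_le_mul_of_nonneg_left (hC n) (abs_nonneg K)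
  have h4 : 0 ≤ ∑ k ∈ Finset.range N, |v k| := Finset.sum_nonneg fun _ _ => abs_nonneg _
  nlinarith [hl n]

lemma bo_add {v w ℓ : ℕ → ℝ} (hv : BO v ℓ) (hw : BO w ℓ) : BO (fun k => v k + w k) ℓ := by
  obtain ⟨C, hC⟩ := hv
  obtain ⟨D, hD⟩ := hw
  refine ⟨C + D, fun n => ?_⟩
  rw [Finset.sum_add_distrib]; linarith [hC n, hD n]

lemma ratC {x y w δ ℓ : ℕ → ℝ} (hw : ∀ k, 0 ≤ w k) (hl : Tendsto ℓ atTop atTop)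
    (hb : BO w ℓ) (hδ : Tendsto δ atTop (𝓝 0)) (hz : ∀ᶠ k in atTop, |y k - x k| ≤ δ k * w k)
    {a : ℝ} (hx : Tendsto (fun n => (∑ k ∈ Finset.range n, x k) / ℓ n) atTop (𝓝 a)) :
    Tendsto (fun n => (∑ k ∈ Finset.range n, y k) / ℓ n) atTop (𝓝 a) := by
  have := (ces hw hl hb hδ hz).add hx
  rw [zero_add] at this
  refine this.congr fun n => ?_
  rw [Finset.sum_sub_distrib]; ring

lemma ratA {x y δ ℓ : ℕ → ℝ} (hx0 : ∀ k, 0 ≤ x k) (hl : Tendsto ℓ atTop atTop)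
    (hl1 : ∀ k, 1 ≤ ℓ k) (hδ : Tendsto δ atTop (𝓝 0))
    (hz : ∀ᶠ k in atTop, |y k - x k| ≤ δ k * x k)
    {a : ℝ} (hx : Tendsto (fun n => (∑ k ∈ Finset.range n, x k) / ℓ n) atTop (𝓝 a)) :
    Tendsto (fun n => (∑ k ∈ Finset.range n, y k) / ℓ n) atTop (𝓝 a) :=
  ratC hx0 hl (bo_of_tendsto hl1 hx) hδ hz hx

lemma ratB {x y δ ℓ : ℕ → ℝ} (hx0 : ∀ k, 0 ≤ x k) (hy0 : ∀ k, 0 ≤ y k)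
    (hl : Tendsto ℓ atTop atTop)
    (hl1 : ∀ k, 1 ≤ ℓ k) (hδ : Tendsto δ atTop (𝓝 0))
    (hz : ∀ᶠ k in atTop, |x k - y k| ≤ δ k * y k)
    {a : ℝ} (hx : Tendsto (fun n => (∑ k ∈ Finset.range n, x k) / ℓ n) atTop (𝓝 a)) :
    Tendsto (fun n => (∑ k ∈ Finset.range n, y k) / ℓ n) atTop (𝓝 a) := by
  have hδ2 : Tendsto (fun k => 2 * |δ k|) atTop (𝓝 0) := by simpa using (hδ.abs.const_mul 2)
  refine ratA hx0 hl hl1 hδ2 ?_ hx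
  filter_upwards [hz, hδ.eventually_lt_const (by norm_num : (0:ℝ) < 1/2)] with k hk h2
  rw [abs_sub_comm]
  have h3 : δ k * y k ≤ 1 / 2 * y k := by have := hy0 k; gcongr
  have h4 := (abs_le.1 hk).1
  have h5 : y k ≤ 2 * x k := by linarith
  calc |x k - y k| ≤ δ k * y k := hk
    _ ≤ |δ k| * (2 * x k) := mul_le_mul (le_abs_self _) h5 (hy0 k) (abs_nonneg _)
    _ = _ := by ring

lemma pow_sub_bound {X A c : ℝ} (hX : 0 ≤ X) (hc0 : 0 ≤ c) (hc1 : c ≤ 1) (hAX : A ≤ X)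
    (hA : (1 - c) * X ≤ A) (j : ℕ) : |A ^ j - X ^ j| ≤ j * c * X ^ j := by
  have h0 : 0 ≤ (1 - c) * X := mul_nonneg (by linarith) hX
  have h1 : A ^ j ≤ X ^ j := pow_le_pow_left₀ (by linarith) hAX j
  have h2 : ((1 - c) * X) ^ j ≤ A ^ j := pow_le_pow_left₀ h0 hA j
  have h3 := one_add_mul_le_pow (by linarith : -2 ≤ -c) j
  rw [mul_pow] at h2
  have h4 := mul_le_mul_of_nonneg_right h3 (pow_nonneg hX j)
  rw [abs_le]
  constructor
  · have : (1 - c) ^ j = (1 + -c) ^ j := by ring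
    rw [this] at h2; linarith
  · have : 0 ≤ j * c * X ^ j := by positivity
    linarith

lemma pow_diff_bounds {X A : ℝ} (hA : 0 ≤ A) (hAX : A ≤ X) (n : ℕ) :
    (n + 1) * (X - A) * A ^ n ≤ X ^ (n + 1) - A ^ (n + 1) ∧
      X ^ (n + 1) - A ^ (n + 1) ≤ (n + 1) * (X - A) * X ^ n := by
  have hX : 0 ≤ X := hA.trans hAX
  induction n with
  | zero => simp
  | succ n ih =>
    have h1 : A ^ (n + 1) ≤ X ^ (n + 1) := pow_le_pow_left₀ hA hAX _
    have e : X ^ (n + 1 + 1) - A ^ (n + 1 + 1) =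
      X * (X ^ (n + 1) - A ^ (n + 1)) + (X - A) * A ^ (n + 1) := by ring
    have e' : X ^ (n + 1 + 1) - A ^ (n + 1 + 1) =
      A * (X ^ (n + 1) - A ^ (n + 1)) + (X - A) * X ^ (n + 1) := by ring
    have hd : 0 ≤ X - A := by linarith
    constructor
    · rw [e']
      have := mul_le_mul_of_nonneg_left ih.1 hA
      have := mul_le_mul_of_nonneg_left h1 hd
      push_cast
      calc _ = A * ((n + 1) * (X - A) * A ^ n) + (X - A) * A ^ (n + 1) := by ring
        _ ≤ _ := by linarith
    · rw [e]
      have := mul_le_mul_of_nonneg_left ih.2 hX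
      have := mul_le_mul_of_nonneg_left h1 hd
      push_cast
      calc _ ≤ X * ((n + 1) * (X - A) * X ^ n) + (X - A) * X ^ (n + 1) := by linarith
        _ = _ := by ring

lemma det_post {X H c B ℓ : ℕ → ℝ} {σ2 : ℝ} (n : ℕ) (hX : ∀ k, 0 ≤ X k) (hH : ∀ k, 0 ≤ H k)
    (hHc : ∀ k, H k ≤ c k * X k) (hc0 : ∀ k, 0 ≤ c k) (hc1 : ∀ k, c k ≤ 1)
    (hct : Tendsto c atTop (𝓝 0)) (hB : ∀ k, B k ^ 2 ≤ 4 * (X k - H k) * c k)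
    (hl : Tendsto ℓ atTop atTop) (hl1 : ∀ k, 1 ≤ ℓ k) (hbo : BO (fun k => c k * X k ^ n) ℓ)
    (hmain : Tendsto (fun N => (∑ k ∈ Finset.range N, (X k ^ (n + 1) - (X k - H k) ^ (n + 1)
      - σ2 * ((n + 1) * (X k - H k) ^ n * c k
        + ((n + 1).choose 2 : ℕ) * (X k - H k) ^ (n - 1) * B k ^ 2))) / ℓ N) atTop (𝓝 0))
    {G : ℝ} (hG : Tendsto (fun N => (∑ k ∈ Finset.range N, ((n + 1) * X k ^ n * c k
        + ((n + 1).choose 2 : ℕ) * X k ^ (n - 1) * B k ^ 2)) / ℓ N) atTop (𝓝 G)) :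
    Tendsto (fun N => (∑ k ∈ Finset.range N, (n + 1) * H k * X k ^ n) / ℓ N) atTop
      (𝓝 (σ2 * G)) := by
  have hA0 : ∀ k, 0 ≤ X k - H k := fun k => by
    have := hHc k; have := mul_le_mul_of_nonneg_right (hc1 k) (hX k); linarith
  have hAX : ∀ k, X k - H k ≤ X k := fun k => by linarith [hH k]
  have hAl : ∀ k, (1 - c k) * X k ≤ X k - H k := fun k => by linarith [hHc k]
  set Ch : ℝ := (((n + 1).choose 2 : ℕ) : ℝ) with hCh
  have hCh0 : 0 ≤ Ch := Nat.cast_nonneg _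
  have hG' : Tendsto (fun N => (∑ k ∈ Finset.range N, ((n + 1) * (X k - H k) ^ n * c k
        + Ch * (X k - H k) ^ (n - 1) * B k ^ 2)) / ℓ N) atTop (𝓝 G) := by
    refine ratC (w := fun k => c k * X k ^ n)
      (δ := fun k => ((n + 1) * n + Ch * (n - 1 : ℕ) * 4) * c k) (fun k => ?_) hl hbo ?_ ?_ hG
    · exact mul_nonneg (hc0 k) (pow_nonneg (hX k) _)
    · simpa using hct.const_mul (((n:ℝ) + 1) * n + Ch * (n - 1 : ℕ) * 4)
    · refine Eventually.of_forall fun k => ?_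
      have h1 := pow_sub_bound (hX k) (hc0 k) (hc1 k) (hAX k) (hAl k) n
      have h2 := pow_sub_bound (hX k) (hc0 k) (hc1 k) (hAX k) (hAl k) (n - 1)
      set A := X k - H k
      have hB' : B k ^ 2 ≤ 4 * X k * c k := (hB k).trans (by have := hc0 k; gcongr; exact hAX k)
      have h3 : |Ch * A ^ (n - 1) * B k ^ 2 - Ch * X k ^ (n - 1) * B k ^ 2| ≤
          Ch * (n - 1 : ℕ) * 4 * c k * (c k * X k ^ n) := by
        rcases n with _ | n
        · have : Ch = 0 := by simp [hCh]
          simp [this]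
        · simp only [Nat.add_sub_cancel] at h2 ⊢
          rw [show Ch * A ^ n * B k ^ 2 - Ch * X k ^ n * B k ^ 2
            = Ch * (A ^ n - X k ^ n) * B k ^ 2 by ring, abs_mul, abs_mul, abs_of_nonneg hCh0,
            abs_of_nonneg (sq_nonneg (B k))]
          have := hX k; have := hc0 k
          calc Ch * |A ^ n - X k ^ n| * B k ^ 2
              ≤ Ch * (n * c k * X k ^ n) * (4 * X k * c k) := by gcongr
            _ = _ := by ring
      have h4 : |((n:ℝ) + 1) * A ^ n * c k - (n + 1) * X k ^ n * c k| ≤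
          (n + 1) * n * c k * (c k * X k ^ n) := by
        rw [show ((n:ℝ) + 1) * A ^ n * c k - (n + 1) * X k ^ n * c k
          = (n + 1) * (A ^ n - X k ^ n) * c k by ring, abs_mul, abs_mul,
          abs_of_nonneg (hc0 k), abs_of_nonneg (by positivity : 0 ≤ (n:ℝ) + 1)]
        have := hc0 k
        calc ((n:ℝ) + 1) * |A ^ n - X k ^ n| * c k ≤ (n + 1) * (n * c k * X k ^ n) * c k := by gcongr
          _ = _ := by ring
      calc _ = |(((n:ℝ) + 1) * A ^ n * c k - (n + 1) * X k ^ n * c k)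
            + (Ch * A ^ (n - 1) * B k ^ 2 - Ch * X k ^ (n - 1) * B k ^ 2)| := by congr 1; ring
        _ ≤ _ := (abs_add_le _ _).trans (add_le_add h4 h3)
        _ = _ := by ring
  have h5 : Tendsto (fun N => (∑ k ∈ Finset.range N, (X k ^ (n + 1) - (X k - H k) ^ (n + 1))) / ℓ N)
      atTop (𝓝 (σ2 * G)) := by
    have := hmain.add (hG'.const_mul σ2)
    rw [zero_add] at this
    refine this.congr fun N => ?_
    rw [Finset.sum_sub_distrib, ← Finset.mul_sum]; ring
  refine ratB (δ := fun k => n * c k) (fun k => ?_) (fun k => ?_) hl hl1 ?_ ?_ h5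
  · have := pow_le_pow_left₀ (hA0 k) (hAX k) (n + 1); linarith
  · have := hH k; have := hX k; positivity
  · simpa using hct.const_mul (n:ℝ)
  · refine Eventually.of_forall fun k => ?_
    obtain ⟨l, u⟩ := pow_diff_bounds (hA0 k) (hAX k) n
    have h1 := (abs_le.1 (pow_sub_bound (hX k) (hc0 k) (hc1 k) (hAX k) (hAl k) n)).1
    rw [sub_sub_cancel] at l u
    have h2 : 0 ≤ ((n:ℝ) + 1) * H k := by have := hH k; positivity
    have h3 := mul_le_mul_of_nonneg_left h1 h2
    rw [abs_le]
    constructor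
    · linarith
    · have : 0 ≤ n * c k * ((n + 1) * H k * X k ^ n) := by
        have := hH k; have := hX k; have := hc0 k; positivity
      linarith
end partB

section partC
lemma exists_thresh {Ω : Type*} {m0 : MeasurableSpace Ω} (μ : Measure Ω) [IsProbabilityMeasure μ]
    (G : ℕ → Ω → ℝ) (hG : ∀ n, Measurable (G n)) :
    ∃ κ : ℕ → ℝ, (∀ n, 0 ≤ κ n) ∧ ∀ᵐ ω ∂μ, ∃ D : ℕ, ∀ n, G n ω ≤ κ n + D := by
  have h1 : ∀ n, ∃ k : ℕ, μ {ω | (k:ℝ) < G n ω} ≤ (2:ENNReal)⁻¹ ^ n := by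
    intro n
    have ht : Tendsto (fun k : ℕ => μ {ω | (k:ℝ) < G n ω}) atTop
        (𝓝 (μ (⋂ k : ℕ, {ω | (k:ℝ) < G n ω}))) := by
      apply tendsto_measure_iInter_atTop
      · intro k; exact (measurableSet_lt measurable_const (hG n)).nullMeasurableSet
      · intro a b hab ω hω
        simp only [Set.mem_ofPred_eq] at hω ⊢
        exact lt_of_le_of_lt (by exact_mod_cast hab) hω
      · exact ⟨0, measure_ne_top _ _⟩
    have he : (⋂ k : ℕ, {ω | (k:ℝ) < G n ω}) = ∅ := by
      ext ω
      simp only [Set.mem_iInter, Set.mem_ofPred_eq, Set.mem_empty_iff_false, iff_false, not_forall,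
        not_lt]
      exact exists_nat_ge _
    rw [he, measure_empty] at ht
    have hp : (0:ENNReal) < (2:ENNReal)⁻¹ ^ n := by
      apply ENNReal.pow_pos; simp
    obtain ⟨k, hk⟩ := (ht.eventually_lt_const hp).exists
    exact ⟨k, hk.le⟩
  choose k hk using h1
  refine ⟨fun n => k n, fun n => Nat.cast_nonneg _, ?_⟩
  have hs : (∑' n, μ {ω | (k n:ℝ) < G n ω}) ≠ ⊤ := by
    refine ne_top_of_le_ne_top ?_ (ENNReal.tsum_le_tsum hk)
    rw [ENNReal.tsum_geometric]
    simp
  filter_upwards [ae_eventually_notMem hs] with ω hω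
  obtain ⟨N, hN⟩ := eventually_atTop.1 hω
  obtain ⟨D, hD⟩ := exists_nat_ge (∑ n ∈ Finset.range N, |G n ω|)
  refine ⟨D, fun n => ?_⟩
  by_cases hn : N ≤ n
  · have := hN n hn
    simp only [Set.mem_ofPred_eq, not_lt] at this
    have : (0:ℝ) ≤ D := Nat.cast_nonneg _
    linarith
  · push Not at hn
    have h2 : |G n ω| ≤ ∑ n ∈ Finset.range N, |G n ω| :=
      Finset.single_le_sum (f := fun n => |G n ω|) (fun _ _ => abs_nonneg _) (Finset.mem_range.2 hn)
    have : (0:ℝ) ≤ k n := Nat.cast_nonneg _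
    linarith [le_abs_self (G n ω)]

theorem rs {Ω : Type*} {m0 : MeasurableSpace Ω} {μ : Measure Ω} [IsProbabilityMeasure μ]
    (F : Filtration ℕ m0) (U C : ℕ → Ω → ℝ) (t : ℕ) (γ ξ : Fin t → ℕ → Ω → ℝ)
    (hU0 : ∀ n ω, 0 ≤ U n ω) (hUm : StronglyMeasurable[F 0] (U 0))
    (hC0 : ∀ n ω, 0 ≤ C n ω) (hCm : ∀ n, StronglyMeasurable[F n] (C n))
    (hγ : ∀ i n, StronglyMeasurable[F n] (γ i n))
    (hξ : ∀ i n, StronglyMeasurable[F (n + 1)] (ξ i n))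
    (hξi : ∀ i n, Integrable (ξ i n) μ) (hξ0 : ∀ i n, μ[ξ i n|F n] =ᵐ[μ] 0)
    (hle : ∀ᵐ ω ∂μ, ∀ n, U (n + 1) ω ≤ U n ω + C n ω + ∑ i, γ i n ω * ξ i n ω) :
    ∀ᵐ ω ∂μ, (∃ D : ℝ, ∀ n, ∑ k ∈ Finset.range n, C k ω ≤ D) → ∃ K : ℝ, ∀ n, U n ω ≤ K := by
  classical
  set G : ℕ → Ω → ℝ := fun n ω => ∑ i, |γ i n ω| with hG
  have hGm : ∀ n, Measurable[F n] (G n) := fun n =>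
    Finset.measurable_sum _ fun i _ => (continuous_abs.comp_stronglyMeasurable (hγ i n)).measurable
  obtain ⟨κ, hκ0, hκ⟩ := exists_thresh μ G fun n => (hGm n).mono (F.le n) le_rfl
  -- good sets
  let S : ℕ → ℕ → Set Ω := fun D n =>
    {ω | U 0 ω ≤ D ∧ (∑ k ∈ Finset.range (n + 1), C k ω ≤ D) ∧ ∀ k ∈ Finset.range (n + 1),
      G k ω ≤ κ k + D}
  have hSm : ∀ D n, MeasurableSet[F n] (S D n) := by
    intro D n
    have e : S D n = {ω | U 0 ω ≤ D} ∩ ({ω | ∑ k ∈ Finset.range (n + 1), C k ω ≤ D} ∩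
        ⋂ k ∈ Finset.range (n + 1), {ω | G k ω ≤ κ k + D}) := by
      ext ω; simp [S]
    rw [e]
    refine MeasurableSet.inter ?_ (MeasurableSet.inter ?_ ?_)
    · exact measurableSet_le (hUm.measurable.mono (F.mono (Nat.zero_le n)) le_rfl) measurable_const
    · refine measurableSet_le (Finset.measurable_sum _ fun k hk => ?_) measurable_const
      exact (hCm k).measurable.mono (F.mono (by simp at hk; omega)) le_rfl
    · refine Finset.measurableSet_biInter _ fun k hk => ?_
      exact measurableSet_le ((hGm k).mono (F.mono (by simp at hk; omega)) le_rfl) measurable_const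
  have hSmono : ∀ D n ω, ω ∈ S D (n + 1) → ω ∈ S D n := by
    intro D n ω h
    refine ⟨h.1, ?_, fun k hk => h.2.2 k (by simp at hk ⊢; omega)⟩
    have := h.2.1
    rw [Finset.sum_range_succ] at this
    linarith [hC0 (n + 1) ω]
  have main : ∀ D : ℕ, ∀ᵐ ω ∂μ, (∀ n, ω ∈ S D n) → ∃ K : ℝ, ∀ n, U n ω ≤ K := by
    intro D
    let γ' : Fin t → ℕ → Ω → ℝ := fun i n => (S D n).indicator (γ i n)
    have hγ'm : ∀ i n, StronglyMeasurable[F n] (γ' i n) := fun i n => (hγ i n).indicator (hSm D n)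
    have hγ'b : ∀ i n ω, ‖γ' i n ω‖ ≤ κ n + D := by
      intro i n ω
      by_cases h : ω ∈ S D n
      · simp only [γ', Set.indicator_of_mem h]
        refine le_trans ?_ (h.2.2 n (by simp))
        exact Finset.single_le_sum (f := fun i => |γ i n ω|) (fun _ _ => abs_nonneg _)
          (Finset.mem_univ i)
      · simp only [γ', Set.indicator_of_notMem h, norm_zero]
        have := hκ0 n; positivity
    let Y : ℕ → Ω → ℝ := fun n ω => ∑ i, γ' i n ω * ξ i n ω
    have hYi' : ∀ i n, Integrable (fun ω => γ' i n ω * ξ i n ω) μ := fun i n =>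
      (hξi i n).bdd_mul ((hγ'm i n).mono (F.le n)).aestronglyMeasurable
        (Eventually.of_forall (hγ'b i n))
    have hYi : ∀ n, Integrable (Y n) μ := fun n => integrable_finsetSum _ fun i _ => hYi' i n
    have hYm : ∀ n, StronglyMeasurable[F (n + 1)] (Y n) := fun n => by
      refine Finset.stronglyMeasurable_fun_sum _ fun i _ => ?_
      exact ((hγ'm i n).mono (F.mono (Nat.le_succ n))).mul (hξ i n)
    have hY0 : ∀ n, μ[Y n|F n] =ᵐ[μ] 0 := fun n => by
      have e1 : μ[Y n|F n] =ᵐ[μ] ∑ i, μ[fun ω => γ' i n ω * ξ i n ω|F n] := by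
        have : Y n = ∑ i, fun ω => γ' i n ω * ξ i n ω := by ext ω; simp [Y]
        rw [this]
        exact condExp_finsetSum (fun i _ => hYi' i n) _
      have e2 : ∀ i, μ[fun ω => γ' i n ω * ξ i n ω|F n] =ᵐ[μ] 0 := fun i => by
        have := condExp_mul_of_stronglyMeasurable_left (hγ'm i n) (hYi' i n) (hξi i n)
        refine this.trans ?_
        filter_upwards [hξ0 i n] with ω hω
        simp [hω]
      refine e1.trans ?_
      filter_upwards [ae_all_iff.2 e2] with ω hω
      simp [hω]
    let N : ℕ → Ω → ℝ := fun n ω => ∑ k ∈ Finset.range n, Y k ω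
    have hNs : ∀ n ω, N (n + 1) ω = N n ω + Y n ω := fun n ω => Finset.sum_range_succ _ _
    have hNi : ∀ n, Integrable (N n) μ := fun n => integrable_finsetSum _ fun k _ => hYi k
    have hNm : Martingale N F μ := by
      refine martingale_of_condExp_sub_eq_zero_nat (fun n => ?_) hNi fun n => ?_
      · refine Finset.stronglyMeasurable_fun_sum _ fun k hk => ?_
        exact (hYm k).mono (F.mono (by simp at hk; omega))
      · have : N (n + 1) - N n = Y n := by ext ω; simp [hNs]
        rw [this]; exact hY0 n
    have hlow : ∀ᵐ ω ∂μ, ∀ n, -(2 * (D:ℝ)) ≤ N n ω ∧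
        (ω ∈ S D n → U n ω ≤ U 0 ω + ∑ k ∈ Finset.range n, C k ω + N n ω) := by
      filter_upwards [hle] with ω hω n
      induction n with
      | zero => simp [N]
      | succ n ih =>
        by_cases h : ω ∈ S D n
        · have hY : Y n ω = ∑ i, γ i n ω * ξ i n ω := by
            simp only [Y, γ', Set.indicator_of_mem h]
          have h1 := hω n
          have h2 := ih.2 h
          have h3 : U (n + 1) ω ≤ U 0 ω + ∑ k ∈ Finset.range (n + 1), C k ω + N (n + 1) ω := by
            rw [Finset.sum_range_succ, hNs, hY]; linarith
          refine ⟨?_, fun _ => h3⟩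
          have h4 := h.1
          have h5 := h.2.1
          linarith [hU0 (n + 1) ω]
        · refine ⟨?_, fun h' => absurd (hSmono D n ω h') h⟩
          have hY : Y n ω = 0 := by
            simp only [Y, γ', Set.indicator_of_notMem h]; simp
          rw [hNs, hY, add_zero]; exact ih.1
    have hint : ∀ n, ∫ ω, N n ω ∂μ = 0 := fun n => by
      have := hNm.setIntegral_eq (Nat.zero_le n) (MeasurableSet.univ)
      simp only [setIntegral_univ] at this
      rw [← this]; simp [N]
    have hbdd : ∀ n, eLpNorm (N n) 1 μ ≤ ((4 * D : NNReal) : ENNReal) := fun n => by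
      rw [eLpNorm_one_eq_lintegral_enorm, ← ofReal_integral_norm_eq_lintegral_enorm (hNi n)]
      rw [ENNReal.ofReal_le_iff_le_toReal ENNReal.coe_ne_top]
      calc ∫ ω, ‖N n ω‖ ∂μ ≤ ∫ ω, (N n ω + 4 * D) ∂μ := by
            refine integral_mono_ae (hNi n).norm ((hNi n).add (integrable_const _)) ?_
            filter_upwards [hlow] with ω hω
            have h1 := (hω n).1
            have hD : (0:ℝ) ≤ D := Nat.cast_nonneg _
            simp only [Real.norm_eq_abs, abs_le]
            constructor <;> linarith
        _ = 4 * D := by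
            rw [integral_add (hNi n) (integrable_const _), hint]; simp
        _ ≤ _ := by simp
    filter_upwards [hNm.submartingale.exists_ae_tendsto_of_bdd hbdd, hlow] with ω hω hl hS
    obtain ⟨c, hc⟩ := hω
    obtain ⟨K, hK⟩ := hc.bddAbove_range
    refine ⟨D + D + K, fun n => ?_⟩
    have h1 := (hl n).2 (hS n)
    have h2 := (hS n).1
    have h3 : ∑ k ∈ Finset.range n, C k ω ≤ D := by
      have := (hS n).2.1
      rw [Finset.sum_range_succ] at this
      linarith [hC0 n ω]
    have h4 := hK ⟨n, rfl⟩
    simp only at h4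
    linarith
  filter_upwards [ae_all_iff.2 main, hκ] with ω h1 ⟨D1, hD1⟩ ⟨D2, hD2⟩
  obtain ⟨D3, hD3⟩ := exists_nat_ge (U 0 ω)
  obtain ⟨D4, hD4⟩ := exists_nat_ge D2
  refine h1 (D1 + D3 + D4) fun n => ?_
  have a1 : (0:ℝ) ≤ D1 := Nat.cast_nonneg _
  have a3 : (0:ℝ) ≤ D3 := Nat.cast_nonneg _
  have a4 : (0:ℝ) ≤ D4 := Nat.cast_nonneg _
  refine ⟨?_, ?_, fun k _ => ?_⟩
  · push_cast; linarith
  · push_cast; linarith [hD2 (n + 1)]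
  · push_cast; linarith [hD1 k]
end partC

section partD
/-- Standing assumptions on the noise. -/
structure Noise {Ω : Type*} {m0 : MeasurableSpace Ω} (μ : Measure Ω)
    (F : Filtration ℕ m0) (ε : ℕ → Ω → ℝ) (σ a : ℝ) : Prop where
  adapt : ∀ n, StronglyMeasurable[F n] (ε n)
  mds : ∀ n, μ[ε (n + 1)|F n] =ᵐ[μ] 0
  var : ∀ n, μ[fun ω => ε (n + 1) ω ^ 2|F n] =ᵐ[μ] fun _ => σ ^ 2
  momint : ∀ n, Integrable (fun ω => |ε (n + 1) ω| ^ a) μ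
  mom : ∀ᵐ ω ∂μ, ∃ C : ℝ, ∀ n, (μ[fun ω => |ε (n + 1) ω| ^ a|F n]) ω ≤ C
  ha : 2 ≤ a

lemma sm_rpow {Ω : Type*} {m : MeasurableSpace Ω} {f : Ω → ℝ} (hf : StronglyMeasurable f) (q : ℝ) :
    StronglyMeasurable (fun ω => f ω ^ q) := (hf.measurable.pow_const q).stronglyMeasurable

lemma sm_pow {Ω : Type*} {m : MeasurableSpace Ω} {f : Ω → ℝ} (hf : StronglyMeasurable f) (q : ℕ) :
    StronglyMeasurable (fun ω => f ω ^ q) := (hf.measurable.pow_const q).stronglyMeasurable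

lemma sm_abs {Ω : Type*} {m : MeasurableSpace Ω} {f : Ω → ℝ} (hf : StronglyMeasurable f) :
    StronglyMeasurable (fun ω => |f ω|) := continuous_abs.comp_stronglyMeasurable hf

lemma sm_div {Ω : Type*} {m : MeasurableSpace Ω} {f g : Ω → ℝ} (hf : StronglyMeasurable f)
    (hg : StronglyMeasurable g) :
    StronglyMeasurable (fun ω => f ω / g ω) := (hf.measurable.div hg.measurable).stronglyMeasurable

lemma sm_mul {Ω : Type*} {m : MeasurableSpace Ω} {f g : Ω → ℝ} (hf : StronglyMeasurable f)
    (hg : StronglyMeasurable g) :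
    StronglyMeasurable (fun ω => f ω * g ω) := (hf.measurable.mul hg.measurable).stronglyMeasurable

lemma sm_add {Ω : Type*} {m : MeasurableSpace Ω} {f g : Ω → ℝ} (hf : StronglyMeasurable f)
    (hg : StronglyMeasurable g) :
    StronglyMeasurable (fun ω => f ω + g ω) := (hf.measurable.add hg.measurable).stronglyMeasurable

lemma sm_sub {Ω : Type*} {m : MeasurableSpace Ω} {f g : Ω → ℝ} (hf : StronglyMeasurable f)
    (hg : StronglyMeasurable g) :
    StronglyMeasurable (fun ω => f ω - g ω) := (hf.measurable.sub hg.measurable).stronglyMeasurable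

lemma sm_const {Ω : Type*} {m : MeasurableSpace Ω} (c : ℝ) :
    StronglyMeasurable (fun _ : Ω => c) := stronglyMeasurable_const

lemma sm_sqrt {Ω : Type*} {m : MeasurableSpace Ω} {f : Ω → ℝ} (hf : StronglyMeasurable f) :
    StronglyMeasurable (fun ω => √(f ω)) := Real.continuous_sqrt.comp_stronglyMeasurable hf

lemma add_rpow_le4 {x y r : ℝ} (hx : 0 ≤ x) (hy : 0 ≤ y) (hr : 0 ≤ r) :
    (x + y) ^ r ≤ 2 ^ r * (x ^ r + y ^ r) := by
  have h : (x + y) ^ r ≤ (2 * max x y) ^ r := by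
    apply Real.rpow_le_rpow (by positivity) _ hr
    linarith [le_max_left x y, le_max_right x y]
  rw [Real.mul_rpow (by norm_num) (le_max_of_le_left hx)] at h
  refine h.trans ?_
  gcongr
  rcases max_choice x y with e | e <;> rw [e]
  · linarith [Real.rpow_nonneg hy r]
  · linarith [Real.rpow_nonneg hx r]

section
variable {Ω : Type*} {m0 : MeasurableSpace Ω} {μ : Measure Ω} [IsProbabilityMeasure μ]
    {F : Filtration ℕ m0} {ε : ℕ → Ω → ℝ} {σ a : ℝ}

lemma cond_data (hN : Noise μ F ε σ a) (Z : ℕ → Ω → ℝ)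
    (hZm : ∀ k, StronglyMeasurable[F (k + 1)] (Z k))
    (hb : ∀ k ω, |Z k ω| ≤ (1 + |ε (k + 1) ω|) ^ a) :
    (∀ k, Integrable (Z k) μ) ∧ ∀ᵐ ω ∂μ, ∃ C, 0 ≤ C ∧ ∀ k, |(μ[Z k|F k]) ω| ≤ C := by
  have ha := hN.ha
  have hb' : ∀ k ω, |Z k ω| ≤ 2 ^ a * (1 + |ε (k + 1) ω| ^ a) := by
    intro k ω
    refine (hb k ω).trans ?_
    have := add_rpow_le4 (x := 1) (y := |ε (k + 1) ω|) (r := a) zero_le_one (abs_nonneg _)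
      (by linarith)
    rwa [Real.one_rpow] at this
  have hWi : ∀ k, Integrable (fun ω => 2 ^ a * (1 + |ε (k + 1) ω| ^ a)) μ := fun k =>
    ((integrable_const 1).add (hN.momint k)).const_mul _
  have hi : ∀ k, Integrable (Z k) μ := fun k =>
    (hWi k).mono' ((hZm k).mono (F.le _)).aestronglyMeasurable (Eventually.of_forall (hb' k))
  refine ⟨hi, ?_⟩
  have h1 : ∀ k, ∀ᵐ ω ∂μ, |(μ[Z k|F k]) ω| ≤
      2 ^ a * (1 + (μ[fun ω => |ε (k + 1) ω| ^ a|F k]) ω) := by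
    intro k
    have e : μ[fun ω => 2 ^ a * (1 + |ε (k + 1) ω| ^ a)|F k] =ᵐ[μ]
        fun ω => 2 ^ a * (1 + (μ[fun ω => |ε (k + 1) ω| ^ a|F k]) ω) := by
      have e1 := condExp_smul (μ := μ) ((2:ℝ) ^ a) (fun ω => 1 + |ε (k + 1) ω| ^ a) (F k)
      have e2 := condExp_add (μ := μ) (integrable_const (1:ℝ)) (hN.momint k) (F k)
      have e3 := condExp_const (μ := μ) (F.le k) (1:ℝ)
      filter_upwards [e1, e2] with ω h1 h2
      have h1' : (μ[fun ω => 2 ^ a * (1 + |ε (k + 1) ω| ^ a)|F k]) ω =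
        2 ^ a * (μ[fun ω => (1 + |ε (k + 1) ω| ^ a)|F k]) ω := h1
      have h2' : (μ[fun ω => (1 + |ε (k + 1) ω| ^ a)|F k]) ω =
        (μ[fun _ => (1:ℝ)|F k]) ω + (μ[fun ω => |ε (k + 1) ω| ^ a|F k]) ω := h2
      rw [h1', h2', e3]
    have u1 := condExp_mono (m := F k) (hi k) (hWi k)
      (Eventually.of_forall fun ω => (le_abs_self _).trans (hb' k ω))
    have u2 := condExp_mono (m := F k) (hi k).neg (hWi k)
      (Eventually.of_forall fun ω => (neg_le_abs _).trans (hb' k ω))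
    have u3 := condExp_neg (μ := μ) (Z k) (F k)
    filter_upwards [e, u1, u2, u3] with ω h1 h2 h3 h4
    rw [h1] at h2 h3
    rw [h4] at h3
    simp only [Pi.neg_apply] at h3
    exact abs_le.2 ⟨by linarith, h2⟩
  filter_upwards [ae_all_iff.2 h1, hN.mom] with ω hω ⟨C, hC⟩
  have h2 : (0:ℝ) ≤ 2 ^ a := by positivity
  refine ⟨2 ^ a * (1 + |C|), by positivity, fun k => (hω k).trans ?_⟩
  gcongr
  exact (hC k).trans (le_abs_self C)

theorem lln (hN : Noise μ F ε σ a) {r : ℝ} (hr1 : 1 < r) (hr2 : r ≤ 2) (s : ℝ) (hs : 0 ≤ s)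
    (Z : ℕ → Ω → ℝ) (hZm : ∀ k, StronglyMeasurable[F (k + 1)] (Z k))
    (hb : ∀ k ω, |Z k ω| ≤ (1 + |ε (k + 1) ω|) ^ a)
    (hbr : ∀ k ω, |Z k ω| ^ r ≤ (1 + |ε (k + 1) ω|) ^ a)
    (γ ℓ : ℕ → Ω → ℝ) (hγ : ∀ k, StronglyMeasurable[F k] (γ k))
    (hℓ : ∀ k, StronglyMeasurable[F k] (ℓ k)) (hℓ1 : ∀ k ω, 1 ≤ ℓ k ω)
    (hℓm : ∀ k ω, ℓ k ω ≤ ℓ (k + 1) ω) :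
    ∀ᵐ ω ∂μ, (Summable fun k => |γ k ω| ^ r / ℓ k ω ^ s) →
      ∃ C, ∀ n, |∑ k ∈ range n, γ k ω * (Z k ω - (μ[Z k|F k]) ω)| ^ r ≤ C * ℓ n ω ^ s := by
  obtain ⟨hZi, hZc⟩ := cond_data hN Z hZm hb
  let Y : ℕ → Ω → ℝ := fun k ω => |Z k ω| ^ r
  have hYm : ∀ k, StronglyMeasurable[F (k + 1)] (Y k) := fun k => sm_rpow (sm_abs (hZm k)) r
  obtain ⟨hYi, hYc⟩ := cond_data hN Y hYm (fun k ω => by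
    simp only [Y]; rw [abs_of_nonneg (by positivity)]; exact hbr k ω)
  have hr0 : 0 < r := by linarith
  let e : ℕ → Ω → ℝ := fun k => μ[Z k|F k]
  let E : ℕ → Ω → ℝ := fun k => μ[Y k|F k]
  have hem : ∀ k, StronglyMeasurable[F k] (e k) := fun k => stronglyMeasurable_condExp
  have hEm : ∀ k, StronglyMeasurable[F k] (E k) := fun k => stronglyMeasurable_condExp
  let N : ℕ → Ω → ℝ := fun n ω => ∑ k ∈ range n, γ k ω * (Z k ω - e k ω)
  have hNm : ∀ n, StronglyMeasurable[F n] (N n) := by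
    intro n
    refine Finset.stronglyMeasurable_fun_sum _ fun k hk => ?_
    have hk : k + 1 ≤ n := by simp at hk; omega
    exact sm_mul ((hγ k).mono (F.mono (by omega)))
      (sm_sub ((hZm k).mono (F.mono hk)) ((hem k).mono (F.mono (by omega))))
  let U : ℕ → Ω → ℝ := fun n ω => |N n ω| ^ r / ℓ n ω ^ s
  let G : Fin 2 → ℕ → Ω → ℝ := ![fun n ω => r * (N n ω * |N n ω| ^ (r - 2)) * γ n ω / ℓ n ω ^ s,
    fun n ω => 24 * |γ n ω| ^ r / ℓ n ω ^ s]
  let ξ : Fin 2 → ℕ → Ω → ℝ := ![fun n ω => Z n ω - e n ω, fun n ω => Y n ω - E n ω]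
  let C : ℕ → Ω → ℝ := fun n ω => 24 * |γ n ω| ^ r * (|E n ω| + |e n ω| ^ r) / ℓ n ω ^ s
  have hlp : ∀ n ω, 0 < ℓ n ω := fun n ω => by linarith [hℓ1 n ω]
  have key := rs (μ := μ) F U C 2 G ξ
    (fun n ω => by have := hlp n ω; simp only [U]; positivity)
    (sm_div (sm_rpow (sm_abs (hNm 0)) r) (sm_rpow (hℓ 0) s))
    (fun n ω => by have := hlp n ω; simp only [C]; positivity)
    (fun n => sm_div (sm_mul (sm_mul (sm_const 24) (sm_rpow (sm_abs (hγ n)) r))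
      (sm_add (sm_abs (hEm n)) (sm_rpow (sm_abs (hem n)) r))) (sm_rpow (hℓ n) s))
    (fun i n => by
      fin_cases i
      · exact sm_div (sm_mul (sm_mul (sm_const r) (sm_mul (hNm n)
          (sm_rpow (sm_abs (hNm n)) _))) (hγ n)) (sm_rpow (hℓ n) s)
      · exact sm_div (sm_mul (sm_const 24) (sm_rpow (sm_abs (hγ n)) r)) (sm_rpow (hℓ n) s))
    (fun i n => by
      fin_cases i
      · exact sm_sub (hZm n) ((hem n).mono (F.mono (Nat.le_succ n)))
      · exact sm_sub (hYm n) ((hEm n).mono (F.mono (Nat.le_succ n))))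
    (fun i n => by
      fin_cases i
      · exact (hZi n).sub integrable_condExp
      · exact (hYi n).sub integrable_condExp)
    (fun i n => by
      have aux : ∀ W : Ω → ℝ, Integrable W μ → μ[fun ω => W ω - (μ[W|F n]) ω|F n] =ᵐ[μ] 0 := by
        intro W hW
        have h1 := condExp_sub (μ := μ) hW (integrable_condExp (m := F n) (f := W)) (F n)
        refine h1.trans ?_
        rw [condExp_of_stronglyMeasurable (F.le n) stronglyMeasurable_condExp integrable_condExp]
        filter_upwards with ω; simp
      fin_cases i
      · exact aux _ (hZi n)
      · exact aux _ (hYi n))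
    (by
      filter_upwards with ω n
      rw [Fin.sum_univ_two]
      simp only [G, ξ, U, C, Matrix.cons_val_zero, Matrix.cons_val_one]
      have hl := hlp n ω
      have hls : 0 < ℓ n ω ^ s := by positivity
      have hsucc : N (n + 1) ω = N n ω + γ n ω * (Z n ω - e n ω) := Finset.sum_range_succ _ _
      have h1 := vbe hr1 hr2 (N n ω) (γ n ω * (Z n ω - e n ω))
      have h2 : |γ n ω * (Z n ω - e n ω)| ^ r ≤ |γ n ω| ^ r * (4 * (Y n ω + |e n ω| ^ r)) := by
        rw [abs_mul, Real.mul_rpow (abs_nonneg _) (abs_nonneg _)]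
        gcongr
        have h3 : |Z n ω - e n ω| ≤ |Z n ω| + |e n ω| := abs_sub _ _
        have h4 := add_rpow_le4 (abs_nonneg (Z n ω)) (abs_nonneg (e n ω)) hr0.le
        have h5 : (2:ℝ) ^ r ≤ 4 := by
          calc (2:ℝ) ^ r ≤ 2 ^ (2:ℝ) := Real.rpow_le_rpow_of_exponent_le (by norm_num) hr2
            _ = 4 := by norm_num
        calc _ ≤ (|Z n ω| + |e n ω|) ^ r := Real.rpow_le_rpow (abs_nonneg _) h3 hr0.le
          _ ≤ _ := h4
          _ ≤ _ := by simp only [Y]; gcongr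
      have h6 : |N (n + 1) ω| ^ r / ℓ (n + 1) ω ^ s ≤ |N (n + 1) ω| ^ r / ℓ n ω ^ s := by
        gcongr
        exact hℓm n ω
      refine h6.trans ?_
      rw [← sub_nonneg]
      have : |N n ω| ^ r / ℓ n ω ^ s + 24 * |γ n ω| ^ r * (|E n ω| + |e n ω| ^ r) / ℓ n ω ^ s +
        (r * (N n ω * |N n ω| ^ (r - 2)) * γ n ω / ℓ n ω ^ s * (Z n ω - e n ω) +
          24 * |γ n ω| ^ r / ℓ n ω ^ s * (Y n ω - E n ω)) - |N (n + 1) ω| ^ r / ℓ n ω ^ s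
        = (|N n ω| ^ r + 24 * |γ n ω| ^ r * (|E n ω| + |e n ω| ^ r) +
        (r * (N n ω * |N n ω| ^ (r - 2)) * γ n ω  * (Z n ω - e n ω) +
          24 * |γ n ω| ^ r  * (Y n ω - E n ω)) - |N (n + 1) ω| ^ r) / ℓ n ω ^ s := by ring
      rw [this]
      apply div_nonneg _ hls.le
      rw [hsucc]
      have h7 : 0 ≤ |γ n ω| ^ r * (|E n ω| - E n ω) := by
        have := le_abs_self (E n ω)
        apply mul_nonneg (by positivity) (by linarith)
      nlinarith [h1, h2, h7])
  filter_upwards [key, hZc, hYc] with ω hω ⟨C1, hC10, hC1⟩ ⟨C2, hC20, hC2⟩ hsum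
  have hb : ∃ D : ℝ, ∀ n, ∑ k ∈ range n, C k ω ≤ D := by
    refine ⟨24 * (C2 + C1 ^ r) * ∑' k, |γ k ω| ^ r / ℓ k ω ^ s, fun n => ?_⟩
    calc ∑ k ∈ range n, C k ω ≤ ∑ k ∈ range n, 24 * (C2 + C1 ^ r) * (|γ k ω| ^ r / ℓ k ω ^ s) := by
          refine Finset.sum_le_sum fun k _ => ?_
          have := hlp k ω
          have h1 : |e k ω| ^ r ≤ C1 ^ r := Real.rpow_le_rpow (abs_nonneg _) (hC1 k) hr0.le
          have h2 : |E k ω| ≤ C2 := hC2 k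
          calc C k ω = 24 * (|E k ω| + |e k ω| ^ r) * (|γ k ω| ^ r / ℓ k ω ^ s) := by
                simp only [C]; ring
            _ ≤ _ := by gcongr
      _ = 24 * (C2 + C1 ^ r) * ∑ k ∈ range n, (|γ k ω| ^ r / ℓ k ω ^ s) := by rw [Finset.mul_sum]
      _ ≤ _ := by
          gcongr
          exact hsum.sum_le_tsum _ fun k _ => by have := hlp k ω; positivity
  obtain ⟨K, hK⟩ := hω hb
  refine ⟨K, fun n => ?_⟩
  have := hK n
  have hl := hlp n ω
  simp only [U] at this
  rwa [div_le_iff₀ (by positivity)] at this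

/-- Law of large numbers in little-o form. -/
theorem lln_o (hN : Noise μ F ε σ a) {r : ℝ} (hr1 : 1 < r) (hr2 : r ≤ 2) {η : ℝ} (hη : 0 < η)
    (hη1 : η < 1)
    (Z : ℕ → Ω → ℝ) (hZm : ∀ k, StronglyMeasurable[F (k + 1)] (Z k))
    (hb : ∀ k ω, |Z k ω| ≤ (1 + |ε (k + 1) ω|) ^ a)
    (hbr : ∀ k ω, |Z k ω| ^ r ≤ (1 + |ε (k + 1) ω|) ^ a)
    (γ ℓ : ℕ → Ω → ℝ) (hγ : ∀ k, StronglyMeasurable[F k] (γ k))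
    (hℓ : ∀ k, StronglyMeasurable[F k] (ℓ k)) (hℓ1 : ∀ k ω, 1 ≤ ℓ k ω)
    (hℓm : ∀ k ω, ℓ k ω ≤ ℓ (k + 1) ω) (hℓ2 : ∀ k ω, ℓ (k + 1) ω ≤ 2 * ℓ k ω) :
    ∀ᵐ ω ∂μ, Tendsto (fun n => ℓ n ω) atTop atTop →
      (∃ (w : ℕ → ℝ) (C : ℝ), (∀ k, 0 ≤ w k) ∧ BO w (fun n => ℓ n ω) ∧
        ∀ k, |γ k ω| ^ r ≤ C * w k * ℓ k ω ^ ((1 - η) * (r - 1))) →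
      Tendsto (fun n => (∑ k ∈ range n, γ k ω * (Z k ω - (μ[Z k|F k]) ω)) / ℓ n ω) atTop (𝓝 0) := by
  have hq : 0 < η * (r - 1) / 2 := by
    have : 0 < r - 1 := by linarith
    positivity
  have hq2 : η * (r - 1) < r := by nlinarith
  have key := lln hN hr1 hr2 (r - η * (r - 1) / 2) (by linarith) Z hZm hb hbr γ ℓ hγ hℓ hℓ1 hℓm
  filter_upwards [key] with ω hω hℓt ⟨w, C, hw0, hw, hγw⟩
  have hlp : ∀ n, 0 < ℓ n ω := fun n => by linarith [hℓ1 n ω]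
  have hsum : Summable fun k => |γ k ω| ^ r / ℓ k ω ^ (r - η * (r - 1) / 2) := by
    have h1 := ds hw0 (fun n => hℓ1 n ω) (fun n => hℓ2 n ω) hw hq
    refine Summable.of_nonneg_of_le (fun k => ?_) (fun k => ?_) (h1.mul_left |C|)
    · have := hlp k; positivity
    · have hp := hlp k
      rw [div_le_iff₀ (by positivity)]
      refine (hγw k).trans ?_
      have e : ℓ k ω ^ (r - η * (r - 1) / 2) = ℓ k ω ^ (1 + η * (r - 1) / 2) *
          ℓ k ω ^ ((1 - η) * (r - 1)) := by
        rw [← Real.rpow_add hp]; congr 1; ring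
      rw [e]
      have e2 : |C| * (w k / ℓ k ω ^ (1 + η * (r - 1) / 2)) * (ℓ k ω ^ (1 + η * (r - 1) / 2) *
          ℓ k ω ^ ((1 - η) * (r - 1))) = |C| * w k * ℓ k ω ^ ((1 - η) * (r - 1)) := by
        have : ℓ k ω ^ (1 + η * (r - 1) / 2) ≠ 0 := by positivity
        field_simp
      rw [e2]
      gcongr
      · exact hw0 k
      · exact le_abs_self C
  obtain ⟨D, hD⟩ := hω hsum
  have hr0 : 0 < r := by linarith
  set T : ℕ → ℝ := fun n => ∑ k ∈ range n, γ k ω * (Z k ω - (μ[Z k|F k]) ω) with hT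
  have hlim : Tendsto (fun n => (|D| * (ℓ n ω) ^ (-(η * (r - 1) / 2))) ^ (1 / r)) atTop (𝓝 0) := by
    have h1 : Tendsto (fun n => |D| * (ℓ n ω) ^ (-(η * (r - 1) / 2))) atTop (𝓝 0) := by
      have := ((tendsto_rpow_neg_atTop hq).comp hℓt).const_mul |D|
      simpa using this
    have h2 := h1.rpow_const (p := 1 / r) (Or.inr (by positivity))
    rwa [Real.zero_rpow (by positivity)] at h2
  refine squeeze_zero_norm (fun n => ?_) hlim
  have hp := hlp n
  have hx : 0 ≤ ‖T n / ℓ n ω‖ := norm_nonneg _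
  have h1 : ‖T n / ℓ n ω‖ ^ r ≤ |D| * ℓ n ω ^ (-(η * (r - 1) / 2)) := by
    rw [norm_div, Real.norm_eq_abs, Real.norm_of_nonneg hp.le, Real.div_rpow (abs_nonneg _) hp.le,
      div_le_iff₀ (by positivity), mul_assoc, ← Real.rpow_add hp]
    refine (hD n).trans ?_
    have e : -(η * (r - 1) / 2) + r = r - η * (r - 1) / 2 := by ring
    rw [e]
    gcongr
    exact le_abs_self D
  calc ‖T n / ℓ n ω‖ = (‖T n / ℓ n ω‖ ^ r) ^ (1 / r) := by
        rw [← Real.rpow_mul hx, mul_one_div_cancel hr0.ne', Real.rpow_one]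
    _ ≤ _ := Real.rpow_le_rpow (by positivity) h1 (by positivity)

end
end partD

section partE
section
variable {Ω : Type*} {m0 : MeasurableSpace Ω} {μ : Measure Ω} [IsProbabilityMeasure μ]
    {F : Filtration ℕ m0} {ε : ℕ → Ω → ℝ} {σ a : ℝ}

lemma one_add_rpow_mono {x s t : ℝ} (h : s ≤ t) : (1 + |x|) ^ s ≤ (1 + |x|) ^ t :=
  Real.rpow_le_rpow_of_exponent_le (by linarith [abs_nonneg x]) h

lemma centered (hN : Noise μ F ε σ a) (Z : ℕ → Ω → ℝ)
    (hZm : ∀ k, StronglyMeasurable[F (k + 1)] (Z k))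
    (hb : ∀ k ω, |Z k ω| ≤ (1 + |ε (k + 1) ω|) ^ a) (n : ℕ) :
    μ[fun ω => Z n ω - (μ[Z n|F n]) ω|F n] =ᵐ[μ] 0 := by
  have hW := (cond_data hN Z hZm hb).1 n
  have h1 := condExp_sub (μ := μ) hW (integrable_condExp (m := F n) (f := Z n)) (F n)
  refine h1.trans ?_
  rw [condExp_of_stronglyMeasurable (F.le n) stronglyMeasurable_condExp integrable_condExp]
  filter_upwards with ω; simp

lemma kxq {k A x q : ℝ} (hq1 : 1 < q) (hk : 0 ≤ k) (hA : 0 ≤ A) (hAx : A ≤ x) :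
    k * A ^ (q - 1) ≤ x ^ q + k ^ q := by
  have hx0 : 0 ≤ x := hA.trans hAx
  have h3 : A ^ (q - 1) ≤ x ^ (q - 1) := Real.rpow_le_rpow hA hAx (by linarith)
  have e : ∀ y : ℝ, 0 ≤ y → y * y ^ (q - 1) = y ^ q := by
    intro y hy
    rcases hy.eq_or_lt with h | h
    · rw [← h, Real.zero_rpow (by linarith : q ≠ 0), zero_mul]
    · rw [Real.rpow_sub_one h.ne']; field_simp
  have hxq : 0 ≤ x ^ q := by positivity
  have hkq : 0 ≤ k ^ q := by positivity
  rcases le_total k x with h | h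
  · calc k * A ^ (q - 1) ≤ x * x ^ (q - 1) := by gcongr
      _ = x ^ q := e x hx0
      _ ≤ _ := by linarith
  · have h4 : x ^ (q - 1) ≤ k ^ (q - 1) := Real.rpow_le_rpow hx0 h (by linarith)
    calc k * A ^ (q - 1) ≤ k * k ^ (q - 1) := mul_le_mul_of_nonneg_left (h3.trans h4) hk
      _ = k ^ q := e _ hk
      _ ≤ _ := by linarith

set_option maxHeartbeats 1000000 in
theorem apriori (hN : Noise μ F ε σ a) {p : ℕ} (hp : 1 ≤ p) (ha : 2 * p < a)
    (X c B ℓ : ℕ → Ω → ℝ) (hXm : ∀ n, StronglyMeasurable[F n] (X n))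
    (hcm : ∀ n, StronglyMeasurable[F n] (c n)) (hBm : ∀ n, StronglyMeasurable[F n] (B n))
    (hX0 : ∀ n ω, 0 ≤ X n ω) (hc0 : ∀ n ω, 0 ≤ c n ω) (hc1 : ∀ n ω, c n ω ≤ 1)
    (hB : ∀ n ω, B n ω ^ 2 ≤ 4 * ((1 - c n ω) * X n ω) * c n ω)
    (hrec : ∀ n ω, X (n + 1) ω = (1 - c n ω) * X n ω + B n ω * ε (n + 1) ω +
      c n ω * ε (n + 1) ω ^ 2)
    (hℓ : ∀ k, StronglyMeasurable[F k] (ℓ k)) (hℓ1 : ∀ k ω, 1 ≤ ℓ k ω)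
    (hℓm : ∀ k ω, ℓ k ω ≤ ℓ (k + 1) ω) (hℓ2 : ∀ k ω, ℓ (k + 1) ω ≤ 2 * ℓ k ω) :
    ∃ η : ℝ, 0 < η ∧ η < 1 ∧ ∀ᵐ ω ∂μ, BO (fun n => c n ω) (fun n => ℓ n ω) →
      ∃ C : ℝ, ∀ n, X n ω ^ p ≤ C * ℓ n ω ^ (1 - η) := by
  have hp1 : (1:ℝ) ≤ p := by exact_mod_cast hp
  set r : ℝ := min 2 (a / 2 - p + 1) with hr
  have hr1 : 1 < r := lt_min (by norm_num) (by linarith)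
  have hr2 : r ≤ 2 := min_le_left _ _
  have hr3 : r ≤ a / 2 - p + 1 := min_le_right _ _
  set q : ℝ := ((p - 1 : ℕ) : ℝ) + r with hq
  have hpc : ((p - 1 : ℕ) : ℝ) = p - 1 := by push_cast [hp]; ring
  have hqp : (p : ℝ) < q := by rw [hq, hpc]; linarith
  have hqa : 2 * q ≤ a := by rw [hq, hpc]; linarith
  have hq1 : 1 < q := by linarith
  obtain ⟨K, hK0, hK⟩ := qineq hr1 hr2 (p - 1)
  rw [← hq] at hK
  set η0 : ℝ := (q - p) / (2 * p) with hη0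
  have hη0p : 0 < η0 := by have : 0 < q - p := by linarith
                           positivity
  have hlp : ∀ n ω, 0 < ℓ n ω := fun n ω => by linarith [hℓ1 n ω]
  let A : ℕ → Ω → ℝ := fun n ω => (1 - c n ω) * X n ω
  have hA0 : ∀ n ω, 0 ≤ A n ω := fun n ω => mul_nonneg (by linarith [hc1 n ω]) (hX0 n ω)
  have hAm : ∀ n, StronglyMeasurable[F n] (A n) := fun n =>
    sm_mul (sm_sub (sm_const 1) (hcm n)) (hXm n)
  let Y : ℕ → Ω → ℝ := fun n ω => |ε (n + 1) ω| ^ (2 * q)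
  let Z1 : ℕ → Ω → ℝ := fun n => ε (n + 1)
  let Z2 : ℕ → Ω → ℝ := fun n ω => ε (n + 1) ω ^ 2
  have hYm : ∀ k, StronglyMeasurable[F (k + 1)] (Y k) := fun k =>
    sm_rpow (sm_abs (hN.adapt (k + 1))) _
  have hZ1m : ∀ k, StronglyMeasurable[F (k + 1)] (Z1 k) := fun k => hN.adapt (k + 1)
  have hZ2m : ∀ k, StronglyMeasurable[F (k + 1)] (Z2 k) := fun k => sm_pow (hN.adapt (k + 1)) 2
  have hYb : ∀ k ω, |Y k ω| ≤ (1 + |ε (k + 1) ω|) ^ a := by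
    intro k ω
    simp only [Y]
    rw [abs_of_nonneg (by positivity)]
    refine le_trans ?_ (one_add_rpow_mono hqa)
    exact Real.rpow_le_rpow (abs_nonneg _) (by linarith) (by linarith)
  have hZ1b : ∀ k ω, |Z1 k ω| ≤ (1 + |ε (k + 1) ω|) ^ a := by
    intro k ω
    refine le_trans ?_ (one_add_rpow_mono (s := 1) (by linarith))
    rw [Real.rpow_one]; simp only [Z1]; linarith
  have hZ2b : ∀ k ω, |Z2 k ω| ≤ (1 + |ε (k + 1) ω|) ^ a := by
    intro k ω
    refine le_trans ?_ (one_add_rpow_mono (s := 2) (by linarith))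
    simp only [Z2]
    rw [abs_of_nonneg (by positivity), ← sq_abs, Real.rpow_two]
    have := abs_nonneg (ε (k + 1) ω)
    gcongr; linarith
  obtain ⟨hYi, hYc⟩ := cond_data hN Y hYm hYb
  obtain ⟨hZ1i, -⟩ := cond_data hN Z1 hZ1m hZ1b
  obtain ⟨hZ2i, -⟩ := cond_data hN Z2 hZ2m hZ2b
  let E : ℕ → Ω → ℝ := fun k => μ[Y k|F k]
  have hEm : ∀ k, StronglyMeasurable[F k] (E k) := fun k => stronglyMeasurable_condExp
  let U : ℕ → Ω → ℝ := fun n ω => X n ω ^ q / ℓ n ω ^ (1 + η0)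
  let C : ℕ → Ω → ℝ := fun n ω => c n ω * ((K * σ ^ 2) ^ q + K * |E n ω|) / ℓ n ω ^ (1 + η0)
  let G : Fin 3 → ℕ → Ω → ℝ := ![fun n ω => q * A n ω ^ (q - 1) * B n ω / ℓ n ω ^ (1 + η0),
    fun n ω => K * (A n ω ^ (q - 1) * c n ω) / ℓ n ω ^ (1 + η0),
    fun n ω => K * c n ω ^ q / ℓ n ω ^ (1 + η0)]
  let ξ : Fin 3 → ℕ → Ω → ℝ := ![fun n ω => Z1 n ω - (μ[Z1 n|F n]) ω,
    fun n ω => Z2 n ω - (μ[Z2 n|F n]) ω, fun n ω => Y n ω - E n ω]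
  have key := rs (μ := μ) F U C 3 G ξ
    (fun n ω => by have := hlp n ω; have := hX0 n ω; simp only [U]; positivity)
    (sm_div (sm_rpow (hXm 0) q) (sm_rpow (hℓ 0) _))
    (fun n ω => by have := hlp n ω; have := hc0 n ω; simp only [C]; positivity)
    (fun n => sm_div (sm_mul (hcm n) (sm_add (sm_const _) (sm_mul (sm_const K) (sm_abs (hEm n)))))
      (sm_rpow (hℓ n) _))
    (fun i n => by
      fin_cases i
      · exact sm_div (sm_mul (sm_mul (sm_const q) (sm_rpow (hAm n) _)) (hBm n)) (sm_rpow (hℓ n) _)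
      · exact sm_div (sm_mul (sm_const K) (sm_mul (sm_rpow (hAm n) _) (hcm n))) (sm_rpow (hℓ n) _)
      · exact sm_div (sm_mul (sm_const K) (sm_rpow (hcm n) _)) (sm_rpow (hℓ n) _))
    (fun i n => by
      fin_cases i
      · exact sm_sub (hZ1m n) (stronglyMeasurable_condExp.mono (F.mono (Nat.le_succ n)))
      · exact sm_sub (hZ2m n) (stronglyMeasurable_condExp.mono (F.mono (Nat.le_succ n)))
      · exact sm_sub (hYm n) ((hEm n).mono (F.mono (Nat.le_succ n))))
    (fun i n => by
      fin_cases i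
      · exact (hZ1i n).sub integrable_condExp
      · exact (hZ2i n).sub integrable_condExp
      · exact (hYi n).sub integrable_condExp)
    (fun i n => by
      fin_cases i
      · exact centered hN Z1 hZ1m hZ1b n
      · exact centered hN Z2 hZ2m hZ2b n
      · exact centered hN Y hYm hYb n)
    (by
      filter_upwards [ae_all_iff.2 hN.mds, ae_all_iff.2 hN.var] with ω hmds hvar n
      rw [Fin.sum_univ_three]
      have e1 : (μ[Z1 n|F n]) ω = 0 := hmds n
      have e2 : (μ[Z2 n|F n]) ω = σ ^ 2 := hvar n
      simp only [G, ξ, U, C, Matrix.cons_val_zero, Matrix.cons_val_one, Matrix.cons_val]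
      rw [e1, e2]
      have hl := hlp n ω
      set x := X n ω with hx
      have hx0 : 0 ≤ x := hX0 n ω
      set cc := c n ω with hcc
      have hcc0 : 0 ≤ cc := hc0 n ω
      have hcc1 : cc ≤ 1 := hc1 n ω
      have hAe : A n ω = (1 - cc) * x := rfl
      have hAx : A n ω ≤ x := by rw [hAe]; nlinarith
      set AA := A n ω with hAA
      have hAA0 : 0 ≤ AA := hA0 n ω
      have hX1 : 0 ≤ X (n + 1) ω ^ q := Real.rpow_nonneg (hX0 _ _) _
      have h0 := hK AA (B n ω) cc (ε (n + 1) ω) hAA0 hcc0 (hB n ω)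
      have h0' : X (n + 1) ω ^ q ≤ AA ^ q + q * AA ^ (q - 1) * B n ω * ε (n + 1) ω +
          K * (AA ^ (q - 1) * cc * ε (n + 1) ω ^ 2 + cc ^ q * |ε (n + 1) ω| ^ (2 * q)) := by
        rw [hrec]; exact h0
      have h6 : X (n + 1) ω ^ q / ℓ (n + 1) ω ^ (1 + η0) ≤ X (n + 1) ω ^ q / ℓ n ω ^ (1 + η0) := by
        gcongr
        exact hℓm n ω
      refine h6.trans ?_
      have hls : 0 < ℓ n ω ^ (1 + η0) := by positivity
      generalize ℓ n ω ^ (1 + η0) = T at hls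
      rw [← sub_nonneg]
      have : x ^ q / T + cc * ((K * σ ^ 2) ^ q + K * |E n ω|) / T +
          (q * AA ^ (q - 1) * B n ω / T * (Z1 n ω - 0) + K * (AA ^ (q - 1) * cc) / T *
            (Z2 n ω - σ ^ 2) + K * cc ^ q / T * (Y n ω - E n ω)) - X (n + 1) ω ^ q / T =
          (x ^ q  + cc * ((K * σ ^ 2) ^ q + K * |E n ω|) +
          (q * AA ^ (q - 1) * B n ω * Z1 n ω + K * (AA ^ (q - 1) * cc)  *
            (Z2 n ω - σ ^ 2) + K * cc ^ q  * (Y n ω - E n ω)) - X (n + 1) ω ^ q) / T := by ring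
      rw [this]
      apply div_nonneg _ hls.le
      have h1 : AA ^ q ≤ (1 - cc) * x ^ q := by
        rw [hAe, Real.mul_rpow (by linarith) hx0]
        gcongr
        have := Real.rpow_le_rpow_of_exponent_ge' (x := 1 - cc) (by linarith) (by linarith)
          zero_le_one hq1.le
        rwa [Real.rpow_one] at this
      have h2 := kxq (k := K * σ ^ 2) hq1 (by positivity) hAA0 hAx
      have h2' := mul_le_mul_of_nonneg_left h2 hcc0
      have h3 : cc ^ q * E n ω ≤ cc * |E n ω| := by
        have h4 : cc ^ q ≤ cc := by
          have := Real.rpow_le_rpow_of_exponent_ge' hcc0 hcc1 zero_le_one hq1.le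
          rwa [Real.rpow_one] at this
        calc cc ^ q * E n ω ≤ cc ^ q * |E n ω| := by gcongr; exact le_abs_self _
          _ ≤ _ := by gcongr
      have h3' := mul_le_mul_of_nonneg_left h3 hK0
      simp only [Z1, Z2, Y]
      nlinarith [h0', h1, h2', h3'])
  refine ⟨(q - p) / (2 * q), by apply div_pos <;> linarith, by
    rw [div_lt_one (by linarith)]; linarith, ?_⟩
  filter_upwards [key, hYc] with ω hω ⟨C1, hC10, hC1⟩ hBO
  have hb : ∃ D : ℝ, ∀ n, ∑ k ∈ range n, C k ω ≤ D := by
    have hsum := ds (fun k => hc0 k ω) (fun n => hℓ1 n ω) (fun n => hℓ2 n ω) hBO hη0p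
    refine ⟨((K * σ ^ 2) ^ q + K * C1) * ∑' k, c k ω / ℓ k ω ^ (1 + η0), fun n => ?_⟩
    calc ∑ k ∈ range n, C k ω ≤
        ∑ k ∈ range n, ((K * σ ^ 2) ^ q + K * C1) * (c k ω / ℓ k ω ^ (1 + η0)) := by
          refine Finset.sum_le_sum fun k _ => ?_
          have := hlp k ω
          have := hc0 k ω
          have h2 : |E k ω| ≤ C1 := hC1 k
          calc C k ω = ((K * σ ^ 2) ^ q + K * |E k ω|) * (c k ω / ℓ k ω ^ (1 + η0)) := by
                simp only [C]; ring
            _ ≤ _ := by gcongr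
      _ = ((K * σ ^ 2) ^ q + K * C1) * ∑ k ∈ range n, (c k ω / ℓ k ω ^ (1 + η0)) := by
          rw [Finset.mul_sum]
      _ ≤ _ := by
          gcongr
          exact hsum.sum_le_tsum _ fun k _ => by
            have := hlp k ω; have := hc0 k ω; positivity
  obtain ⟨D, hD⟩ := hω hb
  refine ⟨|D| ^ (p / q), fun n => ?_⟩
  have hl := hlp n ω
  have hx := hX0 n ω
  have h1 : X n ω ^ q ≤ |D| * ℓ n ω ^ (1 + η0) := by
    have := hD n
    simp only [U] at this
    rw [div_le_iff₀ (by positivity)] at this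
    refine this.trans ?_
    gcongr; exact le_abs_self D
  have hq0 : q ≠ 0 := by linarith
  calc X n ω ^ p = (X n ω ^ q) ^ (p / q) := by
        rw [← Real.rpow_mul hx, mul_div_cancel₀ _ hq0, Real.rpow_natCast]
    _ ≤ (|D| * ℓ n ω ^ (1 + η0)) ^ (p / q) := Real.rpow_le_rpow (by positivity) h1 (by positivity)
    _ = _ := by
        rw [Real.mul_rpow (abs_nonneg _) (by positivity), ← Real.rpow_mul hl.le]
        congr 2
        rw [hη0]
        have : (p:ℝ) ≠ 0 := by linarith
        field_simp
        ring

end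
end partE

section partG
section
variable {Ω : Type*} {m0 : MeasurableSpace Ω} {μ : Measure Ω} [IsProbabilityMeasure μ]
    {F : Filtration ℕ m0} {ε : ℕ → Ω → ℝ} {σ a : ℝ}

/-- bound of the second order coefficient -/
lemma Gbound {A X B c : ℝ} (n : ℕ) (hA : 0 ≤ A) (hAX : A ≤ X) (hc : 0 ≤ c)
    (hB : B ^ 2 ≤ 4 * A * c) :
    0 ≤ ((n:ℝ) + 1) * A ^ n * c + ((n + 1).choose 2 : ℕ) * A ^ (n - 1) * B ^ 2 ∧
    ((n:ℝ) + 1) * A ^ n * c + ((n + 1).choose 2 : ℕ) * A ^ (n - 1) * B ^ 2 ≤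
      ((n:ℝ) + 1 + 4 * ((n + 1).choose 2 : ℕ)) * (c * X ^ n) := by
  refine ⟨by positivity, ?_⟩
  have h1 : A ^ n ≤ X ^ n := pow_le_pow_left₀ hA hAX n
  have h2 : (((n + 1).choose 2 : ℕ) : ℝ) * A ^ (n - 1) * B ^ 2 ≤
      4 * ((n + 1).choose 2 : ℕ) * (c * A ^ n) := by
    rcases Nat.eq_zero_or_pos n with h | h
    · subst h; simp
    · have e : A ^ n = A ^ (n - 1) * A := by rw [← pow_succ]; congr 1; omega
      rw [e]
      have : 0 ≤ (((n + 1).choose 2 : ℕ) : ℝ) * A ^ (n - 1) := by positivity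
      nlinarith [mul_le_mul_of_nonneg_left hB this]
  have h3 : c * A ^ n ≤ c * X ^ n := by gcongr
  have h4 : (0:ℝ) ≤ ((n + 1).choose 2 : ℕ) := by positivity
  have h5 : (0:ℝ) ≤ n := by positivity
  nlinarith [mul_le_mul_of_nonneg_left h3 h4, mul_le_mul_of_nonneg_left h3 h5]

lemma rpow_split {w K u T r η C : ℝ} (hr : 1 < r) (hη : η < 1) (hw0 : 0 ≤ w) (hK : 0 ≤ K)
    (hu : 0 ≤ u) (hT : 1 ≤ T) (huT : u ≤ C * T ^ (1 - η)) (hwu : w ≤ K * u) (hC : 0 ≤ C) :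
    w ^ r ≤ (K * C) ^ (r - 1) * w * T ^ ((1 - η) * (r - 1)) := by
  have hT0 : 0 < T := by linarith
  rcases hw0.eq_or_lt with h | h
  · rw [← h, Real.zero_rpow (by linarith)]; simp
  · have e : w ^ r = w ^ (r - 1) * w := by
      rw [Real.rpow_sub_one h.ne']; field_simp
    have h1 : w ≤ K * C * T ^ (1 - η) := hwu.trans (by rw [mul_assoc]; gcongr)
    have h2 : w ^ (r - 1) ≤ (K * C) ^ (r - 1) * T ^ ((1 - η) * (r - 1)) := by
      refine (Real.rpow_le_rpow hw0 h1 (by linarith)).trans (le_of_eq ?_)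
      rw [Real.mul_rpow (by positivity) (by positivity), ← Real.rpow_mul hT0.le]
    rw [e]
    nlinarith

set_option maxHeartbeats 1000000 in
theorem mainlem (hN : Noise μ F ε σ a) {p : ℕ} (ha : 2 * p < a) (n : ℕ) (hnp : n + 1 ≤ p)
    {η : ℝ} (hη : 0 < η) (hη1 : η < 1)
    (X H c B ℓ : ℕ → Ω → ℝ) (hXm : ∀ n, StronglyMeasurable[F n] (X n))
    (hHm : ∀ n, StronglyMeasurable[F n] (H n))
    (hcm : ∀ n, StronglyMeasurable[F n] (c n)) (hBm : ∀ n, StronglyMeasurable[F n] (B n))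
    (hX0 : ∀ n ω, 0 ≤ X n ω) (hH0 : ∀ n ω, 0 ≤ H n ω) (hHc : ∀ n ω, H n ω ≤ c n ω * X n ω)
    (hc0 : ∀ n ω, 0 ≤ c n ω) (hc1 : ∀ n ω, c n ω ≤ 1)
    (hB : ∀ n ω, B n ω ^ 2 ≤ 4 * (X n ω - H n ω) * c n ω)
    (hrec : ∀ n ω, X (n + 1) ω = (X n ω - H n ω) + B n ω * ε (n + 1) ω +
      c n ω * ε (n + 1) ω ^ 2)
    (hℓ : ∀ k, StronglyMeasurable[F k] (ℓ k)) (hℓ1 : ∀ k ω, 1 ≤ ℓ k ω)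
    (hℓm : ∀ k ω, ℓ k ω ≤ ℓ (k + 1) ω) (hℓ2 : ∀ k ω, ℓ (k + 1) ω ≤ 2 * ℓ k ω) :
    ∀ᵐ ω ∂μ, Tendsto (fun n => c n ω) atTop (𝓝 0) → Tendsto (fun n => ℓ n ω) atTop atTop →
      BO (fun n => c n ω) (fun n => ℓ n ω) → BO (fun k => c k ω * X k ω ^ n) (fun n => ℓ n ω) →
      (∃ C : ℝ, ∀ k, X k ω ^ (n + 1) ≤ C * ℓ k ω ^ (1 - η)) →
      Tendsto (fun N => (∑ k ∈ Finset.range N, (X k ω ^ (n + 1) - (X k ω - H k ω) ^ (n + 1)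
      - σ ^ 2 * ((n + 1) * (X k ω - H k ω) ^ n * c k ω
        + ((n + 1).choose 2 : ℕ) * (X k ω - H k ω) ^ (n - 1) * B k ω ^ 2))) / ℓ N ω)
        atTop (𝓝 0) := by
  have hp1 : (1:ℝ) ≤ p := by exact_mod_cast (by omega : 1 ≤ p)
  have hnp' : (n:ℝ) + 1 ≤ p := by exact_mod_cast hnp
  set r : ℝ := min 2 (a / (2 * p)) with hr
  have hr1 : 1 < r := lt_min (by norm_num) (by rw [lt_div_iff₀ (by linarith)]; linarith)
  have hr2 : r ≤ 2 := min_le_left _ _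
  have hr3 : 2 * p * r ≤ a := by
    have : r ≤ a / (2 * p) := min_le_right _ _
    rw [le_div_iff₀ (by linarith)] at this; linarith
  have hr0 : 0 < r := by linarith
  obtain ⟨K, hK0, hK⟩ := expand_main (n + 1) (by omega)
  let A : ℕ → Ω → ℝ := fun k ω => X k ω - H k ω
  have hA0 : ∀ k ω, 0 ≤ A k ω := fun k ω => by
    simp only [A]; nlinarith [hHc k ω, hc1 k ω, hX0 k ω]
  have hAX : ∀ k ω, A k ω ≤ X k ω := fun k ω => by simp only [A]; linarith [hH0 k ω]
  have hAm : ∀ k, StronglyMeasurable[F k] (A k) := fun k => sm_sub (hXm k) (hHm k)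
  let Z1 : ℕ → Ω → ℝ := fun n => ε (n + 1)
  let Z2 : ℕ → Ω → ℝ := fun n ω => ε (n + 1) ω ^ 2
  let Z3 : ℕ → Ω → ℝ := fun k ω => (1 + |ε (k + 1) ω|) ^ (2 * (n + 1))
  have hZ1m : ∀ k, StronglyMeasurable[F (k + 1)] (Z1 k) := fun k => hN.adapt (k + 1)
  have hZ2m : ∀ k, StronglyMeasurable[F (k + 1)] (Z2 k) := fun k => sm_pow (hN.adapt (k + 1)) 2
  have hZ3m : ∀ k, StronglyMeasurable[F (k + 1)] (Z3 k) := fun k =>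
    sm_pow (sm_add (sm_const 1) (sm_abs (hN.adapt (k + 1)))) _
  have hZ1b : ∀ k ω, |Z1 k ω| ≤ (1 + |ε (k + 1) ω|) ^ a := by
    intro k ω
    refine le_trans ?_ (one_add_rpow_mono (s := 1) (by linarith))
    rw [Real.rpow_one]; simp only [Z1]; linarith
  have hZ1br : ∀ k ω, |Z1 k ω| ^ (2:ℝ) ≤ (1 + |ε (k + 1) ω|) ^ a := by
    intro k ω
    refine le_trans ?_ (one_add_rpow_mono (s := 2) (by linarith))
    exact Real.rpow_le_rpow (abs_nonneg _) (by simp only [Z1]; linarith) (by norm_num)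
  have hpos1 : ∀ k ω, 0 ≤ 1 + |ε (k + 1) ω| := fun k ω => by positivity
  have hZ3r : ∀ k ω, |Z3 k ω| = (1 + |ε (k + 1) ω|) ^ (2 * ((n:ℝ) + 1)) := by
    intro k ω
    simp only [Z3]
    rw [abs_of_nonneg (pow_nonneg (hpos1 k ω) _), ← Real.rpow_natCast]
    push_cast; rfl
  have hZ3b : ∀ k ω, |Z3 k ω| ≤ (1 + |ε (k + 1) ω|) ^ a := by
    intro k ω
    rw [hZ3r]
    exact one_add_rpow_mono (by linarith)
  have hZ3br : ∀ k ω, |Z3 k ω| ^ r ≤ (1 + |ε (k + 1) ω|) ^ a := by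
    intro k ω
    rw [hZ3r, ← Real.rpow_mul (hpos1 k ω)]
    exact one_add_rpow_mono (by nlinarith)
  have hZ23 : ∀ k ω, |Z2 k ω| ≤ |Z3 k ω| := by
    intro k ω
    rw [hZ3r]
    refine le_trans ?_ (one_add_rpow_mono (s := 2) (by
      have : (0:ℝ) ≤ n := Nat.cast_nonneg n
      linarith))
    simp only [Z2]
    rw [abs_of_nonneg (by positivity), ← sq_abs, Real.rpow_two]
    have := abs_nonneg (ε (k + 1) ω)
    gcongr; linarith
  have hZ2b : ∀ k ω, |Z2 k ω| ≤ (1 + |ε (k + 1) ω|) ^ a := fun k ω => (hZ23 k ω).trans (hZ3b k ω)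
  have hZ2br : ∀ k ω, |Z2 k ω| ^ r ≤ (1 + |ε (k + 1) ω|) ^ a := fun k ω =>
    (Real.rpow_le_rpow (abs_nonneg _) (hZ23 k ω) hr0.le).trans (hZ3br k ω)
  let γ1 : ℕ → Ω → ℝ := fun k ω => ((n:ℝ) + 1) * A k ω ^ n * B k ω
  let γ2 : ℕ → Ω → ℝ := fun k ω => ((n:ℝ) + 1) * A k ω ^ n * c k ω
        + ((n + 1).choose 2 : ℕ) * A k ω ^ (n - 1) * B k ω ^ 2
  let γ3 : ℕ → Ω → ℝ := fun k ω => K * (c k ω * √(c k ω) * (1 + A k ω ^ n))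
  have hγ1 : ∀ k, StronglyMeasurable[F k] (γ1 k) := fun k =>
    sm_mul (sm_mul (sm_const _) (sm_pow (hAm k) n)) (hBm k)
  have hγ2 : ∀ k, StronglyMeasurable[F k] (γ2 k) := fun k =>
    sm_add (sm_mul (sm_mul (sm_const _) (sm_pow (hAm k) n)) (hcm k))
      (sm_mul (sm_mul (sm_const _) (sm_pow (hAm k) _)) (sm_pow (hBm k) 2))
  have hγ3 : ∀ k, StronglyMeasurable[F k] (γ3 k) := fun k =>
    sm_mul (sm_const _) (sm_mul (sm_mul (hcm k) (sm_sqrt (hcm k)))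
      (sm_add (sm_const 1) (sm_pow (hAm k) n)))
  have l1 := lln_o hN (r := 2) (by norm_num) le_rfl hη hη1 Z1 hZ1m hZ1b hZ1br γ1 ℓ hγ1 hℓ hℓ1 hℓm hℓ2
  have l2 := lln_o hN hr1 hr2 hη hη1 Z2 hZ2m hZ2b hZ2br γ2 ℓ hγ2 hℓ hℓ1 hℓm hℓ2
  have l3 := lln_o hN hr1 hr2 hη hη1 Z3 hZ3m hZ3b hZ3br γ3 ℓ hγ3 hℓ hℓ1 hℓm hℓ2
  filter_upwards [l1, l2, l3, ae_all_iff.2 hN.mds, ae_all_iff.2 hN.var, (cond_data hN Z3 hZ3m hZ3b).2]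
    with ω l1 l2 l3 hmds hvar ⟨D, hD0, hD⟩ hct hℓt hbc hbcX ⟨C, hC⟩
  have hlp : ∀ k, 0 < ℓ k ω := fun k => by linarith [hℓ1 k ω]
  have hlη : ∀ k, 1 ≤ ℓ k ω ^ (1 - η) := fun k => Real.one_le_rpow (hℓ1 k ω) (by linarith)
  have hC0 : 0 ≤ C := by
    by_contra h
    push Not at h
    have := hC 0
    have h2 : 0 ≤ X 0 ω ^ (n + 1) := pow_nonneg (hX0 _ _) _
    nlinarith [hlη 0]
  -- `1 + X^n` is controlled as well
  have hu : ∀ k, 1 + X k ω ^ n ≤ (2 + C) * ℓ k ω ^ (1 - η) := by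
    intro k
    have h1 := hC k
    have h2 := hlη k
    have hx := hX0 k ω
    have h3 : X k ω ^ n ≤ 1 + X k ω ^ (n + 1) := by
      rcases le_total (X k ω) 1 with h | h
      · have := pow_le_one₀ hx h (n := n)
        have := pow_nonneg hx (n + 1)
        linarith
      · have := pow_le_pow_right₀ h (by omega : n ≤ n + 1)
        linarith
    nlinarith
  let w : ℕ → ℝ := fun k => c k ω + c k ω * X k ω ^ n
  have hw0 : ∀ k, 0 ≤ w k := fun k => by
    have := hc0 k ω; have := hX0 k ω; simp only [w]; positivity
  have hw : BO w (fun n => ℓ n ω) := bo_add hbc hbcX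
  have hwu : ∀ k, w k ≤ 1 * (1 + X k ω ^ n) := fun k => by
    have h1 := hc1 k ω
    have h2 : 0 ≤ X k ω ^ n := pow_nonneg (hX0 _ _) _
    simp only [w]; nlinarith
  have hwr : ∀ k, w k ^ r ≤ (1 * (2 + C)) ^ (r - 1) * w k * ℓ k ω ^ ((1 - η) * (r - 1)) := fun k =>
    rpow_split hr1 hη1 (hw0 k) zero_le_one (by have := hX0 k ω; positivity) (hℓ1 k ω) (hu k) (hwu k)
      (by linarith)
  -- application of the three laws of large numbers
  have t1 := l1 hℓt ⟨w, 4 * ((n:ℝ) + 1) ^ 2 * C, hw0, hw, fun k => by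
    have hA := hA0 k ω
    have hX := hX0 k ω
    have hc := hc0 k ω
    have hl := hlp k
    have h1 : ((1 - η) * ((2:ℝ) - 1)) = 1 - η := by ring
    rw [h1, Real.rpow_two, sq_abs]
    simp only [γ1]
    have h2 : (A k ω ^ n) ^ 2 * B k ω ^ 2 ≤ 4 * (w k * (C * ℓ k ω ^ (1 - η))) := by
      have hB' : B k ω ^ 2 ≤ 4 * A k ω * c k ω := hB k ω
      calc (A k ω ^ n) ^ 2 * B k ω ^ 2 ≤ (A k ω ^ n) ^ 2 * (4 * A k ω * c k ω) := by gcongr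
        _ = 4 * (c k ω * A k ω ^ n * A k ω ^ (n + 1)) := by ring
        _ ≤ 4 * (c k ω * X k ω ^ n * X k ω ^ (n + 1)) := by gcongr <;> exact hAX k ω
        _ ≤ 4 * (w k * (C * ℓ k ω ^ (1 - η))) := by
          have hwk : c k ω * X k ω ^ n ≤ w k := by simp only [w]; linarith
          have := mul_le_mul hwk (hC k) (by positivity) (hw0 k)
          linarith
    have h3 := mul_le_mul_of_nonneg_left h2 (sq_nonneg ((n:ℝ) + 1))
    calc _ = ((n:ℝ) + 1) ^ 2 * ((A k ω ^ n) ^ 2 * B k ω ^ 2) := by ring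
      _ ≤ _ := h3
      _ = _ := by ring⟩
  have t2 := l2 hℓt ⟨w, ((n:ℝ) + 1 + 4 * ((n + 1).choose 2 : ℕ)) ^ r * (1 * (2 + C)) ^ (r - 1),
      hw0, hw, fun k => by
    obtain ⟨g0, g1⟩ := Gbound n (hA0 k ω) (hAX k ω) (hc0 k ω) (hB k ω)
    have hX := hX0 k ω
    have hc := hc0 k ω
    have h1 : |γ2 k ω| ≤ ((n:ℝ) + 1 + 4 * ((n + 1).choose 2 : ℕ)) * w k := by
      rw [abs_of_nonneg g0]
      refine g1.trans ?_
      gcongr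
      simp only [w]; linarith
    refine (Real.rpow_le_rpow (abs_nonneg _) h1 hr0.le).trans ?_
    rw [Real.mul_rpow (by positivity) (hw0 k)]
    have h2 := mul_le_mul_of_nonneg_left (hwr k)
      (by positivity : 0 ≤ ((n:ℝ) + 1 + 4 * ((n + 1).choose 2 : ℕ)) ^ r)
    refine h2.trans (le_of_eq (by ring))⟩
  have hγ3w : ∀ k, 0 ≤ γ3 k ω ∧ γ3 k ω ≤ K * √(c k ω) * w k := fun k => by
    have hA := hA0 k ω
    have hc := hc0 k ω
    refine ⟨by simp only [γ3]; positivity, ?_⟩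
    have h1 : A k ω ^ n ≤ X k ω ^ n := pow_le_pow_left₀ hA (hAX k ω) n
    calc γ3 k ω ≤ K * (c k ω * √(c k ω) * (1 + X k ω ^ n)) := by simp only [γ3]; gcongr
      _ = _ := by simp only [w]; ring
  have t3 := l3 hℓt ⟨w, K ^ r * (1 * (2 + C)) ^ (r - 1),
      hw0, hw, fun k => by
    have h1 : |γ3 k ω| ≤ K * w k := by
      rw [abs_of_nonneg (hγ3w k).1]
      refine (hγ3w k).2.trans ?_
      have h2 : √(c k ω) ≤ 1 := Real.sqrt_le_one.2 (hc1 k ω)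
      have h3 : 0 ≤ K * w k := mul_nonneg hK0 (hw0 k)
      nlinarith
    refine (Real.rpow_le_rpow (abs_nonneg _) h1 hr0.le).trans ?_
    rw [Real.mul_rpow hK0 (hw0 k)]
    have h2 := mul_le_mul_of_nonneg_left (hwr k) (by positivity : 0 ≤ K ^ r)
    refine h2.trans (le_of_eq (by ring))⟩
  have t4 : Tendsto (fun N => (∑ k ∈ range N, γ3 k ω * (μ[Z3 k|F k]) ω) / ℓ N ω) atTop (𝓝 0) := by
    have hδ : Tendsto (fun k => K * D * √(c k ω)) atTop (𝓝 0) := by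
      have h1 : Tendsto (fun k => √(c k ω)) atTop (𝓝 0) := by
        have := (Real.continuous_sqrt.tendsto 0).comp hct
        rw [Real.sqrt_zero] at this
        exact this
      simpa using h1.const_mul (K * D)
    refine ces hw0 hℓt hw hδ (Eventually.of_forall fun k => ?_)
    rw [abs_mul, abs_of_nonneg (hγ3w k).1]
    calc γ3 k ω * |(μ[Z3 k|F k]) ω| ≤ (K * √(c k ω) * w k) * D := by
          apply mul_le_mul (hγ3w k).2 (hD k) (abs_nonneg _)
          have := hw0 k; positivity
      _ = _ := by ring
  have t5 : Tendsto (fun N => (∑ k ∈ range N, γ3 k ω * Z3 k ω) / ℓ N ω) atTop (𝓝 0) := by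
    have := t3.add t4
    rw [add_zero] at this
    refine this.congr fun N => ?_
    rw [← add_div, ← Finset.sum_add_distrib]
    congr 1
    exact Finset.sum_congr rfl fun k _ => by ring
  let R : ℕ → ℝ := fun k => X (k + 1) ω ^ (n + 1) - A k ω ^ (n + 1) - (γ1 k ω * ε (k + 1) ω) -
    γ2 k ω * ε (k + 1) ω ^ 2
  have hR : ∀ k, |R k| ≤ γ3 k ω * Z3 k ω := by
    intro k
    have h1 := hK (A k ω) (B k ω) (c k ω) (ε (k + 1) ω) (hA0 k ω) (hc0 k ω) (hc1 k ω) (hB k ω)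
    have e : R k = (A k ω + B k ω * ε (k + 1) ω + c k ω * ε (k + 1) ω ^ 2) ^ (n + 1) -
      A k ω ^ (n + 1) - ((n + 1 : ℕ) : ℝ) * A k ω ^ (n + 1 - 1) * (B k ω * ε (k + 1) ω +
        c k ω * ε (k + 1) ω ^ 2) - ((n + 1).choose 2 : ℕ) * A k ω ^ (n + 1 - 2) * B k ω ^ 2 *
        ε (k + 1) ω ^ 2 := by
      have e1 : n + 1 - 1 = n := rfl
      have e2 : n + 1 - 2 = n - 1 := by omega
      rw [e1, e2]
      simp only [R, γ1, γ2]
      rw [hrec]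
      push_cast
      simp only [A]
      ring
    rw [e]
    exact h1
  have t6 : Tendsto (fun N => (∑ k ∈ range N, R k) / ℓ N ω) atTop (𝓝 0) := by
    refine squeeze_zero_norm (fun N => ?_) t5
    rw [norm_div, Real.norm_of_nonneg (hlp N).le]
    have h1 : ‖∑ k ∈ range N, R k‖ ≤ ∑ k ∈ range N, γ3 k ω * Z3 k ω :=
      (norm_sum_le _ _).trans (Finset.sum_le_sum fun k _ => hR k)
    have := hlp N
    gcongr
  have t7 : Tendsto (fun N => X N ω ^ (n + 1) / ℓ N ω) atTop (𝓝 0) := by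
    have h1 : Tendsto (fun N => C * ℓ N ω ^ (-η)) atTop (𝓝 0) := by
      simpa using ((tendsto_rpow_neg_atTop hη).comp hℓt).const_mul C
    refine squeeze_zero (fun N => ?_) (fun N => ?_) h1
    · have := hlp N; have := hX0 N ω; positivity
    · have h2 := hlp N
      rw [div_le_iff₀ h2, mul_assoc]
      refine (hC N).trans (le_of_eq ?_)
      congr 1
      have : ℓ N ω ^ (-η) * ℓ N ω = ℓ N ω ^ (-η) * ℓ N ω ^ (1:ℝ) := by rw [Real.rpow_one]
      rw [this, ← Real.rpow_add h2]; congr 1; ring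
  have t8 : Tendsto (fun N => X 0 ω ^ (n + 1) / ℓ N ω) atTop (𝓝 0) :=
    tendsto_const_nhds.div_atTop hℓt
  have := (((t8.sub t7).add t1).add t2).add t6
  simp only [sub_zero, add_zero] at this
  refine this.congr fun N => ?_
  have hsum : ∀ N, ∑ k ∈ range N, (X k ω ^ (n + 1) - (X k ω - H k ω) ^ (n + 1)
      - σ ^ 2 * ((n + 1) * (X k ω - H k ω) ^ n * c k ω
        + ((n + 1).choose 2 : ℕ) * (X k ω - H k ω) ^ (n - 1) * B k ω ^ 2)) =
      X 0 ω ^ (n + 1) - X N ω ^ (n + 1) + ∑ k ∈ range N, γ1 k ω * (Z1 k ω - (μ[Z1 k|F k]) ω) +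
       ∑ k ∈ range N, γ2 k ω * (Z2 k ω - (μ[Z2 k|F k]) ω) + ∑ k ∈ range N, R k := by
    intro N
    induction N with
    | zero => simp
    | succ N ih =>
      rw [Finset.sum_range_succ, ih, Finset.sum_range_succ _ N, Finset.sum_range_succ _ N,
        Finset.sum_range_succ _ N]
      have e1 : (μ[Z1 N|F N]) ω = 0 := hmds N
      have e2 : (μ[Z2 N|F N]) ω = σ ^ 2 := hvar N
      rw [e1, e2]
      simp only [R, γ1, γ2, Z1, Z2, A]
      ring
  rw [hsum N]
  ring

end
end partG

section partN
lemma relmul {x y x' y' s t : ℝ} (hy : 0 ≤ y) (hy' : 0 ≤ y')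
    (h : |x - y| ≤ s * y) (h' : |x' - y'| ≤ t * y') :
    |x * x' - y * y'| ≤ ((1 + s) * (1 + t) - 1) * (y * y') := by
  have e : x * x' - y * y' = (x - y) * (x' - y') + (x - y) * y' + y * (x' - y') := by ring
  rw [e]
  calc _ ≤ |x - y| * |x' - y'| + |x - y| * y' + y * |x' - y'| := by
        refine (abs_add_le _ _).trans (add_le_add ((abs_add_le _ _).trans ?_) ?_)
        · rw [abs_mul, abs_mul, abs_of_nonneg hy']
        · rw [abs_mul, abs_of_nonneg hy]
    _ ≤ (s * y) * (t * y') + (s * y) * y' + y * (t * y') := by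
        have := (abs_nonneg _).trans h
        gcongr
    _ = _ := by ring

lemma relpow {x y s : ℝ} (hy : 0 ≤ y) (h : |x - y| ≤ s * y) (n : ℕ) :
    |x ^ n - y ^ n| ≤ ((1 + s) ^ n - 1) * y ^ n := by
  induction n with
  | zero => simp
  | succ n ih =>
    have := relmul (pow_nonneg hy n) hy ih h
    rw [← pow_succ, ← pow_succ] at this
    convert this using 2
    ring

/-- coefficients -/
def bco (d : ℕ) (s2 : ℝ) (n : ℕ) : ℝ := s2 ^ (n + 1) * ∏ j ∈ Finset.Icc 1 n, ((d : ℝ) + 2 * (j : ℝ))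

def aco (d : ℕ) (s2 : ℝ) (n : ℕ) : ℝ := if n = 0 then 1 else d * bco d s2 (n - 1)

lemma bco_rec (d : ℕ) (s2 : ℝ) (n : ℕ) :
    bco d s2 n = s2 * (aco d s2 n + 2 * n * (if n = 0 then 0 else bco d s2 (n - 1))) := by
  cases n with
  | zero => simp [bco, aco]
  | succ n =>
    simp only [bco, aco, Nat.add_sub_cancel, Nat.succ_ne_zero, if_false]
    rw [Finset.prod_Icc_succ_top (by omega)]
    push_cast
    ring

lemma choose2 (n : ℕ) : (((n + 1).choose 2 : ℕ) : ℝ) = (n + 1) * n / 2 := by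
  rw [Nat.cast_choose_two]; push_cast; ring

lemma tend_one_add_pow {δ : ℕ → ℝ} (hδ : Tendsto δ atTop (𝓝 0)) (n : ℕ) :
    Tendsto (fun k => (1 + δ k) ^ n - 1) atTop (𝓝 0) := by
  have := ((hδ.const_add 1).pow n).sub_const 1
  simpa using this

set_option maxHeartbeats 1000000 in
theorem assembly (p d : ℕ) (hd : 0 < d) (s2 : ℝ) (V f h B m f' B' δ ℓ : ℕ → ℝ)
    (hV : ∀ k, 0 ≤ V k) (hh : ∀ k, 0 ≤ h k) (hhf : ∀ k, h k ≤ f k * V k) (hf0 : ∀ k, 0 ≤ f k)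
    (hf1 : ∀ k, f k ≤ 1) (hft : Tendsto f atTop (𝓝 0))
    (hBe : ∀ k, B k ^ 2 = 4 * (1 - f k) * h k) (hB : ∀ k, B k ^ 2 ≤ 4 * (V k - h k) * f k)
    (hm : ∀ k, 0 ≤ m k) (hf'0 : ∀ k, 0 ≤ f' k) (hf'1 : ∀ k, f' k ≤ 1)
    (hf't : Tendsto f' atTop (𝓝 0))
    (hB' : ∀ k, B' k ^ 2 ≤ 4 * ((1 - f' k) * m k) * f' k)
    (hδ : Tendsto δ atTop (𝓝 0))
    (hδf : ∀ k, |f k - d * f' k| ≤ δ k * (d * f' k))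
    (hδV : ∀ k, |V k - d * m k| ≤ δ k * (d * m k))
    (hδB : ∀ k, |B k ^ 2 - (d * B' k) ^ 2| ≤ δ k * (f' k * m k))
    (hl : Tendsto ℓ atTop atTop) (hl1 : ∀ k, 1 ≤ ℓ k)
    (hl0 : Tendsto (fun n => (∑ k ∈ range n, f k) / ℓ n) atTop (𝓝 1))
    (hmV : ∀ n, n < p → BO (fun k => f k * V k ^ n) ℓ → Tendsto (fun N => (∑ k ∈ Finset.range N,
      (V k ^ (n + 1) - (V k - h k) ^ (n + 1) - s2 * ((n + 1) * (V k - h k) ^ n * f k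
        + ((n + 1).choose 2 : ℕ) * (V k - h k) ^ (n - 1) * B k ^ 2))) / ℓ N) atTop (𝓝 0))
    (hmm : ∀ n, n < p → BO (fun k => f' k * m k ^ n) ℓ → Tendsto (fun N => (∑ k ∈ Finset.range N,
      (m k ^ (n + 1) - (m k - f' k * m k) ^ (n + 1) - s2 * ((n + 1) * (m k - f' k * m k) ^ n * f' k
        + ((n + 1).choose 2 : ℕ) * (m k - f' k * m k) ^ (n - 1) * B' k ^ 2))) / ℓ N) atTop (𝓝 0)) :
    ∀ n, n < p →
      Tendsto (fun N => (∑ k ∈ range N, f k * V k ^ n) / ℓ N) atTop (𝓝 (aco d s2 n)) ∧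
      Tendsto (fun N => (∑ k ∈ range N, h k * V k ^ n) / ℓ N) atTop (𝓝 (bco d s2 n)) := by
  have hd0 : (0:ℝ) < d := by exact_mod_cast hd
  have hW : ∀ k, 0 ≤ d * m k := fun k => mul_nonneg hd0.le (hm k)
  have hF : ∀ k, 0 ≤ d * f' k := fun k => mul_nonneg hd0.le (hf'0 k)
  -- relative comparison
  have rel : ∀ n k, |f k * V k ^ n - (d * f' k) * (d * m k) ^ n| ≤
      ((1 + δ k) ^ (n + 1) - 1) * ((d * f' k) * (d * m k) ^ n) := by
    intro n k
    have := relmul (hF k) (pow_nonneg (hW k) n) (hδf k) (relpow (hW k) (hδV k) n)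
    convert this using 2
    ring
  have scale : ∀ (x : ℕ → ℝ) (c A : ℝ), Tendsto (fun N => (∑ k ∈ range N, x k) / ℓ N) atTop (𝓝 A) →
      Tendsto (fun N => (∑ k ∈ range N, c * x k) / ℓ N) atTop (𝓝 (c * A)) := by
    intro x c A hx
    refine (hx.const_mul c).congr fun N => ?_
    rw [← Finset.mul_sum, mul_div_assoc]
  have key : ∀ n, n < p →
      Tendsto (fun N => (∑ k ∈ range N, f k * V k ^ n) / ℓ N) atTop (𝓝 (aco d s2 n)) →
      Tendsto (fun N => (∑ k ∈ range N, V k ^ (n - 1) * B k ^ 2) / ℓ N) atTop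
        (𝓝 (4 * (if n = 0 then 0 else bco d s2 (n - 1)))) ∨ n = 0 →
      Tendsto (fun N => (∑ k ∈ range N, h k * V k ^ n) / ℓ N) atTop (𝓝 (bco d s2 n)) ∧
      Tendsto (fun N => (∑ k ∈ range N, f k * V k ^ (n + 1)) / ℓ N) atTop
        (𝓝 (aco d s2 (n + 1))) := by
    intro n hn hA hBl
    have hbo := bo_of_tendsto hl1 hA
    have hmt : Tendsto (fun N => (∑ k ∈ range N, (d * f' k) * (d * m k) ^ n) / ℓ N) atTop
        (𝓝 (aco d s2 n)) :=
      ratB (fun k => mul_nonneg (hf0 k) (pow_nonneg (hV k) n))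
        (fun k => mul_nonneg (hF k) (pow_nonneg (hW k) n)) hl hl1 (tend_one_add_pow hδ (n + 1))
        (Eventually.of_forall (rel n)) hA
    have hmt' : Tendsto (fun N => (∑ k ∈ range N, f' k * m k ^ n) / ℓ N) atTop
        (𝓝 ((1 / d ^ (n + 1)) * aco d s2 n)) := by
      refine (scale _ (1 / d ^ (n + 1)) _ hmt).congr fun N => ?_
      congr 1
      refine Finset.sum_congr rfl fun k _ => ?_
      rw [mul_pow]; field_simp
      try ring
    have hbo' := bo_of_tendsto hl1 hmt'
    have hwm : ∀ k, 0 ≤ f' k * m k ^ n := fun k => mul_nonneg (hf'0 k) (pow_nonneg (hm k) n)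
    have hG : Tendsto (fun N => (∑ k ∈ range N, (((n:ℝ) + 1) * V k ^ n * f k +
        ((n + 1).choose 2 : ℕ) * V k ^ (n - 1) * B k ^ 2)) / ℓ N) atTop
        (𝓝 (((n:ℝ) + 1) * (aco d s2 n + 2 * n * (if n = 0 then 0 else bco d s2 (n - 1))))) := by
      have h1 := scale _ ((n:ℝ) + 1) _ hA
      rcases hBl with hBl | h0
      · have h2 := scale _ (((n + 1).choose 2 : ℕ) : ℝ) _ hBl
        have h3 := h1.add h2
        have e : ((n:ℝ) + 1) * aco d s2 n + (((n + 1).choose 2 : ℕ) : ℝ) *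
          (4 * (if n = 0 then 0 else bco d s2 (n - 1))) =
          (((n:ℝ) + 1) * (aco d s2 n + 2 * n * (if n = 0 then 0 else bco d s2 (n - 1)))) := by
          rw [choose2]; ring
        rw [e] at h3
        refine h3.congr fun N => ?_
        rw [← add_div, ← Finset.sum_add_distrib]
        congr 1
        exact Finset.sum_congr rfl fun k _ => by ring
      · subst h0
        simp only [if_true, mul_zero, add_zero]
        refine h1.congr fun N => ?_
        congr 1
        exact Finset.sum_congr rfl fun k _ => by simp
    have hG' : Tendsto (fun N => (∑ k ∈ range N, (((n:ℝ) + 1) * m k ^ n * f' k +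
        ((n + 1).choose 2 : ℕ) * m k ^ (n - 1) * B' k ^ 2)) / ℓ N) atTop
        (𝓝 ((1 / d ^ (n + 1)) * (((n:ℝ) + 1) * (aco d s2 n + 2 * n *
          (if n = 0 then 0 else bco d s2 (n - 1)))))) := by
      have h1 := scale _ ((n:ℝ) + 1) _ hmt'
      rcases hBl with hBl | h0
      · rcases Nat.eq_zero_or_pos n with hn0 | hn0
        · subst hn0
          simp only [if_true, mul_zero, add_zero]
          have e : (1 / (d:ℝ) ^ (0 + 1) * (((0:ℕ) + 1) * aco d s2 0)) =
            ((0:ℕ) + 1) * (1 / (d:ℝ) ^ (0 + 1) * aco d s2 0) := by ring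
          rw [e]
          refine h1.congr fun N => ?_
          congr 1
          exact Finset.sum_congr rfl fun k _ => by simp
        have hc : Tendsto (fun N => (∑ k ∈ range N, (d * m k) ^ (n - 1) * (d * B' k) ^ 2) / ℓ N)
            atTop (𝓝 (4 * (if n = 0 then 0 else bco d s2 (n - 1)))) := by
          have hδ2 : Tendsto (fun k => (((1 + δ k) ^ (n - 1) - 1) * (d:ℝ) ^ (n + 1) * 4 +
              (1 + δ k) ^ (n - 1) * d ^ (n - 1) * δ k)) atTop (𝓝 0) := by
            have a1 := ((tend_one_add_pow hδ (n - 1)).mul_const ((d:ℝ) ^ (n + 1))).mul_const 4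
            have a2 := (((hδ.const_add 1).pow (n - 1)).mul_const ((d:ℝ) ^ (n - 1))).mul hδ
            simpa using a1.add a2
          refine ratC hwm hl hbo' hδ2 (Eventually.of_forall fun k => ?_) hBl
          have r1 := relpow (hW k) (hδV k) (n - 1)
          have hs0 : 0 ≤ d * m k := hW k
          have hB1 : B' k ^ 2 ≤ 4 * (m k * f' k) := by
            have := hB' k
            nlinarith [mul_nonneg (mul_nonneg (hf'0 k) (hm k)) (hf'0 k)]
          have r2 : V k ^ (n - 1) ≤ (1 + δ k) ^ (n - 1) * (d * m k) ^ (n - 1) := by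
            have := (abs_le.1 r1).2; linarith
          have em : m k ^ n = m k ^ (n - 1) * m k := by rw [← pow_succ]; congr 1; omega
          have ed : (d:ℝ) ^ (n + 1) = d ^ (n - 1) * d ^ 2 := by rw [← pow_add]; congr 1; omega
          have e : (d * m k) ^ (n - 1) * (d * B' k) ^ 2 - V k ^ (n - 1) * B k ^ 2 =
            ((d * m k) ^ (n - 1) - V k ^ (n - 1)) * (d * B' k) ^ 2 +
              V k ^ (n - 1) * ((d * B' k) ^ 2 - B k ^ 2) := by ring
          rw [e]
          have b1 : |((d * m k) ^ (n - 1) - V k ^ (n - 1)) * (d * B' k) ^ 2| ≤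
              ((1 + δ k) ^ (n - 1) - 1) * (d:ℝ) ^ (n + 1) * 4 * (f' k * m k ^ n) := by
            rw [abs_mul, abs_sub_comm, abs_of_nonneg (sq_nonneg ((d:ℝ) * B' k))]
            calc _ ≤ (((1 + δ k) ^ (n - 1) - 1) * (d * m k) ^ (n - 1)) *
                  (d ^ 2 * (4 * (m k * f' k))) := by
                  rw [mul_pow (d:ℝ) (B' k) 2]
                  have := (abs_nonneg _).trans r1
                  gcongr
              _ = _ := by rw [em, ed, mul_pow]; ring
          have b2 : |V k ^ (n - 1) * ((d * B' k) ^ 2 - B k ^ 2)| ≤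
              (1 + δ k) ^ (n - 1) * d ^ (n - 1) * δ k * (f' k * m k ^ n) := by
            rw [abs_mul, abs_sub_comm, abs_of_nonneg (pow_nonneg (hV k) (n - 1))]
            calc _ ≤ ((1 + δ k) ^ (n - 1) * (d * m k) ^ (n - 1)) * (δ k * (f' k * m k)) := by
                  apply mul_le_mul r2 (hδB k) (abs_nonneg _)
                  exact (pow_nonneg (hV k) _).trans r2
              _ = _ := by rw [em, mul_pow]; ring
          calc _ ≤ _ := abs_add_le _ _
            _ ≤ _ := add_le_add b1 b2
            _ = _ := by ring
        have h2 := scale _ ((1 / d ^ (n + 1)) * (((n + 1).choose 2 : ℕ) : ℝ)) _ hc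
        have h3 := h1.add h2
        have e : ((n:ℝ) + 1) * (1 / d ^ (n + 1) * aco d s2 n) + (1 / d ^ (n + 1)) *
          (((n + 1).choose 2 : ℕ) : ℝ) * (4 * (if n = 0 then 0 else bco d s2 (n - 1))) =
          (1 / d ^ (n + 1)) * (((n:ℝ) + 1) * (aco d s2 n + 2 * n *
            (if n = 0 then 0 else bco d s2 (n - 1)))) := by
          rw [choose2]; ring
        rw [e] at h3
        refine h3.congr fun N => ?_
        rw [← add_div, ← Finset.sum_add_distrib]
        congr 1
        refine Finset.sum_congr rfl fun k _ => ?_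
        have ed : (d:ℝ) ^ (n + 1) = d ^ (n - 1) * d ^ 2 := by rw [← pow_add]; congr 1; omega
        rw [ed, mul_pow, mul_pow]
        field_simp
      · subst h0
        simp only [if_true, mul_zero, add_zero]
        have e : (1 / (d:ℝ) ^ (0 + 1) * (((0:ℕ) + 1) * aco d s2 0)) =
            ((0:ℕ) + 1) * (1 / (d:ℝ) ^ (0 + 1) * aco d s2 0) := by ring
        rw [e]
        refine h1.congr fun N => ?_
        congr 1
        exact Finset.sum_congr rfl fun k _ => by simp
    have p1 := det_post n hV hh hhf hf0 hf1 hft hB hl hl1 hbo (hmV n hn hbo) hG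
    have p2 := det_post n hm (fun k => mul_nonneg (hf'0 k) (hm k)) (fun k => le_rfl) hf'0 hf'1 hf't
      (fun k => by have := hB' k; linarith) hl hl1 hbo' (hmm n hn hbo') hG'
    have hn1 : (0:ℝ) < (n:ℝ) + 1 := by positivity
    have hrec := bco_rec d s2 n
    constructor
    · have := scale _ (1 / ((n:ℝ) + 1)) _ p1
      have e : 1 / ((n:ℝ) + 1) * (s2 * (((n:ℝ) + 1) * (aco d s2 n + 2 * n *
          (if n = 0 then 0 else bco d s2 (n - 1))))) = bco d s2 n := by
        rw [hrec]; field_simp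
      rw [e] at this
      refine this.congr fun N => ?_
      congr 1
      exact Finset.sum_congr rfl fun k _ => by field_simp
    · have := scale _ ((1 / ((n:ℝ) + 1)) * d ^ (n + 2)) _ p2
      have e : ((1 / ((n:ℝ) + 1)) * d ^ (n + 2)) * (s2 * ((1 / d ^ (n + 1)) * (((n:ℝ) + 1) *
          (aco d s2 n + 2 * n * (if n = 0 then 0 else bco d s2 (n - 1)))))) =
          aco d s2 (n + 1) := by
        have : aco d s2 (n + 1) = d * bco d s2 n := by simp [aco]
        rw [this, hrec, pow_succ (d:ℝ) (n + 1)]; field_simp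
      rw [e] at this
      refine ratA (x := fun k => (d * f' k) * (d * m k) ^ (n + 1))
        (fun k => mul_nonneg (hF k) (pow_nonneg (hW k) _)) hl hl1 (tend_one_add_pow hδ (n + 2))
        (Eventually.of_forall fun k => rel (n + 1) k) ?_
      refine this.congr fun N => ?_
      congr 1
      refine Finset.sum_congr rfl fun k _ => ?_
      rw [mul_pow]; field_simp
      try ring
  have hBl : ∀ n, Tendsto (fun N => (∑ k ∈ range N, h k * V k ^ n) / ℓ N) atTop
        (𝓝 (bco d s2 n)) → Tendsto (fun N => (∑ k ∈ range N, V k ^ n * B k ^ 2) / ℓ N) atTop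
        (𝓝 (4 * bco d s2 n)) := by
      intro n hn
      refine ratA (x := fun k => 4 * (h k * V k ^ n)) (δ := f) (fun k => by
        have := hh k; have := hV k; positivity) hl hl1 hft (Eventually.of_forall fun k => ?_)
        (scale _ 4 _ hn)
      rw [hBe]
      have h1 : V k ^ n * (4 * (1 - f k) * h k) - 4 * (h k * V k ^ n) =
        -(f k * (4 * (h k * V k ^ n))) := by ring
      rw [h1, abs_neg, abs_of_nonneg]
      have := hh k; have := hV k; have := hf0 k; positivity
  have fin : ∀ n, n < p →
      (Tendsto (fun N => (∑ k ∈ range N, f k * V k ^ n) / ℓ N) atTop (𝓝 (aco d s2 n))) ∧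
      (Tendsto (fun N => (∑ k ∈ range N, h k * V k ^ n) / ℓ N) atTop (𝓝 (bco d s2 n))) ∧
      (Tendsto (fun N => (∑ k ∈ range N, f k * V k ^ (n + 1)) / ℓ N) atTop
        (𝓝 (aco d s2 (n + 1)))) := by
    intro n
    induction n with
    | zero =>
      intro hn
      have h0 : Tendsto (fun N => (∑ k ∈ range N, f k * V k ^ 0) / ℓ N) atTop
          (𝓝 (aco d s2 0)) := by
        simpa [aco] using hl0
      exact ⟨h0, key 0 hn h0 (Or.inr rfl)⟩
    | succ n ih =>
      intro hn
      obtain ⟨i1, i2, i3⟩ := ih (by omega)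
      exact ⟨i3, key (n + 1) hn i3 (Or.inl (by simpa using hBl n i2))⟩
  exact fun n hn => ⟨(fin n hn).1, (fin n hn).2.1⟩
end partN

section partM
section mat
variable {d : ℕ}

lemma symq {N : Matrix (Fin d) (Fin d) ℝ} (hN : N.IsHermitian) (x y : Fin d → ℝ) :
    x ⬝ᵥ (N *ᵥ y) = y ⬝ᵥ (N *ᵥ x) := by
  have hT : Nᵀ = N := by simpa [Matrix.IsHermitian, conjTranspose_eq_transpose_of_trivial] using hN
  rw [dotProduct_mulVec, ← mulVec_transpose, hT, dotProduct_comm]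

lemma qnn {N : Matrix (Fin d) (Fin d) ℝ} (hN : N.PosSemidef) (x : Fin d → ℝ) :
    0 ≤ x ⬝ᵥ (N *ᵥ x) := by simpa using hN.dotProduct_mulVec_nonneg x

lemma csq {N : Matrix (Fin d) (Fin d) ℝ} (hN : N.PosSemidef) (x y : Fin d → ℝ) :
    (x ⬝ᵥ (N *ᵥ y)) ^ 2 ≤ (x ⬝ᵥ (N *ᵥ x)) * (y ⬝ᵥ (N *ᵥ y)) := by
  have h : ∀ t : ℝ, 0 ≤ (y ⬝ᵥ (N *ᵥ y)) * (t * t) + (2 * (x ⬝ᵥ (N *ᵥ y))) * t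
      + x ⬝ᵥ (N *ᵥ x) := by
    intro t
    have h1 := qnn hN (x + t • y)
    have e : (x + t • y) ⬝ᵥ (N *ᵥ (x + t • y)) = (y ⬝ᵥ (N *ᵥ y)) * (t * t) +
        (2 * (x ⬝ᵥ (N *ᵥ y))) * t + x ⬝ᵥ (N *ᵥ x) := by
      simp only [mulVec_add, mulVec_smul, add_dotProduct, dotProduct_add, smul_dotProduct,
        dotProduct_smul, smul_eq_mul]
      rw [symq hN.isHermitian y x]; ring
    rwa [e] at h1
  have := discrim_le_zero h
  unfold discrim at this
  nlinarith

lemma vmv (u x : Fin d → ℝ) : vecMulVec u u *ᵥ x = (u ⬝ᵥ x) • u := by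
  rw [vecMulVec_mulVec]; simp

lemma r1_pd {P : Matrix (Fin d) (Fin d) ℝ} (hP : P.PosDef) (u : Fin d → ℝ) :
    (P + vecMulVec u u).PosDef :=
  hP.add_posSemidef (by simpa using posSemidef_vecMulVec_self_star u)

lemma inv_mv {P : Matrix (Fin d) (Fin d) ℝ} (hP : P.PosDef) (x : Fin d → ℝ) :
    P⁻¹ *ᵥ (P *ᵥ x) = x := by
  rw [mulVec_mulVec, nonsing_inv_mul _ ((isUnit_iff_isUnit_det _).1 hP.isUnit), one_mulVec]

lemma mv_inv {P : Matrix (Fin d) (Fin d) ℝ} (hP : P.PosDef) (x : Fin d → ℝ) :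
    P *ᵥ (P⁻¹ *ᵥ x) = x := by
  rw [mulVec_mulVec, mul_nonsing_inv _ ((isUnit_iff_isUnit_det _).1 hP.isUnit), one_mulVec]

lemma r1_inv {P : Matrix (Fin d) (Fin d) ℝ} (hP : P.PosDef) (u x : Fin d → ℝ) :
    (P + vecMulVec u u)⁻¹ *ᵥ x = P⁻¹ *ᵥ x -
      ((1 + u ⬝ᵥ (P⁻¹ *ᵥ u))⁻¹ * (x ⬝ᵥ (P⁻¹ *ᵥ u))) • (P⁻¹ *ᵥ u) := by
  have hτ := qnn hP.inv.posSemidef u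
  have : x = (P + vecMulVec u u) *ᵥ (P⁻¹ *ᵥ x -
      ((1 + u ⬝ᵥ (P⁻¹ *ᵥ u))⁻¹ * (x ⬝ᵥ (P⁻¹ *ᵥ u))) • (P⁻¹ *ᵥ u)) := by
    rw [mulVec_sub, add_mulVec, mulVec_smul, add_mulVec, vmv, vmv, mv_inv hP, mv_inv hP,
      symq hP.inv.isHermitian u x]
    set τ := u ⬝ᵥ (P⁻¹ *ᵥ u)
    set g := x ⬝ᵥ (P⁻¹ *ᵥ u)
    ext i
    simp only [Pi.add_apply, Pi.sub_apply, Pi.smul_apply, smul_eq_mul]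
    field_simp
    ring
  conv_lhs => rw [this]
  rw [inv_mv (r1_pd hP u)]

lemma r1_det {P : Matrix (Fin d) (Fin d) ℝ} (hP : P.PosDef) (u : Fin d → ℝ) :
    (P + vecMulVec u u).det = P.det * (1 + u ⬝ᵥ (P⁻¹ *ᵥ u)) := by
  have := det_add_replicateCol_mul_replicateRow (ι := Unit)
    ((isUnit_iff_isUnit_det _).1 hP.isUnit) u u
  rw [vecMulVec_eq Unit, this]
  congr 1
  simp [Matrix.det_unique, Matrix.mul_apply, dotProduct, mulVec, Finset.sum_mul, Finset.mul_sum]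
  rw [Finset.sum_comm]
  refine Finset.sum_congr rfl fun i _ => Finset.sum_congr rfl fun j _ => by ring

/-- all facts about one step for `V` -/
lemma stepV {P : Matrix (Fin d) (Fin d) ℝ} (hP : P.PosDef) (u M : Fin d → ℝ) :
    let R := P + vecMulVec u u
    let f := u ⬝ᵥ (R⁻¹ *ᵥ u)
    let V := M ⬝ᵥ (P⁻¹ *ᵥ M)
    let g := M ⬝ᵥ (P⁻¹ *ᵥ u)
    0 ≤ f ∧ f < 1 ∧ 0 ≤ V ∧ (1 - f) * g ^ 2 ≤ f * V ∧ M ⬝ᵥ (R⁻¹ *ᵥ u) = (1 - f) * g ∧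
    P.det = R.det * (1 - f) ∧
    (∀ e : ℝ, (M + e • u) ⬝ᵥ (R⁻¹ *ᵥ (M + e • u)) =
      (V - (1 - f) * g ^ 2) + (2 * ((1 - f) * g)) * e + f * e ^ 2) := by
  intro R f V g
  have hR := r1_pd hP u
  have hτ := qnn hP.inv.posSemidef u
  have hV := qnn hP.inv.posSemidef M
  have hcs := csq hP.inv.posSemidef M u
  have h1 : (R⁻¹ *ᵥ u) = (1 + u ⬝ᵥ (P⁻¹ *ᵥ u))⁻¹ • (P⁻¹ *ᵥ u) := by
    rw [r1_inv hP u u]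
    ext i
    simp only [Pi.sub_apply, Pi.smul_apply, smul_eq_mul]
    field_simp
    ring
  have h2 : R⁻¹ *ᵥ M = P⁻¹ *ᵥ M - ((1 + u ⬝ᵥ (P⁻¹ *ᵥ u))⁻¹ * g) • (P⁻¹ *ᵥ u) := r1_inv hP u M
  have hdet := r1_det hP u
  have hf : f = (1 + u ⬝ᵥ (P⁻¹ *ᵥ u))⁻¹ * (u ⬝ᵥ (P⁻¹ *ᵥ u)) := by
    simp only [f]; rw [h1, dotProduct_smul, smul_eq_mul]
  have hMu : M ⬝ᵥ (R⁻¹ *ᵥ u) = (1 + u ⬝ᵥ (P⁻¹ *ᵥ u))⁻¹ * g := by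
    rw [h1, dotProduct_smul, smul_eq_mul]
  have hMM : M ⬝ᵥ (R⁻¹ *ᵥ M) = V - (1 + u ⬝ᵥ (P⁻¹ *ᵥ u))⁻¹ * g * g := by
    rw [h2, dotProduct_sub, dotProduct_smul, smul_eq_mul]
  change g ^ 2 ≤ V * _ at hcs
  change 0 ≤ V at hV
  set τ := u ⬝ᵥ (P⁻¹ *ᵥ u)
  have h1f : 1 - f = (1 + τ)⁻¹ := by rw [hf]; field_simp; ring
  have hpos : 0 < (1 + τ)⁻¹ := by positivity
  refine ⟨by rw [hf]; positivity, by linarith, hV, ?_, ?_, ?_, ?_⟩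
  · rw [h1f, hf]; nlinarith
  · rw [hMu, h1f]
  · rw [hdet, h1f]; field_simp
  · intro e
    have : (M + e • u) ⬝ᵥ (R⁻¹ *ᵥ (M + e • u)) = M ⬝ᵥ (R⁻¹ *ᵥ M) + 2 * e * (M ⬝ᵥ (R⁻¹ *ᵥ u)) +
      f * e ^ 2 := by
      simp only [mulVec_add, mulVec_smul, add_dotProduct, dotProduct_add, smul_dotProduct,
        dotProduct_smul, smul_eq_mul]
      rw [symq hR.inv.isHermitian u M]; simp only [f]; ring
    rw [this, hMM, hMu, h1f]; ring

/-- one step for `m` -/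
lemma stepm {K : Matrix (Fin d) (Fin d) ℝ} (hK : K.PosDef) (u M : Fin d → ℝ) {b : ℝ} (hb : 0 < b) :
    let φ := u ⬝ᵥ (K *ᵥ u)
    let f := φ / (b + φ)
    let m := b⁻¹ * (M ⬝ᵥ (K *ᵥ M))
    let B := 2 * (M ⬝ᵥ (K *ᵥ u)) / (b + φ)
    0 ≤ φ ∧ 0 ≤ f ∧ f ≤ 1 ∧ 0 ≤ m ∧ B ^ 2 ≤ 4 * ((1 - f) * m) * f ∧
    (∀ e : ℝ, (b + φ)⁻¹ * ((M + e • u) ⬝ᵥ (K *ᵥ (M + e • u))) =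
      (1 - f) * m + B * e + f * e ^ 2) := by
  intro φ f m B
  have hφ : 0 ≤ φ := qnn hK.posSemidef u
  have hM := qnn hK.posSemidef M
  have hcs : _ ≤ _ * φ := csq hK.posSemidef M u
  have hbp : 0 < b + φ := by linarith
  have h1f : 1 - f = b / (b + φ) := by simp only [f]; field_simp; ring
  refine ⟨hφ, by positivity, by simp only [f]; rw [div_le_one hbp]; linarith, by positivity, ?_, ?_⟩
  · rw [h1f]; simp only [B, m, f]
    have e : 4 * (b / (b + φ) * (b⁻¹ * (M ⬝ᵥ (K *ᵥ M)))) * (φ / (b + φ)) =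
      4 * ((M ⬝ᵥ (K *ᵥ M)) * φ) / (b + φ) ^ 2 := by field_simp
    rw [e, div_pow]
    gcongr
    nlinarith
  · intro e
    have : (M + e • u) ⬝ᵥ (K *ᵥ (M + e • u)) = M ⬝ᵥ (K *ᵥ M) + 2 * e * (M ⬝ᵥ (K *ᵥ u)) +
      φ * e ^ 2 := by
      simp only [mulVec_add, mulVec_smul, add_dotProduct, dotProduct_add, smul_dotProduct,
        dotProduct_smul, smul_eq_mul]
      rw [symq hK.isHermitian u M]; simp only [φ]; ring
    rw [this, h1f]; simp only [B, m, f]; field_simp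

lemma bil_bound {L : Matrix (Fin d) (Fin d) ℝ} (hL : L.PosDef) (D : Matrix (Fin d) (Fin d) ℝ)
    (x y : Fin d → ℝ) :
    |x ⬝ᵥ (D *ᵥ y)| ≤ (L.trace * ∑ i, ∑ j, |D i j|) *
      (√(x ⬝ᵥ (L⁻¹ *ᵥ x)) * √(y ⬝ᵥ (L⁻¹ *ᵥ y))) := by
  have hc : ∀ (x : Fin d → ℝ) i, |x i| ≤ √L.trace * √(x ⬝ᵥ (L⁻¹ *ᵥ x)) := by
    intro x i
    have h1 := csq hL.inv.posSemidef x (L *ᵥ Pi.single i 1)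
    rw [inv_mv hL] at h1
    have e1 : x ⬝ᵥ Pi.single i 1 = x i := by simp
    have e2 : (L *ᵥ Pi.single i 1) ⬝ᵥ Pi.single i (1:ℝ) = L i i := by simp
    rw [e1, e2] at h1
    have h2 : L i i ≤ L.trace := by
      rw [Matrix.trace]
      exact Finset.single_le_sum (f := fun i => L.diag i)
        (fun j _ => hL.posSemidef.diag_nonneg) (Finset.mem_univ i)
    have h3 := qnn hL.inv.posSemidef x
    rw [← Real.sqrt_mul (hL.posSemidef.trace_nonneg)]
    apply Real.abs_le_sqrt
    nlinarith
  have ht : √L.trace * √L.trace = L.trace := Real.mul_self_sqrt hL.posSemidef.trace_nonneg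
  calc |x ⬝ᵥ (D *ᵥ y)| ≤ ∑ i, ∑ j, |x i| * (|D i j| * |y j|) := by
        simp only [dotProduct, mulVec, Finset.mul_sum]
        refine (Finset.abs_sum_le_sum_abs _ _).trans (Finset.sum_le_sum fun i _ => ?_)
        refine (Finset.abs_sum_le_sum_abs _ _).trans (Finset.sum_le_sum fun j _ => ?_)
        rw [abs_mul, abs_mul]
    _ ≤ ∑ i, ∑ j, (√L.trace * √(x ⬝ᵥ (L⁻¹ *ᵥ x))) * (|D i j| * (√L.trace * √(y ⬝ᵥ (L⁻¹ *ᵥ y)))) := by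
        refine Finset.sum_le_sum fun i _ => Finset.sum_le_sum fun j _ => ?_
        have := hc x i
        have := hc y j
        gcongr
    _ = _ := by
        simp only [Finset.mul_sum, Finset.sum_mul]
        refine Finset.sum_congr rfl fun i _ => Finset.sum_congr rfl fun j _ => ?_
        generalize √L.trace = t at ht
        rw [← ht]; ring

lemma tr_vmv (K : Matrix (Fin d) (Fin d) ℝ) (u : Fin d → ℝ) :
    (K * vecMulVec u u).trace = u ⬝ᵥ (K *ᵥ u) := by
  rw [mul_vecMulVec, trace_vecMulVec, dotProduct_comm]

lemma tr_half {L Lh : Matrix (Fin d) (Fin d) ℝ} (hLh : Lh * Lh = L) (P : Matrix (Fin d) (Fin d) ℝ) :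
    (Lh⁻¹ * P * Lh⁻¹).trace = (L⁻¹ * P).trace := by
  rw [Matrix.trace_mul_comm, ← Matrix.mul_assoc, ← hLh, Matrix.mul_inv_rev]

lemma tr_pos {L Lh P : Matrix (Fin d) (Fin d) ℝ} (hd : 0 < d) (h : Lh.PosDef) (hP : P.PosDef)
    (hLh : Lh * Lh = L) : 0 < (L⁻¹ * P).trace := by
  rw [← tr_half hLh]
  have : Nonempty (Fin d) := ⟨⟨0, hd⟩⟩
  have h1 := h.inv
  have h2 : (Lh⁻¹ * P * Lh⁻¹ᴴ).PosDef := by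
    apply hP.mul_mul_conjTranspose_same
    exact Matrix.vecMul_injective_of_isUnit h1.isUnit
  rw [h1.isHermitian.eq] at h2
  exact h2.trace_pos

/-- asymptotics -/
lemma asym {L : Matrix (Fin d) (Fin d) ℝ} (hd : 0 < d) (hL : L.PosDef)
    (P : ℕ → Matrix (Fin d) (Fin d) ℝ)
    (hP : ∀ n, (P n).PosDef) (α : ℕ → ℝ) (hα : ∀ n, 0 < α n) (hαt : Tendsto α atTop atTop)
    (hc : Tendsto (fun n => (α n)⁻¹ • P (n + 1)) atTop (𝓝 L)) :
    Tendsto (fun n => L.trace * ∑ i, ∑ j, |((L⁻¹ * P n).trace • (P n)⁻¹ - (d:ℝ) • L⁻¹) i j|) atTop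
      (𝓝 0) ∧ Tendsto (fun n => (P n).det) atTop atTop := by
  have hLd : L.det ≠ 0 := hL.det_pos.ne'
  have hdet : Tendsto (fun n => ((α n)⁻¹ • P (n + 1)).det) atTop (𝓝 L.det) :=
    ((continuous_id.matrix_det).tendsto L).comp hc
  have htr : Tendsto (fun n => (L⁻¹ * ((α n)⁻¹ • P (n + 1))).trace) atTop (𝓝 d) := by
    have : Continuous fun X : Matrix (Fin d) (Fin d) ℝ => (L⁻¹ * X).trace := by fun_prop
    have h := (this.tendsto L).comp hc
    rw [nonsing_inv_mul _ hLd.isUnit, Matrix.trace_one, Fintype.card_fin] at h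
    exact h
  have hinv : Tendsto (fun n => ((α n)⁻¹ • P (n + 1))⁻¹) atTop (𝓝 L⁻¹) := by
    have : ContinuousAt (fun X : Matrix (Fin d) (Fin d) ℝ => X⁻¹) L := by
      apply continuousAt_matrix_inv
      simp only [Ring.inverse_eq_inv']
      exact continuousAt_inv₀ hLd
    exact this.tendsto.comp hc
  constructor
  · rw [← tendsto_add_atTop_iff_nat 1]
    have h1 : Tendsto (fun n => (L⁻¹ * P (n + 1)).trace • (P (n + 1))⁻¹ - (d:ℝ) • L⁻¹) atTop
        (𝓝 0) := by
      have h2 := (htr.smul hinv).sub_const ((d:ℝ) • L⁻¹)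
      rw [sub_self] at h2
      refine h2.congr fun n => ?_
      congr 1
      have hu : IsUnit (P (n + 1)).det := (hP (n + 1)).det_pos.ne'.isUnit
      have := Matrix.inv_smul' (A := P (n + 1)) (Units.mk0 ((α n)⁻¹) (inv_ne_zero (hα n).ne')) hu
      have e : ((α n)⁻¹ • P (n + 1))⁻¹ = α n • (P (n + 1))⁻¹ := by
        simpa [Units.smul_def] using this
      rw [e, Matrix.mul_smul, Matrix.trace_smul, smul_smul, smul_eq_mul]
      congr 1
      have := (hα n).ne'
      field_simp
    have h3 : Continuous fun X : Matrix (Fin d) (Fin d) ℝ => L.trace * ∑ i, ∑ j, |X i j| := by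
      fun_prop
    have := (h3.tendsto 0).comp h1
    have e : L.trace * ∑ i, ∑ j, |(0 : Matrix (Fin d) (Fin d) ℝ) i j| = 0 := by simp
    rw [e] at this
    exact this
  · rw [← tendsto_add_atTop_iff_nat 1]
    have h1 : Tendsto (fun n => α n ^ d) atTop atTop :=
      (tendsto_pow_atTop hd.ne').comp hαt
    refine (h1.atTop_mul_pos hL.det_pos hdet).congr fun n => ?_
    rw [Matrix.det_smul, Fintype.card_fin]
    have := (hα n).ne'
    rw [← mul_assoc, ← mul_pow, mul_inv_cancel₀ this, one_pow, one_mul]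

end mat
end partM

section partQ
/-- distance to the limit -/
def dl {d : ℕ} (L P : Matrix (Fin d) (Fin d) ℝ) : ℝ :=
  L.trace * ∑ i, ∑ j, |((L⁻¹ * P).trace • P⁻¹ - (d:ℝ) • L⁻¹) i j|

lemma dl_nn {d : ℕ} {L P : Matrix (Fin d) (Fin d) ℝ} (hL : L.PosDef) : 0 ≤ dl L P :=
  mul_nonneg hL.posSemidef.trace_nonneg
    (Finset.sum_nonneg fun _ _ => Finset.sum_nonneg fun _ _ => abs_nonneg _)

lemma cmp1 {d : ℕ} {L P : Matrix (Fin d) (Fin d) ℝ} (hL : L.PosDef) {b : ℝ}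
    (hb : 0 < b) (hbe : (L⁻¹ * P).trace = b) (x y : Fin d → ℝ) :
    |x ⬝ᵥ (P⁻¹ *ᵥ y) - d * ((x ⬝ᵥ (L⁻¹ *ᵥ y)) / b)| ≤
      dl L P * (√(x ⬝ᵥ (L⁻¹ *ᵥ x)) * √(y ⬝ᵥ (L⁻¹ *ᵥ y)) / b) := by
  have h := bil_bound hL ((L⁻¹ * P).trace • P⁻¹ - (d:ℝ) • L⁻¹) x y
  change _ ≤ dl L P * _ at h
  rw [sub_mulVec, dotProduct_sub, smul_mulVec, smul_mulVec, dotProduct_smul, dotProduct_smul,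
    smul_eq_mul, smul_eq_mul, hbe] at h
  have e : x ⬝ᵥ (P⁻¹ *ᵥ y) - d * ((x ⬝ᵥ (L⁻¹ *ᵥ y)) / b) =
    (b * (x ⬝ᵥ (P⁻¹ *ᵥ y)) - d * (x ⬝ᵥ (L⁻¹ *ᵥ y))) / b := by field_simp
  rw [e, abs_div, abs_of_pos hb, ← mul_div_assoc]
  gcongr

lemma cmpx {d : ℕ} {L P : Matrix (Fin d) (Fin d) ℝ} (hL : L.PosDef) (u M : Fin d → ℝ) {b : ℝ}
    (hb : 0 < b) (hbe : (L⁻¹ * P).trace = b) :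
    let R := P + vecMulVec u u
    let φ := u ⬝ᵥ (L⁻¹ *ᵥ u)
    let f' := φ / (b + φ)
    let m := b⁻¹ * (M ⬝ᵥ (L⁻¹ *ᵥ M))
    let B' := 2 * (M ⬝ᵥ (L⁻¹ *ᵥ u)) / (b + φ)
    |u ⬝ᵥ (R⁻¹ *ᵥ u) - d * f'| ≤ dl L R * f' ∧
    |M ⬝ᵥ (P⁻¹ *ᵥ M) - d * m| ≤ dl L P * m ∧
    |(2 * (M ⬝ᵥ (R⁻¹ *ᵥ u))) ^ 2 - (d * B') ^ 2| ≤
      (4 * dl L R ^ 2 + 8 * d * dl L R) * (f' * m) := by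
  intro R φ f' m B'
  have hφ : 0 ≤ φ := qnn hL.inv.posSemidef u
  have hM := qnn hL.inv.posSemidef M
  have hbp : 0 < b + φ := by linarith
  have hRe : (L⁻¹ * R).trace = b + φ := by
    simp only [R]; rw [Matrix.mul_add, Matrix.trace_add, tr_vmv, hbe]
  refine ⟨?_, ?_, ?_⟩
  · have := cmp1 hL hbp hRe u u
    rw [Real.mul_self_sqrt hφ] at this
    exact this
  · have := cmp1 hL hb hbe M M
    rw [Real.mul_self_sqrt hM] at this
    simp only [m]
    rw [inv_mul_eq_div]
    exact this
  · have h1 := cmp1 hL hbp hRe M u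
    set s := √(M ⬝ᵥ (L⁻¹ *ᵥ M)) * √(u ⬝ᵥ (L⁻¹ *ᵥ u)) / (b + φ) with hs
    have hs0 : 0 ≤ s := by positivity
    have hs2 : s ^ 2 ≤ f' * m := by
      rw [hs, div_pow, mul_pow, Real.sq_sqrt hM, Real.sq_sqrt hφ]
      have e : f' * m = (M ⬝ᵥ (L⁻¹ *ᵥ M)) * φ / ((b + φ) * b) := by
        simp only [f', m]; field_simp
      rw [e]
      change _ * φ / _ ≤ _
      gcongr
      nlinarith
    have hB' : |B'| ≤ 2 * s := by
      simp only [B']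
      rw [abs_div, abs_of_pos hbp, abs_mul, hs, ← mul_div_assoc, abs_of_pos (by norm_num : (0:ℝ) < 2)]
      gcongr
      rw [← Real.sqrt_mul hM]
      exact Real.abs_le_sqrt (csq hL.inv.posSemidef M u)
    have hδ : 0 ≤ dl L R := dl_nn hL
    set δ := dl L R
    have h2 : |2 * (M ⬝ᵥ (R⁻¹ *ᵥ u)) - d * B'| ≤ 2 * δ * s := by
      have e : 2 * (M ⬝ᵥ (R⁻¹ *ᵥ u)) - d * B' =
        2 * (M ⬝ᵥ (R⁻¹ *ᵥ u) - d * ((M ⬝ᵥ (L⁻¹ *ᵥ u)) / (b + φ))) := by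
        simp only [B']; ring
      rw [e, abs_mul, abs_of_pos (by norm_num : (0:ℝ) < 2)]
      linarith
    set B := 2 * (M ⬝ᵥ (R⁻¹ *ᵥ u))
    have h3 : |B + d * B'| ≤ 2 * δ * s + 4 * d * s := by
      have e : B + d * B' = (B - d * B') + 2 * (d * B') := by ring
      rw [e]
      refine (abs_add_le _ _).trans ?_
      have : |2 * (d * B')| ≤ 4 * d * s := by
        rw [abs_mul, abs_mul, abs_of_pos (by norm_num : (0:ℝ) < 2), Nat.abs_cast]
        have : (d:ℝ) * |B'| ≤ d * (2 * s) := by gcongr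
        linarith
      linarith
    have e : B ^ 2 - (d * B') ^ 2 = (B - d * B') * (B + d * B') := by ring
    rw [e, abs_mul]
    calc _ ≤ (2 * δ * s) * (2 * δ * s + 4 * d * s) := by gcongr
      _ = (4 * δ ^ 2 + 8 * d * δ) * s ^ 2 := by ring
      _ ≤ _ := by gcongr

lemma logdet {f D : ℕ → ℝ} (hf0 : ∀ k, 0 ≤ f k) (hf1 : ∀ k, f k < 1)
    (hft : Tendsto f atTop (𝓝 0)) (hD : ∀ k, 0 < D k) (hrec : ∀ k, D k = D (k + 1) * (1 - f k))
    (hDt : Tendsto D atTop atTop) {ℓ : ℕ → ℝ} (hℓ : ∀ n, ℓ n = 1 + ∑ k ∈ range n, f k) :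
    Tendsto ℓ atTop atTop ∧ Tendsto (fun n => (∑ k ∈ range n, f k) / ℓ n) atTop (𝓝 1) ∧
    Tendsto (fun n => Real.log (D n) / ℓ n) atTop (𝓝 1) := by
  have hl1 : ∀ n, 1 ≤ ℓ n := fun n => by
    rw [hℓ]; linarith [Finset.sum_nonneg fun k (_ : k ∈ range n) => hf0 k]
  have hlog : ∀ n, Real.log (D n) = Real.log (D 0) + ∑ k ∈ range n, -Real.log (1 - f k) := by
    intro n
    induction n with
    | zero => simp
    | succ n ih =>
      rw [Finset.sum_range_succ, ← add_assoc, ← ih, hrec n,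
        Real.log_mul (hD _).ne' (by linarith [hf1 n])]
      ring
  have hb : ∀ k, |-Real.log (1 - f k) - f k| ≤ (f k / (1 - f k)) * f k := by
    intro k
    have h1 : 0 < 1 - f k := by linarith [hf1 k]
    have h2 := Real.log_le_sub_one_of_pos h1
    have h3 := Real.one_sub_inv_le_log_of_pos h1
    rw [abs_of_nonneg (by linarith)]
    have e : (f k / (1 - f k)) * f k = (1 - f k)⁻¹ - 1 - f k := by field_simp; ring
    rw [e]; linarith
  have hδ : Tendsto (fun k => f k / (1 - f k)) atTop (𝓝 0) := by
    have := hft.div (hft.const_sub 1) (by norm_num)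
    rw [zero_div] at this
    exact this
  have hBO : BO f ℓ := ⟨1, fun n => by rw [hℓ]; linarith⟩
  have hlt : Tendsto ℓ atTop atTop := by
    obtain ⟨C, hC⟩ : BO (fun k => -Real.log (1 - f k)) ℓ := by
      refine bo_mono hf0 hl1 hBO 2 ?_
      filter_upwards [hδ.eventually (gt_mem_nhds (show (0:ℝ) < 1 by norm_num))] with k hk
      have := (abs_le.1 (hb k)).2
      nlinarith [hf0 k]
    have h1 : Tendsto (fun n => Real.log (D n) + -Real.log (D 0)) atTop atTop :=
      tendsto_atTop_add_const_right _ _ (Real.tendsto_log_atTop.comp hDt)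
    have h2 : Tendsto (fun n => (|C| + 1) * ℓ n) atTop atTop := by
      refine tendsto_atTop_mono (fun n => ?_) h1
      have := hC n
      rw [hlog n]
      nlinarith [le_abs_self C, hl1 n]
    exact (tendsto_const_mul_atTop_of_pos (by positivity)).1 h2
  have hs : Tendsto (fun n => (∑ k ∈ range n, f k) / ℓ n) atTop (𝓝 1) := by
    have h1 : Tendsto (fun n => 1 - 1 / ℓ n) atTop (𝓝 1) := by
      have := (hlt.const_div_atTop 1).const_sub 1
      simpa using this
    refine h1.congr fun n => ?_
    have h0 : ℓ n ≠ 0 := by linarith [hl1 n]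
    have : ∑ k ∈ range n, f k = ℓ n - 1 := by rw [hℓ]; ring
    rw [this]; field_simp
  refine ⟨hlt, hs, ?_⟩
  have h1 := ratA (y := fun k => -Real.log (1 - f k)) hf0 hlt hl1 hδ (Eventually.of_forall hb) hs
  have h2 := (hlt.const_div_atTop (Real.log (D 0))).add h1
  rw [zero_add] at h2
  refine h2.congr fun n => ?_
  rw [hlog n, add_div]
end partQ

section partY
theorem core {Ω : Type*} {m0 : MeasurableSpace Ω} {μ : Measure Ω} [IsProbabilityMeasure μ]
    {F : Filtration ℕ m0} {ε : ℕ → Ω → ℝ} {σ a : ℝ} (hN : Noise μ F ε σ a) {p d : ℕ} (hp : 1 ≤ p)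
    (ha : 2 * p < a) (hd : 0 < d) (V f h B m f' B' δ ℓ : ℕ → Ω → ℝ)
    (hVm : ∀ n, StronglyMeasurable[F n] (V n)) (hfm : ∀ n, StronglyMeasurable[F n] (f n))
    (hhm : ∀ n, StronglyMeasurable[F n] (h n)) (hBm : ∀ n, StronglyMeasurable[F n] (B n))
    (hmm : ∀ n, StronglyMeasurable[F n] (m n)) (hf'm : ∀ n, StronglyMeasurable[F n] (f' n))
    (hB'm : ∀ n, StronglyMeasurable[F n] (B' n))
    (hV : ∀ k ω, 0 ≤ V k ω) (hh : ∀ k ω, 0 ≤ h k ω) (hhf : ∀ k ω, h k ω ≤ f k ω * V k ω)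
    (hf0 : ∀ k ω, 0 ≤ f k ω) (hf1 : ∀ k ω, f k ω ≤ 1)
    (hBe : ∀ k ω, B k ω ^ 2 = 4 * (1 - f k ω) * h k ω)
    (hVr : ∀ n ω, V (n + 1) ω = (V n ω - h n ω) + B n ω * ε (n + 1) ω + f n ω * ε (n + 1) ω ^ 2)
    (hm : ∀ k ω, 0 ≤ m k ω) (hf'0 : ∀ k ω, 0 ≤ f' k ω) (hf'1 : ∀ k ω, f' k ω ≤ 1)
    (hB' : ∀ k ω, B' k ω ^ 2 ≤ 4 * ((1 - f' k ω) * m k ω) * f' k ω)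
    (hmr : ∀ n ω, m (n + 1) ω = (1 - f' n ω) * m n ω + B' n ω * ε (n + 1) ω
      + f' n ω * ε (n + 1) ω ^ 2)
    (hδf : ∀ k ω, |f k ω - d * f' k ω| ≤ δ k ω * (d * f' k ω))
    (hδV : ∀ k ω, |V k ω - d * m k ω| ≤ δ k ω * (d * m k ω))
    (hδB : ∀ k ω, |B k ω ^ 2 - (d * B' k ω) ^ 2| ≤ δ k ω * (f' k ω * m k ω))
    (hℓ : ∀ n ω, ℓ n ω = 1 + ∑ k ∈ range n, f k ω)
    (hft : ∀ᵐ ω ∂μ, Tendsto (fun n => f n ω) atTop (𝓝 0))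
    (hδ : ∀ᵐ ω ∂μ, Tendsto (fun n => δ n ω) atTop (𝓝 0))
    (hlt : ∀ᵐ ω ∂μ, Tendsto (fun n => ℓ n ω) atTop atTop)
    (hl0 : ∀ᵐ ω ∂μ, Tendsto (fun n => (∑ k ∈ range n, f k ω) / ℓ n ω) atTop (𝓝 1)) :
    ∀ᵐ ω ∂μ, Tendsto (fun N => (∑ k ∈ range N, h k ω * m k ω ^ (p - 1)) / ℓ N ω) atTop
      (𝓝 (1 / (d:ℝ) ^ (p - 1) * bco d (σ ^ 2) (p - 1))) := by
  have hd1 : (1:ℝ) ≤ d := by exact_mod_cast hd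
  have hd0 : (0:ℝ) < d := by linarith
  have hl1 : ∀ n ω, 1 ≤ ℓ n ω := fun n ω => by
    rw [hℓ]; linarith [Finset.sum_nonneg fun k (_ : k ∈ range n) => hf0 k ω]
  have hls : ∀ n ω, ℓ (n + 1) ω = ℓ n ω + f n ω := fun n ω => by
    rw [hℓ, hℓ, Finset.sum_range_succ]; ring
  have hlm : ∀ n ω, ℓ n ω ≤ ℓ (n + 1) ω := fun n ω => by rw [hls]; linarith [hf0 n ω]
  have hl2 : ∀ n ω, ℓ (n + 1) ω ≤ 2 * ℓ n ω := fun n ω => by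
    rw [hls]; linarith [hf1 n ω, hl1 n ω]
  have hlM : ∀ n, StronglyMeasurable[F n] (ℓ n) := by
    intro n
    have e : ℓ n = fun ω => 1 + ∑ k ∈ range n, f k ω := funext fun ω => hℓ n ω
    rw [e]
    refine sm_add (sm_const 1) ?_
    refine Finset.stronglyMeasurable_fun_sum _ fun k hk => ?_
    exact (hfm k).mono (F.mono (Finset.mem_range.1 hk).le)
  have hBV : ∀ k ω, B k ω ^ 2 ≤ 4 * (V k ω - h k ω) * f k ω := fun k ω => by
    rw [hBe]; nlinarith [hhf k ω]
  obtain ⟨η, hη, hη1, hap⟩ := apriori hN hp ha m f' B' ℓ hmm hf'm hB'm hm hf'0 hf'1 hB' hmr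
    hlM hl1 hlm hl2
  have tV := fun n (hn : n < p) => mainlem hN ha n hn hη hη1 V h f B ℓ hVm hhm hfm hBm hV hh hhf
    hf0 hf1 hBV hVr hlM hl1 hlm hl2
  have tm := fun n (hn : n < p) => mainlem hN ha n hn hη hη1 m (fun k ω => f' k ω * m k ω) f' B' ℓ
    hmm (fun n => sm_mul (hf'm n) (hmm n)) hf'm hB'm hm
    (fun k ω => mul_nonneg (hf'0 k ω) (hm k ω)) (fun k ω => le_rfl) hf'0 hf'1
    (fun k ω => by have := hB' k ω; linarith) (fun k ω => by rw [hmr]; ring) hlM hl1 hlm hl2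
  have tV' := ae_all_iff.2 fun n => ae_all_iff.2 fun hn => tV n hn
  have tm' := ae_all_iff.2 fun n => ae_all_iff.2 fun hn => tm n hn
  filter_upwards [hap, tV', tm', hft, hδ, hlt, hl0] with ω hap tV tm hft hδ hlt hl0
  have hBf : BO (fun n => f n ω) (fun n => ℓ n ω) := bo_of_tendsto (fun k => hl1 k ω) hl0
  have hff : ∀ᶠ k in atTop, f' k ω ≤ 2 * f k ω := by
    filter_upwards [hδ.eventually (gt_mem_nhds (show (0:ℝ) < 1 / 2 by norm_num))] with k hk
    have h1 := (abs_le.1 (hδf k ω)).1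
    have h2 := hf'0 k ω
    have h3 : 0 ≤ d * f' k ω := by positivity
    nlinarith
  have hBf' : BO (fun n => f' n ω) (fun n => ℓ n ω) :=
    bo_mono (fun k => hf0 k ω) (fun k => hl1 k ω) hBf 2 hff
  have hf't : Tendsto (fun n => f' n ω) atTop (𝓝 0) := by
    refine squeeze_zero' (Eventually.of_forall fun k => hf'0 k ω) hff ?_
    simpa using hft.const_mul 2
  obtain ⟨C, hC⟩ := hap hBf'
  have hlη : ∀ k, 1 ≤ ℓ k ω ^ (1 - η) := fun k => Real.one_le_rpow (hl1 k ω) (by linarith)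
  have hbm : ∀ n, n < p → ∀ k, m k ω ^ (n + 1) ≤ (1 + C) * ℓ k ω ^ (1 - η) := by
    intro n hn k
    have h1 : m k ω ^ (n + 1) ≤ 1 + m k ω ^ p := by
      rcases le_total (m k ω) 1 with h | h
      · linarith [pow_le_one₀ (n := n + 1) (hm k ω) h, pow_nonneg (hm k ω) p]
      · linarith [pow_le_pow_right₀ h (show n + 1 ≤ p from hn)]
    linarith [hC k, hlη k]
  obtain ⟨Δ, hΔ⟩ := hδ.bddAbove_range
  have hVK : ∀ k, V k ω ≤ ((1 + |Δ|) * d) * m k ω := by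
    intro k
    have h1 := (abs_le.1 (hδV k ω)).2
    have h2 : δ k ω ≤ |Δ| := (hΔ ⟨k, rfl⟩).trans (le_abs_self _)
    have h3 : 0 ≤ d * m k ω := mul_nonneg hd0.le (hm k ω)
    nlinarith
  have hbV : ∀ n, n < p → ∀ k, V k ω ^ (n + 1) ≤
      (((1 + |Δ|) * d) ^ (n + 1) * (1 + C)) * ℓ k ω ^ (1 - η) := by
    intro n hn k
    calc V k ω ^ (n + 1) ≤ (((1 + |Δ|) * d) * m k ω) ^ (n + 1) :=
          pow_le_pow_left₀ (hV k ω) (hVK k) _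
      _ = ((1 + |Δ|) * d) ^ (n + 1) * m k ω ^ (n + 1) := mul_pow _ _ _
      _ ≤ ((1 + |Δ|) * d) ^ (n + 1) * ((1 + C) * ℓ k ω ^ (1 - η)) := by
          gcongr; exact hbm n hn k
      _ = _ := by ring
  have hA := assembly p d hd (σ ^ 2) (fun k => V k ω) (fun k => f k ω) (fun k => h k ω)
    (fun k => B k ω) (fun k => m k ω) (fun k => f' k ω) (fun k => B' k ω) (fun k => δ k ω)
    (fun k => ℓ k ω) (fun k => hV k ω) (fun k => hh k ω) (fun k => hhf k ω) (fun k => hf0 k ω)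
    (fun k => hf1 k ω) hft (fun k => hBe k ω) (fun k => hBV k ω) (fun k => hm k ω)
    (fun k => hf'0 k ω) (fun k => hf'1 k ω) hf't (fun k => hB' k ω) hδ (fun k => hδf k ω)
    (fun k => hδV k ω) (fun k => hδB k ω) hlt (fun k => hl1 k ω) hl0
    (fun n hn hbo => tV n hn hft hlt hBf hbo ⟨_, hbV n hn⟩)
    (fun n hn hbo => tm n hn hf't hlt hBf' hbo ⟨_, hbm n hn⟩)
  have hfin := (hA (p - 1) (by omega)).2
  have h2 := ratB (y := fun k => h k ω * (d * m k ω) ^ (p - 1))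
    (fun k => mul_nonneg (hh k ω) (pow_nonneg (hV k ω) _))
    (fun k => mul_nonneg (hh k ω) (pow_nonneg (mul_nonneg hd0.le (hm k ω)) _))
    hlt (fun k => hl1 k ω) (tend_one_add_pow hδ (p - 1)) (Eventually.of_forall fun k => by
      have h1 := relpow (mul_nonneg hd0.le (hm k ω)) (hδV k ω) (p - 1)
      rw [← mul_sub, abs_mul, abs_of_nonneg (hh k ω)]
      calc _ ≤ h k ω * _ := mul_le_mul_of_nonneg_left h1 (hh k ω)
        _ = _ := by ring) hfin
  refine (h2.const_mul (1 / (d:ℝ) ^ (p - 1))).congr fun N => ?_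
  rw [← mul_div_assoc, Finset.mul_sum]
  congr 1
  refine Finset.sum_congr rfl fun k _ => ?_
  rw [mul_pow]; field_simp
end partY

lemma smq {Ω : Type*} {m : MeasurableSpace Ω} {d : ℕ} {N : Ω → Matrix (Fin d) (Fin d) ℝ}
    {x y : Ω → Fin d → ℝ} (hN : StronglyMeasurable N) (hx : StronglyMeasurable x)
    (hy : StronglyMeasurable y) : StronglyMeasurable (fun ω => x ω ⬝ᵥ (N ω *ᵥ y ω)) := by
  have hc : Continuous fun z : (Fin d → ℝ) × Matrix (Fin d) (Fin d) ℝ × (Fin d → ℝ) =>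
      z.1 ⬝ᵥ (z.2.1 *ᵥ z.2.2) :=
    Continuous.dotProduct continuous_fst
      (Continuous.matrix_mulVec (continuous_fst.comp continuous_snd)
        (continuous_snd.comp continuous_snd))
  exact hc.comp_stronglyMeasurable (hx.prodMk (hN.prodMk hy))

lemma sminv {Ω : Type*} {m : MeasurableSpace Ω} {d : ℕ} {N : Ω → Matrix (Fin d) (Fin d) ℝ}
    (hN : StronglyMeasurable N) : StronglyMeasurable (fun ω => (N ω)⁻¹) := by
  simp only [Matrix.inv_def, Ring.inverse_eq_inv']
  have h1 : StronglyMeasurable (fun ω => (N ω).det) :=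
    (continuous_id.matrix_det).comp_stronglyMeasurable hN
  have h2 : StronglyMeasurable (fun ω => (N ω).adjugate) :=
    (continuous_id.matrix_adjugate).comp_stronglyMeasurable hN
  exact (h1.measurable.inv.stronglyMeasurable).smul h2

lemma smtr {Ω : Type*} {m : MeasurableSpace Ω} {d : ℕ} (K : Matrix (Fin d) (Fin d) ℝ)
    {N : Ω → Matrix (Fin d) (Fin d) ℝ}
    (hN : StronglyMeasurable N) : StronglyMeasurable (fun ω => (K * N ω).trace) := by
  have : Continuous fun X : Matrix (Fin d) (Fin d) ℝ => (K * X).trace := by fun_prop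
  exact this.comp_stronglyMeasurable hN

lemma smvv {Ω : Type*} {m : MeasurableSpace Ω} {d : ℕ} {x : Ω → Fin d → ℝ}
    (hx : StronglyMeasurable x) : StronglyMeasurable (fun ω => vecMulVec (x ω) (x ω)) := by
  have : Continuous fun z : Fin d → ℝ => vecMulVec z z :=
    Continuous.matrix_vecMulVec continuous_id continuous_id
  exact this.comp_stronglyMeasurable hx

/-- **Theorem 2, first part**: convergence of the even moments in the ASCLT for
vector martingale transforms. -/
theorem key_lemma_second_part
    {Ω : Type*} {m0 : MeasurableSpace Ω} {μ : Measure Ω} [IsProbabilityMeasure μ]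
    (F : Filtration ℕ m0) {d : ℕ} (hd : 0 < d)
    (ε : ℕ → Ω → ℝ) (Φ : ℕ → Ω → Fin d → ℝ) (M0 : Ω → Fin d → ℝ)
    (S L Lhalf : Matrix (Fin d) (Fin d) ℝ) (hS : S.PosDef) (hL : L.PosDef)
    (hLhalf : Lhalf.PosDef) (hLhalfsq : Lhalf * Lhalf = L)
    (σ : ℝ) (p : ℕ) (hp : 1 ≤ p) (a : ℝ) (ha : 2 * p < a)
    (α : ℕ → Ω → ℝ)
    (hεadapt : ∀ n, StronglyMeasurable[F n] (ε n))
    (hεint : ∀ n, Integrable (ε n) μ)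
    (hΦadapt : ∀ n, StronglyMeasurable[F n] (Φ n))
    (hM0 : StronglyMeasurable[F 0] M0)
    (hmds : ∀ n, μ[ε (n + 1)|F n] =ᵐ[μ] 0)
    (hvar : ∀ n, μ[fun ω => ε (n + 1) ω ^ 2|F n] =ᵐ[μ] fun _ => σ ^ 2)
    (hmomint : ∀ n, Integrable (fun ω => |ε (n + 1) ω| ^ a) μ)
    (hmom : ∀ᵐ ω ∂μ, ∃ C : ℝ, ∀ n, (μ[fun ω => |ε (n + 1) ω| ^ a|F n]) ω ≤ C)
    (hf0 : ∀ᵐ ω ∂μ, Tendsto (fun n => expl S Φ n ω) atTop (𝓝 0))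
    (hαmeas : ∀ n, Measurable (α n))
    (hαpos : ∀ n ω, 0 < α n ω)
    (hαmono : ∀ᵐ ω ∂μ, Monotone fun n => α n ω)
    (hαtop : ∀ᵐ ω ∂μ, Tendsto (fun n => α n ω) atTop atTop)
    (hconv : ∀ᵐ ω ∂μ, Tendsto (fun n => (α n ω)⁻¹ • Smat S Φ n ω) atTop (𝓝 L)) :
    let β : ℕ → Ω → ℝ := fun n ω => (Lhalf⁻¹ * Smat S Φ n ω * Lhalf⁻¹).trace
    let mseq : ℕ → Ω → ℝ :=
      fun n ω => (β (n - 1) ω)⁻¹ * (Mart M0 Φ ε n ω ⬝ᵥ (L⁻¹ *ᵥ Mart M0 Φ ε n ω))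
    let g : ℕ → Ω → ℝ := fun n ω => Mart M0 Φ ε n ω ⬝ᵥ ((Smat S Φ (n - 1) ω)⁻¹ *ᵥ Φ n ω)
    ∀ᵐ ω ∂μ, Tendsto (fun n =>
      (Real.log ((Smat S Φ n ω).det))⁻¹ *
        ∑ k ∈ Finset.Icc 1 n, (1 - expl S Φ k ω) * g k ω ^ 2 * mseq k ω ^ (p - 1))
      atTop (𝓝 ((p : ℝ) / (d : ℝ) * elllim d p σ / ((p : ℝ) * (d : ℝ) ^ (p - 1)))) := by
  intro β mseq g
  have hd1 : (1:ℝ) ≤ d := by exact_mod_cast hd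
  have hd0 : (0:ℝ) < d := by linarith
  have hp1 : (1:ℝ) ≤ p := by exact_mod_cast hp
  have hN : Noise μ F ε σ a := ⟨hεadapt, hmds, hvar, hmomint, hmom, by linarith⟩
  let P : ℕ → Ω → Matrix (Fin d) (Fin d) ℝ := fun n ω =>
    S + ∑ k ∈ Finset.range n, vecMulVec (Φ k ω) (Φ k ω)
  let X : ℕ → Ω → Fin d → ℝ := Mart M0 Φ ε
  have hSP : ∀ n ω, Smat S Φ n ω = P (n + 1) ω := fun n ω => rfl
  have hPs : ∀ n ω, P (n + 1) ω = P n ω + vecMulVec (Φ n ω) (Φ n ω) := fun n ω => by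
    simp only [P]; rw [Finset.sum_range_succ, add_assoc]
  have hP : ∀ n ω, (P n ω).PosDef := by
    intro n ω
    induction n with
    | zero => simpa [P] using hS
    | succ n ih => rw [hPs]; exact r1_pd ih _
  have hXs : ∀ n ω, X (n + 1) ω = X n ω + ε (n + 1) ω • Φ n ω := fun n ω => by
    simp only [X, Mart]; rw [Finset.sum_range_succ, add_assoc]
  have hPm : ∀ n, StronglyMeasurable[F n] (P n) := by
    intro n
    refine StronglyMeasurable.add stronglyMeasurable_const ?_
    refine Finset.stronglyMeasurable_fun_sum _ fun k hk => ?_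
    exact smvv ((hΦadapt k).mono (F.mono (Finset.mem_range.1 hk).le))
  have hPm' : ∀ n, StronglyMeasurable[F n] (P (n + 1)) := by
    intro n
    refine StronglyMeasurable.add stronglyMeasurable_const ?_
    refine Finset.stronglyMeasurable_fun_sum _ fun k hk => ?_
    exact smvv ((hΦadapt k).mono (F.mono (Nat.lt_succ_iff.1 (Finset.mem_range.1 hk))))
  have hXm : ∀ n, StronglyMeasurable[F n] (X n) := by
    intro n
    refine StronglyMeasurable.add (hM0.mono (F.mono (Nat.zero_le n))) ?_
    refine Finset.stronglyMeasurable_fun_sum _ fun k hk => ?_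
    have hk := Finset.mem_range.1 hk
    exact StronglyMeasurable.smul ((hεadapt (k + 1)).mono (F.mono hk))
      ((hΦadapt k).mono (F.mono hk.le))
  let b : ℕ → Ω → ℝ := fun n ω => (L⁻¹ * P n ω).trace
  have hb : ∀ n ω, 0 < b n ω := fun n ω => tr_pos hd hLhalf (hP n ω) hLhalfsq
  let φ : ℕ → Ω → ℝ := fun n ω => Φ n ω ⬝ᵥ (L⁻¹ *ᵥ Φ n ω)
  have hbs : ∀ n ω, b (n + 1) ω = b n ω + φ n ω := fun n ω => by
    simp only [b, φ]; rw [hPs, Matrix.mul_add, Matrix.trace_add, tr_vmv]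
  let f : ℕ → Ω → ℝ := fun n ω => Φ n ω ⬝ᵥ ((P (n + 1) ω)⁻¹ *ᵥ Φ n ω)
  let V : ℕ → Ω → ℝ := fun n ω => X n ω ⬝ᵥ ((P n ω)⁻¹ *ᵥ X n ω)
  let G : ℕ → Ω → ℝ := fun n ω => X n ω ⬝ᵥ ((P n ω)⁻¹ *ᵥ Φ n ω)
  let h : ℕ → Ω → ℝ := fun n ω => (1 - f n ω) * G n ω ^ 2
  let B : ℕ → Ω → ℝ := fun n ω => 2 * (X n ω ⬝ᵥ ((P (n + 1) ω)⁻¹ *ᵥ Φ n ω))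
  let m : ℕ → Ω → ℝ := fun n ω => (b n ω)⁻¹ * (X n ω ⬝ᵥ (L⁻¹ *ᵥ X n ω))
  let f' : ℕ → Ω → ℝ := fun n ω => φ n ω / (b n ω + φ n ω)
  let B' : ℕ → Ω → ℝ := fun n ω => 2 * (X n ω ⬝ᵥ (L⁻¹ *ᵥ Φ n ω)) / (b n ω + φ n ω)
  let ℓ : ℕ → Ω → ℝ := fun n ω => 1 + ∑ k ∈ range n, f k ω
  let δ : ℕ → Ω → ℝ := fun n ω => dl L (P n ω) + dl L (P (n + 1) ω) +
    (4 * dl L (P (n + 1) ω) ^ 2 + 8 * d * dl L (P (n + 1) ω))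
  have hsV : ∀ n ω, 0 ≤ f n ω ∧ f n ω < 1 ∧ 0 ≤ V n ω ∧ (1 - f n ω) * G n ω ^ 2 ≤ f n ω * V n ω ∧
      X n ω ⬝ᵥ ((P (n + 1) ω)⁻¹ *ᵥ Φ n ω) = (1 - f n ω) * G n ω ∧
      (P n ω).det = (P (n + 1) ω).det * (1 - f n ω) ∧
      (∀ e : ℝ, (X n ω + e • Φ n ω) ⬝ᵥ ((P (n + 1) ω)⁻¹ *ᵥ (X n ω + e • Φ n ω)) =
        (V n ω - (1 - f n ω) * G n ω ^ 2) + (2 * ((1 - f n ω) * G n ω)) * e + f n ω * e ^ 2) := by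
    intro n ω
    have := stepV (hP n ω) (Φ n ω) (X n ω)
    rw [← hPs] at this
    exact this
  have hsm := fun n ω => stepm hL.inv (Φ n ω) (X n ω) (hb n ω)
  have hcm : ∀ n ω, |f n ω - d * f' n ω| ≤ dl L (P (n + 1) ω) * f' n ω ∧
      |V n ω - d * m n ω| ≤ dl L (P n ω) * m n ω ∧
      |B n ω ^ 2 - (d * B' n ω) ^ 2| ≤
      (4 * dl L (P (n + 1) ω) ^ 2 + 8 * d * dl L (P (n + 1) ω)) * (f' n ω * m n ω) := by
    intro n ω
    have := cmpx (P := P n ω) hL (Φ n ω) (X n ω) (hb n ω) rfl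
    rw [← hPs] at this
    exact this
  have hfm : ∀ n, StronglyMeasurable[F n] (f n) := fun n =>
    smq (sminv (hPm' n)) (hΦadapt n) (hΦadapt n)
  have hVm : ∀ n, StronglyMeasurable[F n] (V n) := fun n =>
    smq (sminv (hPm n)) (hXm n) (hXm n)
  have hGm : ∀ n, StronglyMeasurable[F n] (G n) := fun n =>
    smq (sminv (hPm n)) (hXm n) (hΦadapt n)
  have hhm : ∀ n, StronglyMeasurable[F n] (h n) := fun n =>
    sm_mul (sm_sub (sm_const 1) (hfm n)) (sm_pow (hGm n) 2)
  have hBm : ∀ n, StronglyMeasurable[F n] (B n) := fun n =>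
    sm_mul (sm_const 2) (smq (sminv (hPm' n)) (hXm n) (hΦadapt n))
  have hbm : ∀ n, StronglyMeasurable[F n] (b n) := fun n => smtr _ (hPm n)
  have hφm : ∀ n, StronglyMeasurable[F n] (φ n) := fun n =>
    smq stronglyMeasurable_const (hΦadapt n) (hΦadapt n)
  have hmm : ∀ n, StronglyMeasurable[F n] (m n) := fun n =>
    sm_mul (hbm n).measurable.inv.stronglyMeasurable
      (smq stronglyMeasurable_const (hXm n) (hXm n))
  have hf'm : ∀ n, StronglyMeasurable[F n] (f' n) := fun n =>
    sm_div (hφm n) (sm_add (hbm n) (hφm n))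
  have hB'm : ∀ n, StronglyMeasurable[F n] (B' n) := fun n =>
    sm_div (sm_mul (sm_const 2) (smq stronglyMeasurable_const (hXm n) (hΦadapt n)))
      (sm_add (hbm n) (hφm n))
  have hlogd : ∀ᵐ ω ∂μ, (Tendsto (fun n => ℓ n ω) atTop atTop ∧
      Tendsto (fun n => (∑ k ∈ range n, f k ω) / ℓ n ω) atTop (𝓝 1) ∧
      Tendsto (fun n => Real.log (P n ω).det / ℓ n ω) atTop (𝓝 1)) ∧
      Tendsto (fun n => dl L (P n ω)) atTop (𝓝 0) := by
    filter_upwards [hf0, hαtop, hconv] with ω h1 h2 h3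
    obtain ⟨a1, a2⟩ := asym hd hL (fun n => P n ω) (fun n => hP n ω) (fun n => α n ω)
      (fun n => hαpos n ω) h2 h3
    exact ⟨logdet (fun k => (hsV k ω).1) (fun k => (hsV k ω).2.1) h1
      (fun k => (hP k ω).det_pos) (fun k => (hsV k ω).2.2.2.2.2.1) a2 (fun n => rfl), a1⟩
  have hδt : ∀ᵐ ω ∂μ, Tendsto (fun n => δ n ω) atTop (𝓝 0) := by
    filter_upwards [hlogd] with ω hω
    have h0 := hω.2
    have h1 : Tendsto (fun n => dl L (P (n + 1) ω)) atTop (𝓝 0) :=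
      (tendsto_add_atTop_iff_nat 1).2 h0
    have := (h0.add h1).add (((h1.pow 2).const_mul 4).add (h1.const_mul (8 * (d:ℝ))))
    simpa using this
  have hdn : ∀ n ω, 0 ≤ dl L (P n ω) := fun n ω => dl_nn hL
  have hcore := core hN hp ha hd V f h B m f' B' δ ℓ hVm hfm hhm hBm hmm hf'm hB'm
    (fun k ω => (hsV k ω).2.2.1)
    (fun k ω => mul_nonneg (by linarith [(hsV k ω).2.1]) (sq_nonneg _))
    (fun k ω => (hsV k ω).2.2.2.1) (fun k ω => (hsV k ω).1) (fun k ω => (hsV k ω).2.1.le)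
    (fun k ω => by simp only [B, h]; rw [(hsV k ω).2.2.2.2.1]; ring)
    (fun n ω => by
      have := (hsV n ω).2.2.2.2.2.2 (ε (n + 1) ω)
      rw [← hXs, ← (hsV n ω).2.2.2.2.1] at this
      exact this)
    (fun k ω => (hsm k ω).2.2.2.1) (fun k ω => (hsm k ω).2.1) (fun k ω => (hsm k ω).2.2.1)
    (fun k ω => (hsm k ω).2.2.2.2.1)
    (fun n ω => by
      have := (hsm n ω).2.2.2.2.2 (ε (n + 1) ω)
      rw [← hXs] at this
      simp only [m, hbs]
      exact this)
    (fun k ω => by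
      refine (hcm k ω).1.trans ?_
      have h1 := hdn k ω
      have h2 := hdn (k + 1) ω
      have h3 : 0 ≤ f' k ω := (hsm k ω).2.1
      refine le_trans (mul_le_mul_of_nonneg_right ?_ h3) (le_of_eq (mul_assoc _ _ _))
      have h4 : dl L (P (k + 1) ω) ≤ δ k ω := by
        simp only [δ]; nlinarith [mul_nonneg hd0.le h2]
      nlinarith)
    (fun k ω => by
      refine (hcm k ω).2.1.trans ?_
      have h1 := hdn k ω
      have h2 := hdn (k + 1) ω
      have h3 : 0 ≤ m k ω := (hsm k ω).2.2.2.1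
      refine le_trans (mul_le_mul_of_nonneg_right ?_ h3) (le_of_eq (mul_assoc _ _ _))
      have h4 : dl L (P k ω) ≤ δ k ω := by
        simp only [δ]; nlinarith [mul_nonneg hd0.le h2]
      nlinarith)
    (fun k ω => by
      refine (hcm k ω).2.2.trans ?_
      have h1 := hdn k ω
      have h2 := hdn (k + 1) ω
      have h3 : 0 ≤ f' k ω * m k ω := mul_nonneg (hsm k ω).2.1 (hsm k ω).2.2.2.1
      refine mul_le_mul_of_nonneg_right ?_ h3
      simp only [δ]; linarith)
    (fun n ω => rfl) hf0 hδt (hlogd.mono fun ω h => h.1.1) (hlogd.mono fun ω h => h.1.2.1)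
  filter_upwards [hcore, hlogd] with ω hc hl
  obtain ⟨⟨hl1, -, hl3⟩, -⟩ := hl
  have hl1' : ∀ n, 1 ≤ ℓ n ω := fun n => by
    simp only [ℓ]; linarith [Finset.sum_nonneg fun k (_ : k ∈ range n) => (hsV k ω).1]
  have h1 : Tendsto (fun N => (∑ k ∈ range N, h k ω * m k ω ^ (p - 1)
      - h 0 ω * m 0 ω ^ (p - 1)) / ℓ N ω) atTop
      (𝓝 (1 / (d:ℝ) ^ (p - 1) * bco d (σ ^ 2) (p - 1))) := by
    have := hc.sub (hl1.const_div_atTop (h 0 ω * m 0 ω ^ (p - 1)))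
    rw [sub_zero] at this
    exact this.congr fun N => by rw [sub_div]
  have h2 := h1.div hl3 one_ne_zero
  rw [div_one] at h2
  have h3 := (tendsto_add_atTop_iff_nat 1).2 h2
  have hval : 1 / (d:ℝ) ^ (p - 1) * bco d (σ ^ 2) (p - 1) =
      (p : ℝ) / (d : ℝ) * elllim d p σ / ((p : ℝ) * (d : ℝ) ^ (p - 1)) := by
    unfold bco elllim
    rw [Nat.sub_add_cancel hp, ← pow_mul]
    field_simp
  rw [← hval]
  refine h3.congr fun n => ?_
  have hs : ∑ k ∈ Finset.Icc 1 n, (1 - expl S Φ k ω) * g k ω ^ 2 * mseq k ω ^ (p - 1) =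
      ∑ k ∈ range (n + 1), h k ω * m k ω ^ (p - 1) - h 0 ω * m 0 ω ^ (p - 1) := by
    have e : ∑ k ∈ range (n + 1), h k ω * m k ω ^ (p - 1) =
        ∑ k ∈ Finset.Icc 1 n, h k ω * m k ω ^ (p - 1) + h 0 ω * m 0 ω ^ (p - 1) := by
      rw [Finset.sum_range_succ']
      congr 1
      rw [← Finset.sum_image (s := range n) (g := fun k => k + 1)
        (f := fun k => h k ω * m k ω ^ (p - 1)) (by intro a _ b _ hab; simpa using hab)]
      congr 1
      ext k
      simp only [Finset.mem_image, Finset.mem_range, Finset.mem_Icc]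
      constructor
      · rintro ⟨j, hj, rfl⟩; omega
      · intro hk; exact ⟨k - 1, by omega, by omega⟩
    rw [e, add_sub_cancel_right]
    refine Finset.sum_congr rfl fun k hk => ?_
    obtain ⟨j, rfl⟩ : ∃ j, k = j + 1 := ⟨k - 1, by have := (Finset.mem_Icc.1 hk).1; omega⟩
    have eβ : β j ω = b (j + 1) ω := tr_half hLhalfsq _
    have eg : g (j + 1) ω = G (j + 1) ω := rfl
    have em : mseq (j + 1) ω = m (j + 1) ω := by
      simp only [mseq, m, Nat.add_sub_cancel, eβ]; rfl
    rw [eg, em]; rfl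
  rw [hs, hSP]
  have hne : ℓ (n + 1) ω ≠ 0 := by linarith [hl1' (n + 1)]
  simp only [Pi.div_apply]
  rw [div_div_div_cancel_right₀ hne, div_eq_inv_mul]
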